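/- arXiv:math/0401343 — 6 statements merged into one kernel-verified Lean document; each statement's English description precedes it below -/
import Mathlib

section
/- For all topological spaces X and Y, c'(X × Y) ≤ (2^(c(X)·c(Y)))⁺, where the product X × Y carries the product topology. -/
universe u

open Cardinal

/-- `S` is a family of pairwise disjoint nonempty open subsets of `X`. -/
def IsCellularFamily {X : Type u} [TopologicalSpace X] (S : Set (Set X)) : Prop :=
  (∀ U ∈ S, IsOpen U ∧ U.Nonempty) ∧ S.PairwiseDisjoint id

/-- The cellularity `c(X)`: the supremum of the cardinalities of families of pairwise
disjoint nonempty open subsets of `X`. -/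
noncomputable def cellularity (X : Type u) [TopologicalSpace X] : Cardinal.{u} :=
  sSup {μ : Cardinal.{u} | ∃ S : Set (Set X), IsCellularFamily S ∧ #S = μ}

/-- `c'(X)`: the least cardinal `μ` such that `X` has no family of `μ` pairwise disjoint
nonempty open sets. -/
noncomputable def cellularity' (X : Type u) [TopologicalSpace X] : Cardinal.{u} :=
  sInf {μ : Cardinal.{u} | ¬ ∃ S : Set (Set X), IsCellularFamily S ∧ #S = μ}

open Set

/-- A ramification sequence towards `x`: the term at `i` is a point that differs from all earlier
terms and is related by `r` to each of them exactly as `x` is, whenever such a point exists. -/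
noncomputable def ramification {S I : Type u} [Nonempty S] [LinearOrder I] [WellFoundedLT I]
    (r : S → S → Prop) (x : S) (i : I) : S :=
  Classical.epsilon fun y => ∀ j : Iio i,
    y ≠ ramification r x j.1 ∧ (r (ramification r x j.1) y ↔ r (ramification r x j.1) x)
termination_by (wellFounded_lt (α := I)).wrap i
decreasing_by all_goals exact j.2

theorem ramification_congr {S I : Type u} [Nonempty S] [LinearOrder I] [WellFoundedLT I]
    (r : S → S → Prop) (x y : S) (i : I)
    (h : ∀ j < i, (r (ramification r x j) x ↔ r (ramification r y j) y)) :
    ramification r x i = ramification r y i := by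
  induction i using WellFoundedLT.induction with
  | ind i ih =>
    rw [ramification, ramification]
    congr 1
    funext z
    refine propext (forall_congr' fun j => ?_)
    rw [h j.1 j.2, ih j.1 j.2 fun k hk => h k (hk.trans j.2)]

theorem ramification_spec {S I : Type u} [Nonempty S] [LinearOrder I] [WellFoundedLT I]
    (r : S → S → Prop) (x : S) (hx : ∀ i : I, x ≠ ramification r x i) {j i : I} (hji : j < i) :
    ramification r x i ≠ ramification r x j ∧
      (r (ramification r x j) (ramification r x i) ↔ r (ramification r x j) x) := by
  have key := Classical.epsilon_spec (p := fun y => ∀ j : Iio i,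
    y ≠ ramification r x j.1 ∧ (r (ramification r x j.1) y ↔ r (ramification r x j.1) x))
    ⟨x, fun j => ⟨hx j, Iff.rfl⟩⟩
  rw [← ramification] at key
  exact key ⟨j, hji⟩

theorem mk_range_ramification_le {S I : Type u} [Nonempty S] [LinearOrder I] [WellFoundedLT I]
    (r : S → S → Prop) (i : I) :
    #(range fun x => ramification r x i) ≤ 2 ^ #(Iio i) := by
  rw [← mk_set]
  refine mk_le_of_injective
    (f := fun p => {j : Iio i | r (ramification r p.2.choose j.1) p.2.choose}) fun p q hpq => ?_
  refine Subtype.ext ?_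
  rw [← p.2.choose_spec, ← q.2.choose_spec]
  exact ramification_congr r _ _ i fun j hj => Set.ext_iff.1 hpq ⟨j, hj⟩

/-- The Erdős–Rado theorem `(2 ^ κ)⁺ → (κ⁺)²₂` for infinite `κ`. -/
theorem exists_homogeneous_of_two_power_lt {S : Type u} {κ : Cardinal.{u}} (hκ : ℵ₀ ≤ κ)
    (hS : 2 ^ κ < #S) (r : S → S → Prop) (hr : ∀ a b, r a b → r b a) :
    ∃ A : Set S, κ < #A ∧ (A.Pairwise r ∨ A.Pairwise fun a b => ¬ r a b) := by
  have : Nonempty S := mk_ne_zero_iff.1 (zero_le.trans_lt hS).ne'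
  let I : Type u := (Order.succ κ).ord.ToType
  have hI : #I = Order.succ κ := by simp [I]
  have hIio (i : I) : #(Iio i) ≤ κ :=
    Order.lt_succ_iff.1 ((mk_Iio_lt i (by simp [I])).trans_eq hI)
  obtain ⟨x, hx⟩ : ∃ x : S, x ∉ ⋃ i : I, range fun y => ramification r y i := by
    by_contra! h
    refine hS.not_ge ?_
    rw [← mk_univ, ← eq_univ_of_forall h]
    refine (mk_iUnion_le _).trans ?_
    have hpow : ℵ₀ ≤ (2 : Cardinal.{u}) ^ κ := hκ.trans (cantor κ).le
    refine (mul_le_mul' (hI.trans_le (Order.succ_le_of_lt (cantor κ)))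
      (ciSup_le' fun i => (mk_range_ramification_le r i).trans
        (power_le_power_left two_ne_zero (hIio i)))).trans ?_
    rw [mul_eq_self hpow]
  have hx' (i : I) : x ≠ ramification r x i := fun h =>
    hx (mem_iUnion.2 ⟨i, x, h.symm⟩)
  set a : I → S := ramification r x
  have hspec {j i : I} (hji : j < i) := ramification_spec r x hx' hji
  have hinj : Function.Injective a := by
    intro i j hij
    by_contra hne
    rcases lt_or_gt_of_ne hne with h | h
    · exact (hspec h).1 hij.symm
    · exact (hspec h).1 hij
  let T : Set I := {i | r (a i) x}
  have hT : κ < #T ∨ κ < #(Tᶜ : Set I) := by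
    by_contra! h
    have := mk_sum_compl T
    rw [hI] at this
    exact (Order.lt_succ κ).not_ge (this ▸ add_le_of_le hκ h.1 h.2)
  rcases hT with hT | hT
  · refine ⟨a '' T, by rwa [mk_image_eq hinj], Or.inl ?_⟩
    rintro _ ⟨i, hi, rfl⟩ _ ⟨j, hj, rfl⟩ hne
    rcases lt_or_gt_of_ne (ne_of_apply_ne a hne) with h | h
    · exact (hspec h).2.2 hi
    · exact hr _ _ ((hspec h).2.2 hj)
  · refine ⟨a '' Tᶜ, by rwa [mk_image_eq hinj], Or.inr ?_⟩
    rintro _ ⟨i, hi, rfl⟩ _ ⟨j, hj, rfl⟩ hne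
    rcases lt_or_gt_of_ne (ne_of_apply_ne a hne) with h | h
    · exact fun hij => hi ((hspec h).2.1 hij)
    · exact fun hij => hj ((hspec h).2.1 (hr _ _ hij))

/-- A form of the finite Ramsey theorem for two colours, with the bound `2 ^ (n * m)`. -/
theorem exists_homogeneous_finset {S : Type u} (r : S → S → Prop) (hr : ∀ a b, r a b → r b a)
    (n m : ℕ) (F : Finset S) (hF : 2 ^ (n * m) ≤ F.card) :
    ∃ A ⊆ F, (A.card = n + 1 ∧ (A : Set S).Pairwise r) ∨
      (A.card = m + 1 ∧ (A : Set S).Pairwise fun a b => ¬ r a b) := by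
  classical
  have hne : F.Nonempty := Finset.card_pos.1 ((Nat.two_pow_pos _).trans_le hF)
  obtain ⟨v, hv⟩ := hne
  induction n, m using Nat.pincerRecursion generalizing F v with
  | Ha0 n => exact ⟨{v}, by simpa using hv, Or.inr (by simp)⟩
  | H0b m => exact ⟨{v}, by simpa using hv, Or.inl (by simp)⟩
  | H n m ih₁ ih₂ =>
    simp only [Nat.succ_eq_add_one] at hF ih₁ ih₂ ⊢
    have hle : 2 ^ (n * (m + 1)) + 2 ^ ((n + 1) * m) ≤ 2 ^ ((n + 1) * (m + 1)) := by
      have h : (n + 1) * (m + 1) = (n * m + n + m) + 1 := by ring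
      rw [h, pow_succ, mul_two]
      exact add_le_add (Nat.pow_le_pow_right two_pos (by nlinarith))
        (Nat.pow_le_pow_right two_pos (by nlinarith))
    have hcard := Finset.card_filter_add_card_filter_not (s := F.erase v) (fun w => r v w)
    rw [Finset.card_erase_of_mem hv] at hcard
    have hcases : 2 ^ (n * (m + 1)) ≤ ((F.erase v).filter fun w => r v w).card ∨
        2 ^ ((n + 1) * m) ≤ ((F.erase v).filter fun w => ¬ r v w).card := by omega
    rcases hcases with h | h
    · obtain ⟨w, hw⟩ := Finset.card_pos.1 ((Nat.two_pow_pos _).trans_le h)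
      obtain ⟨A, hAF, hA⟩ := ih₁ _ h w hw
      have hAv (z) (hz : z ∈ A) : (z ≠ v ∧ z ∈ F) ∧ r v z := by simpa using hAF hz
      have hvA : v ∉ A := fun hvA => (hAv v hvA).1.1 rfl
      rcases hA with ⟨hA, hA'⟩ | hA
      · refine ⟨insert v A, Finset.insert_subset hv fun z hz => (hAv z hz).1.2, Or.inl ⟨?_, ?_⟩⟩
        · rw [Finset.card_insert_of_notMem hvA, hA]
        · rw [Finset.coe_insert]
          exact hA'.insert fun z hz _ => ⟨(hAv z hz).2, hr _ _ (hAv z hz).2⟩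
      · exact ⟨A, fun z hz => (hAv z hz).1.2, Or.inr hA⟩
    · obtain ⟨w, hw⟩ := Finset.card_pos.1 ((Nat.two_pow_pos _).trans_le h)
      obtain ⟨A, hAF, hA⟩ := ih₂ _ h w hw
      have hAv (z) (hz : z ∈ A) : (z ≠ v ∧ z ∈ F) ∧ ¬ r v z := by simpa using hAF hz
      have hvA : v ∉ A := fun hvA => (hAv v hvA).1.1 rfl
      rcases hA with hA | ⟨hA, hA'⟩
      · exact ⟨A, fun z hz => (hAv z hz).1.2, Or.inl hA⟩
      · refine ⟨insert v A, Finset.insert_subset hv fun z hz => (hAv z hz).1.2, Or.inr ⟨?_, ?_⟩⟩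
        · rw [Finset.card_insert_of_notMem hvA, hA]
        · rw [Finset.coe_insert]
          exact hA'.insert fun z hz _ => ⟨(hAv z hz).2, fun hzv => (hAv z hz).2 (hr _ _ hzv)⟩

theorem IsCellularFamily.mk_le_cellularity {X : Type u} [TopologicalSpace X] {S : Set (Set X)}
    (hS : IsCellularFamily S) : #S ≤ cellularity X := by
  refine le_csSup ⟨#(Set X), ?_⟩ ⟨S, hS, rfl⟩
  rintro _ ⟨S, -, rfl⟩
  exact mk_set_le S

theorem mk_le_cellularity_of_pairwise_disjoint {X ι : Type u} [TopologicalSpace X] {A : Set ι}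
    {U : ι → Set X} (hU : ∀ i ∈ A, IsOpen (U i) ∧ (U i).Nonempty)
    (hd : A.Pairwise fun i j => Disjoint (U i) (U j)) : #A ≤ cellularity X := by
  have hinj : InjOn U A := fun i hi j hj hij => by
    by_contra hne
    have h : Disjoint (U i) (U j) := hd hi hj hne
    rw [← hij, disjoint_self] at h
    exact (hU i hi).2.ne_empty h
  rw [← mk_image_eq_of_injOn U A hinj]
  refine IsCellularFamily.mk_le_cellularity ⟨?_, ?_⟩
  · rintro _ ⟨i, hi, rfl⟩
    exact hU i hi
  · rintro _ ⟨i, hi, rfl⟩ _ ⟨j, hj, rfl⟩ hne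
    exact hd hi hj (ne_of_apply_ne U hne)

theorem cellularity_ne_zero (X : Type u) [TopologicalSpace X] [Nonempty X] :
    cellularity X ≠ 0 := by
  have h : IsCellularFamily {(univ : Set X)} :=
    ⟨by simp [univ_nonempty], pairwiseDisjoint_singleton _ _⟩
  have := h.mk_le_cellularity
  rw [mk_singleton] at this
  exact (zero_lt_one.trans_le this).ne'

/-- Every cellular family in a product is dominated by `2 ^ (c(X) * c(Y))`. -/
theorem IsCellularFamily.mk_le_two_power_prod {X Y : Type u} [TopologicalSpace X]
    [TopologicalSpace Y] {S : Set (Set (X × Y))} (hS : IsCellularFamily S) :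
    #S ≤ 2 ^ (cellularity X * cellularity Y) := by
  by_contra! hlt
  have hbox (W : S) : ∃ (U : Set X) (V : Set Y), (IsOpen U ∧ U.Nonempty) ∧
      (IsOpen V ∧ V.Nonempty) ∧ U ×ˢ V ⊆ W.1 := by
    obtain ⟨hW, ⟨x, y⟩, hxy⟩ := hS.1 W.1 W.2
    obtain ⟨U, V, hU, hV, hx, hy, hUV⟩ := isOpen_prod_iff.1 hW x y hxy
    exact ⟨U, V, ⟨hU, x, hx⟩, ⟨hV, y, hy⟩, hUV⟩
  choose U V hU hV hUV using hbox
  have hdisj {W W' : S} (hne : W ≠ W') (h : ¬ Disjoint (U W) (U W')) :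
      Disjoint (V W) (V W') := by
    have hWW' : Disjoint W.1 W'.1 := hS.2 W.2 W'.2 (Subtype.coe_injective.ne hne)
    exact (disjoint_prod.1 (hWW'.mono (hUV W) (hUV W'))).resolve_left h
  have hfirst {A : Set S} (hA : A.Pairwise fun W W' => Disjoint (U W) (U W')) :
      #A ≤ cellularity X := mk_le_cellularity_of_pairwise_disjoint (fun W _ => hU W) hA
  have hsecond {A : Set S} (hA : A.Pairwise fun W W' => ¬ Disjoint (U W) (U W')) :
      #A ≤ cellularity Y := mk_le_cellularity_of_pairwise_disjoint (fun W _ => hV W)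
    fun W hW W' hW' hne => hdisj hne (hA hW hW' hne)
  have hsymm (W W' : S) (h : Disjoint (U W) (U W')) : Disjoint (U W') (U W) := h.symm
  obtain ⟨W⟩ : Nonempty S := mk_ne_zero_iff.1 (zero_le.trans_lt hlt).ne'
  have : Nonempty X := (hU W).2.nonempty
  have : Nonempty Y := (hV W).2.nonempty
  have hX := cellularity_ne_zero X
  have hY := cellularity_ne_zero Y
  rcases le_or_gt ℵ₀ (cellularity X * cellularity Y) with hinf | hfin
  · obtain ⟨A, hA, h | h⟩ := exists_homogeneous_of_two_power_lt hinf hlt _ hsymm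
    · exact (hA.trans_le (hfirst h)).not_ge (le_mul_right hY)
    · exact (hA.trans_le (hsecond h)).not_ge (le_mul_left hX)
  · obtain ⟨hXfin, hYfin⟩ := ((mul_lt_aleph0_iff.1 hfin).resolve_left hX).resolve_left hY
    obtain ⟨n, hn⟩ := lt_aleph0.1 hXfin
    obtain ⟨m, hm⟩ := lt_aleph0.1 hYfin
    obtain ⟨F, hF⟩ : ∃ F : Finset S, 2 ^ (n * m) = F.card := by
      refine exists_finset_eq_card ?_
      rw [hn, hm] at hlt
      exact_mod_cast hlt.le
    obtain ⟨A, -, ⟨hA, h⟩ | ⟨hA, h⟩⟩ := exists_homogeneous_finset _ hsymm n m F hF.le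
    · have := hfirst h
      rw [hn, Finset.coe_sort_coe, mk_coe_finset, hA, Nat.cast_le] at this
      omega
    · have := hsecond h
      rw [hm, Finset.coe_sort_coe, mk_coe_finset, hA, Nat.cast_le] at this
      omega

theorem stmt_0 (X Y : Type u) [TopologicalSpace X] [TopologicalSpace Y] :
    cellularity' (X × Y) ≤ Order.succ (2 ^ (cellularity X * cellularity Y)) := by
  refine csInf_le' ?_
  rintro ⟨S, hS, hcard⟩
  exact (Order.lt_succ _).not_ge (hcard ▸ hS.mk_le_two_power_prod)
end

section
/- Let κ be an infinite cardinal and let X, Y be topological spaces. If c'(X) ≤ (2^κ)⁺ and c'(Y) ≤ κ⁺, then c'(X × Y) ≤ (2^κ)⁺. -/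
universe u

open Cardinal

/-- Any set contains a maximal `r`-pairwise subset. -/
theorem exists_maximal_pairwise_subset {α : Type u} {r : α → α → Prop} (hr : ∀ a b, r a b → r b a)
    (P : Set α) :
    ∃ M ⊆ P, M.Pairwise r ∧ ∀ i ∈ P, i ∉ M → ∃ m ∈ M, ¬ r m i := by
  obtain ⟨M, hM⟩ := zorn_subset {M : Set α | M ⊆ P ∧ M.Pairwise r} (by
    intro c hc hchain
    refine ⟨⋃₀ c, ⟨Set.sUnion_subset fun s hs => (hc hs).1, ?_⟩,
      fun s hs => Set.subset_sUnion_of_mem hs⟩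
    exact (Set.pairwise_sUnion hchain.directedOn).2 fun s hs => (hc hs).2)
  refine ⟨M, hM.prop.1, hM.prop.2, fun i hi hiM => ?_⟩
  by_contra! h
  refine hiM (hM.le_of_ge (y := insert i M) ⟨Set.insert_subset hi hM.prop.1, ?_⟩
    (Set.subset_insert i M) (Set.mem_insert i M))
  exact hM.prop.2.insert fun m hm _ => ⟨hr m i (h m hm), h m hm⟩

/-- A set of at most `2 ^ κ` points closed under an operation sending sets of size at most `κ`
to sets of size at most `2 ^ κ`. -/
theorem exists_closed_set_card_le {α : Type u} {κ : Cardinal.{u}} (hκ : ℵ₀ ≤ κ)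
    (M : Set α → Set α) (hM : ∀ A, #(M A) ≤ 2 ^ κ) :
    ∃ J : Set α, #J ≤ 2 ^ κ ∧ ∀ A ⊆ J, #A ≤ κ → M A ⊆ J := by
  classical
  have hκ2 : ℵ₀ ≤ (2 : Cardinal.{u}) ^ κ := hκ.trans (cantor κ).le
  let L : Type u := Quotient.out ((2 : Cardinal.{u}) ^ κ)
  let K : Type u := Quotient.out κ
  have hL : #L = 2 ^ κ := mk_out _
  have hK : #K = κ := mk_out _
  have hemb : ∀ A, Nonempty (M A ↪ L) := fun A => by
    rw [← Cardinal.le_def, hL]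
    exact hM A
  let emb : ∀ A, M A ↪ L := fun A => (hemb A).some
  let β : Option L → Type u := fun o => o.elim PEmpty fun _ => K
  let decode : Set α → L → Option α := fun A l =>
    if h : ∃ x : M A, emb A x = l then some h.choose.1 else none
  have hdecode : ∀ A (x : M A), decode A (emb A x) = some x.1 := fun A x => by
    have h : ∃ y : M A, emb A y = emb A x := ⟨x, rfl⟩
    simp only [decode, dif_pos h]
    rw [(emb A).injective h.choose_spec]
  let ev : WType β → Option α := WType.elim (Option α) fun p =>
    match p with
    | ⟨none, _⟩ => none
    | ⟨some l, f⟩ => decode {x | ∃ k : K, f k = some x} l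
  have hW : #(WType β) ≤ 2 ^ κ := by
    refine WType.cardinalMk_le_of_le ?_
    refine (Cardinal.sum_le_sum _ (fun _ => 2 ^ κ) ?_).trans ?_
    · rintro (_ | l)
      · simpa [β] using one_le_aleph0.trans hκ2
      · simp only [β, Option.elim, hK]
        rw [← power_mul, mul_eq_self hκ]
    · rw [Cardinal.sum_const', mk_option, hL, add_one_eq hκ2, mul_eq_self hκ2]
  refine ⟨{x | some x ∈ Set.range ev}, ?_, ?_⟩
  · refine le_trans ?_ hW
    choose g hg using fun x : {x | some x ∈ Set.range ev} => x.2
    refine mk_le_of_injective (f := g) fun x y hxy => Subtype.ext (Option.some_injective _ ?_)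
    rw [← hg x, ← hg y, hxy]
  · intro A hAJ hA x hx
    have hAK : Nonempty (A ↪ K) := by
      rw [← Cardinal.le_def, hK]
      exact hA
    obtain ⟨e⟩ := hAK
    choose g hg using fun a : A => hAJ a.2
    let f : K → WType β := fun k =>
      if h : ∃ a : A, e a = k then g h.choose else WType.mk none PEmpty.elim
    have hf : {x | ∃ k : K, ev (f k) = some x} = A := by
      ext y
      constructor
      · rintro ⟨k, hk⟩
        by_cases h : ∃ a : A, e a = k
        · simp only [f, dif_pos h, hg] at hk
          exact Option.some_injective _ hk ▸ h.choose.2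
        · simp only [f, dif_neg h] at hk
          simp [ev, WType.elim] at hk
      · intro hy
        have h : ∃ a : A, e a = e ⟨y, hy⟩ := ⟨_, rfl⟩
        refine ⟨e ⟨y, hy⟩, ?_⟩
        simp only [f, dif_pos h, hg]
        rw [e.injective h.choose_spec]
    refine ⟨WType.mk (some (emb A ⟨x, hx⟩)) f, ?_⟩
    change decode {x | ∃ k : K, ev (f k) = some x} _ = _
    rw [hf, hdecode]

/-- The Erdős–Rado partition relation `(2 ^ κ)⁺ → ((2 ^ κ)⁺, κ⁺)²`. -/
theorem exists_large_pairwise_not_or_pairwise {α : Type u} {κ : Cardinal.{u}} (hκ : ℵ₀ ≤ κ)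
    (hα : Order.succ (2 ^ κ) ≤ #α) {r : α → α → Prop} (hr : ∀ a b, r a b → r b a) :
    (∃ S : Set α, Order.succ (2 ^ κ) ≤ #S ∧ S.Pairwise fun a b => ¬ r a b) ∨
      ∃ S : Set α, Order.succ κ ≤ #S ∧ S.Pairwise r := by
  by_contra! ⟨hlarge, hsmall⟩
  choose M hMP hMr hMmax using fun A : Set α =>
    exists_maximal_pairwise_subset (r := fun a b => ¬ r a b) (fun a b h h' => h (hr b a h'))
      {x | x ∉ A ∧ ∀ a ∈ A, r a x}
  obtain ⟨J, hJ, hJM⟩ := exists_closed_set_card_le hκ M fun A =>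
    Order.lt_succ_iff.1 (lt_of_not_ge fun h => hlarge _ h (hMr A))
  obtain ⟨i, hi⟩ : ∃ i, i ∉ J := by
    by_contra! h
    rw [Set.eq_univ_of_forall h, mk_univ] at hJ
    exact (Order.lt_succ _).not_ge (hα.trans hJ)
  obtain ⟨A, hAP, hAr, hAmax⟩ := exists_maximal_pairwise_subset hr {j | j ∈ J ∧ r j i}
  have hA : #A ≤ κ := Order.lt_succ_iff.1 (lt_of_not_ge fun h => hsmall _ h hAr)
  have hMJ : M A ⊆ J := hJM A (fun a ha => (hAP ha).1) hA
  obtain ⟨m, hm, hmi⟩ := hMmax A i ⟨fun h => hi (hAP h).1, fun a ha => (hAP ha).2⟩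
    fun h => hi (hMJ h)
  obtain ⟨a, ha, ham⟩ := hAmax m ⟨hMJ hm, not_not.1 hmi⟩ (hMP A hm).1
  exact ham ((hMP A hm).2 a ha)

/-- There is no family of at least `c'(X)` pairwise disjoint nonempty open sets. -/
theorem mk_lt_of_cellularity'_le {X ι : Type u} [TopologicalSpace X] {μ : Cardinal.{u}}
    (hX : cellularity' X ≤ μ) {U : ι → Set X} {S : Set ι}
    (hU : ∀ i ∈ S, IsOpen (U i) ∧ (U i).Nonempty) (hS : S.PairwiseDisjoint U) : #S < μ := by
  by_contra! h
  have hne : {μ : Cardinal.{u} | ¬ ∃ S : Set (Set X), IsCellularFamily S ∧ #S = μ}.Nonempty := by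
    refine ⟨Order.succ #(Set X), ?_⟩
    rintro ⟨T, -, hT⟩
    exact (Order.lt_succ _).not_ge (hT ▸ mk_set_le T)
  refine csInf_mem hne ?_
  obtain ⟨T, hTS, hT⟩ := le_mk_iff_exists_subset.1 (hX.trans h)
  have hinj : T.InjOn U := fun i hi j hj hij => by
    by_contra hne
    have hd := hS (hTS hi) (hTS hj) hne
    rw [Function.onFun, ← hij, disjoint_self] at hd
    exact (hU i (hTS hi)).2.ne_empty hd
  refine ⟨U '' T, ⟨?_, ?_⟩, (mk_image_eq_of_injOn _ _ hinj).trans hT⟩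
  · rintro _ ⟨i, hi, rfl⟩
    exact hU i (hTS hi)
  · rintro _ ⟨i, hi, rfl⟩ _ ⟨j, hj, rfl⟩ hij
    exact hS (hTS hi) (hTS hj) fun h => hij (h ▸ rfl)

theorem stmt_1 (κ : Cardinal.{u}) (hκ : ℵ₀ ≤ κ)
    (X Y : Type u) [TopologicalSpace X] [TopologicalSpace Y]
    (hX : cellularity' X ≤ Order.succ (2 ^ κ)) (hY : cellularity' Y ≤ Order.succ κ) :
    cellularity' (X × Y) ≤ Order.succ (2 ^ κ) := by
  refine csInf_le' ?_
  rintro ⟨F, ⟨hF, hdisj⟩, hcard⟩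
  have hbox : ∀ W : F, ∃ (U : Set X) (V : Set Y), (IsOpen U ∧ U.Nonempty) ∧
      (IsOpen V ∧ V.Nonempty) ∧ U ×ˢ V ⊆ W.1 := by
    rintro ⟨W, hW⟩
    obtain ⟨hWo, ⟨x, y⟩, hxy⟩ := hF W hW
    obtain ⟨U, V, hU, hV, hx, hy, hUV⟩ := isOpen_prod_iff.1 hWo x y hxy
    exact ⟨U, V, ⟨hU, x, hx⟩, ⟨hV, y, hy⟩, hUV⟩
  choose U V hU hV hUV using hbox
  rcases exists_large_pairwise_not_or_pairwise hκ hcard.ge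
      (r := fun W W' : F => Disjoint (V W) (V W')) (fun _ _ h => h.symm) with
    ⟨S, hS, hSr⟩ | ⟨S, hS, hSr⟩
  · refine (mk_lt_of_cellularity'_le hX (fun W _ => hU W) fun W hW W' hW' hne => ?_).not_ge hS
    have hd : Disjoint (U W ×ˢ V W) (U W' ×ˢ V W') :=
      (hdisj W.2 W'.2 fun h => hne (Subtype.ext h)).mono (hUV W) (hUV W')
    exact (Set.disjoint_prod.1 hd).resolve_right (hSr hW hW' hne)
  · exact (mk_lt_of_cellularity'_le hY (fun W _ => hV W) hSr).not_ge hS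
end

section
/- Let κ be a strong limit cardinal and let X, Y be topological spaces. If c'(X) ≤ κ⁺ and c'(Y) ≤ cf(κ), then c'(X × Y) ≤ κ⁺. -/
universe u

open Cardinal

/-- If `κ` is a strong limit and `μ < cf κ`, then `κ ^ μ ≤ κ`. -/
theorem Cardinal.IsStrongLimit.power_le_self {κ μ : Cardinal.{u}} (hκ : κ.IsStrongLimit)
    (hμ : μ < κ.ord.cof) : κ ^ μ ≤ κ := by
  induction κ using Cardinal.inductionOn with | _ K
  induction μ using Cardinal.inductionOn with | _ M
  have hmul : #(M × K) ≤ #K := by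
    rw [← mul_def]
    exact (mul_le_mul_left (hμ.le.trans (Ordinal.cof_ord_le _)) _).trans_eq
      (mul_eq_self hκ.aleph0_le)
  obtain ⟨e⟩ := hmul
  rw [power_def]
  conv_rhs => rw [← mk_subset_mk_lt_cof hκ.isStrongPrelimit]
  refine mk_le_of_injective
    (f := fun g : M → K => ⟨Set.range fun m => e (m, g m), mk_range_le.trans_lt hμ⟩) ?_
  intro g g' h
  funext m
  have hm : e (m, g m) ∈ Set.range fun m => e (m, g' m) :=
    (congrArg Subtype.val h).subset ⟨m, rfl⟩
  obtain ⟨m', hm'⟩ := hm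
  have h' := e.injective hm'
  simp only [Prod.mk.injEq] at h'
  obtain ⟨rfl, h'⟩ := h'
  exact h'.symm

/-- An operation on sets of size less than `cf κ`, with values of size at most `κ`,
has a closed set of size at most `κ`, for `κ` a strong limit. -/
theorem Cardinal.IsStrongLimit.exists_closed_set {κ : Cardinal.{u}} (hκ : κ.IsStrongLimit)
    {I : Type u} (Φ : Set I → Set I) (hΦ : ∀ S, #(Φ S) ≤ κ) :
    ∃ A : Set I, #A ≤ κ ∧ ∀ S ⊆ A, #S < κ.ord.cof → Φ S ⊆ A := by
  cases isEmpty_or_nonempty I with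
  | inl _ => exact ⟨∅, by simp, fun S _ _ x => isEmptyElim x⟩
  | inr hI =>
  obtain ⟨i₀⟩ := hI
  induction κ using Cardinal.inductionOn with | _ K
  have hcover : ∀ S, ∃ e : K → I, Φ S ⊆ Set.range e := by
    intro S
    obtain ⟨f⟩ := hΦ S
    refine ⟨Function.extend f Subtype.val fun _ => i₀, fun x hx => ⟨f ⟨x, hx⟩, ?_⟩⟩
    rw [f.injective.extend_apply]
  choose e he using hcover
  let α := {s : Set K // #s < (#K).ord.cof} × K
  let β : α → Type u := fun a => a.1.1
  let eval : WType β → I := WType.elim I fun p => e (Set.range p.2) p.1.2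
  have hα : #α = #K := by
    rw [← mul_def, mk_subset_mk_lt_cof hκ.isStrongPrelimit, mul_eq_self hκ.aleph0_le]
  have hW : #(WType β) ≤ #K := by
    refine WType.cardinalMk_le_of_le ?_
    calc (sum fun a : α => #K ^ #(β a)) ≤ sum fun _ : α => #K :=
          sum_le_sum _ _ fun a => hκ.power_le_self a.1.2
      _ = #K := by rw [sum_const', hα, mul_eq_self hκ.aleph0_le]
  refine ⟨Set.range eval, mk_range_le.trans hW, fun S hS hcard x hx => ?_⟩
  obtain ⟨s, hs⟩ := le_mk_iff_exists_set.1 (hcard.le.trans (Ordinal.cof_ord_le _))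
  obtain ⟨b⟩ := Cardinal.eq.1 hs
  obtain ⟨k, hk⟩ := he S hx
  choose w hw using fun y : S => hS y.2
  refine ⟨WType.mk (β := β) (⟨s, hs ▸ hcard⟩, k) fun t => w (b t), ?_⟩
  have hrange : (Set.range fun t => eval (w (b t))) = S := by
    ext y
    constructor
    · rintro ⟨t, rfl⟩
      simp only [hw]
      exact (b t).2
    · intro hy
      exact ⟨b.symm ⟨y, hy⟩, by simp [hw]⟩
  change e (Set.range fun t => eval (w (b t))) k = x
  rw [hrange, hk]

/-- Every set contains a maximal subset that is pairwise related by `r`. -/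
theorem Set.exists_maximal_pairwise_subset {I : Type u} (r : I → I → Prop) (T : Set I) :
    ∃ m, Maximal (fun s => s ⊆ T ∧ s.Pairwise r) m := by
  refine zorn_subset {s | s ⊆ T ∧ s.Pairwise r} fun c hc hchain =>
    ⟨⋃₀ c, ⟨Set.sUnion_subset fun s hs => (hc hs).1, ?_⟩, fun s hs => Set.subset_sUnion_of_mem hs⟩
  exact (Set.pairwise_sUnion hchain.directedOn).2 fun s hs => (hc hs).2

/-- For a strong limit `κ`, the partition relation `κ⁺ → (κ⁺, cf κ)²`: a graph on more than `κ`
vertices has a clique of size at least `cf κ` or an independent set of size more than `κ`. -/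
theorem SimpleGraph.exists_isClique_or_isIndepSet {κ : Cardinal.{u}} (hκ : κ.IsStrongLimit)
    {I : Type u} (G : SimpleGraph I) (hI : κ < #I) :
    (∃ S : Set I, G.IsClique S ∧ κ.ord.cof ≤ #S) ∨ ∃ H : Set I, G.IsIndepSet H ∧ κ < #H := by
  by_contra! hcon
  obtain ⟨hclique, hindep⟩ := hcon
  choose Φ hΦ using fun S : Set I =>
    Set.exists_maximal_pairwise_subset (fun v w => ¬ G.Adj v w) {x | ∀ s ∈ S, G.Adj s x}
  obtain ⟨A, hA, hclosed⟩ := hκ.exists_closed_set Φ fun S => hindep _ (hΦ S).prop.2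
  obtain ⟨d, hd⟩ : ∃ d, d ∉ A := by
    by_contra! h
    rw [Set.eq_univ_of_forall h, mk_univ] at hA
    exact hA.not_gt hI
  obtain ⟨S, hS⟩ := Set.exists_maximal_pairwise_subset G.Adj {x ∈ A | G.Adj x d}
  have hSA : S ⊆ A := fun x hx => (hS.prop.1 hx).1
  have hΦA := hclosed S hSA (hclique S hS.prop.2)
  have hex : ∃ h ∈ Φ S, G.Adj h d := by
    by_contra! hno
    refine hd (hΦA ((hΦ S).mem_of_prop_insert ⟨?_, ?_⟩))
    · exact Set.insert_subset (fun s hs => (hS.prop.1 hs).2) (hΦ S).prop.1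
    · refine (hΦ S).prop.2.insert fun h hh _ => ⟨fun hadj => hno h hh hadj.symm, hno h hh⟩
  obtain ⟨h, hh, hadj⟩ := hex
  have hhS : ∀ s ∈ S, G.Adj s h := (hΦ S).prop.1 hh
  have hmem : h ∈ S := by
    refine hS.mem_of_prop_insert ⟨Set.insert_subset ⟨hΦA hh, hadj⟩ hS.prop.1, ?_⟩
    exact hS.prop.2.insert fun s hs _ => ⟨(hhS s hs).symm, hhS s hs⟩
  exact G.irrefl (hhS h hmem)

/-- An indexed family of pairwise disjoint nonempty open sets has fewer than `μ` members
whenever `c'(X) ≤ μ`. -/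
theorem mk_lt_of_cellularity'_le_s2 {X : Type u} [TopologicalSpace X] {μ : Cardinal.{u}}
    (hμ : cellularity' X ≤ μ) {I : Type u} {T : Set I} {V : I → Set X}
    (hV : ∀ i ∈ T, IsOpen (V i) ∧ (V i).Nonempty) (hT : T.PairwiseDisjoint V) : #T < μ := by
  by_contra! hcard
  have hmem : cellularity' X ∈
      {μ : Cardinal.{u} | ¬ ∃ S : Set (Set X), IsCellularFamily S ∧ #S = μ} := by
    refine csInf_mem ⟨Order.succ #(Set X), ?_⟩
    rintro ⟨S, -, hS⟩
    exact ((mk_set_le S).trans_lt (Order.lt_succ _)).ne hS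
  have hinj : Set.InjOn V T := by
    intro i hi j hj hij
    by_contra hne
    have hdisj := hT hi hj hne
    simp only [Function.onFun, hij, disjoint_self] at hdisj
    exact (hV j hj).2.ne_empty hdisj
  have hle : cellularity' X ≤ #(V '' T) := by
    rw [mk_image_eq_of_injOn V T hinj]
    exact hμ.trans hcard
  obtain ⟨S, hST, hS⟩ := le_mk_iff_exists_subset.1 hle
  refine hmem ⟨S, ⟨fun U hU => ?_, fun U hU W hW hne => ?_⟩, hS⟩
  · obtain ⟨i, hi, rfl⟩ := hST hU
    exact hV i hi
  · obtain ⟨i, hi, rfl⟩ := hST hU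
    obtain ⟨j, hj, rfl⟩ := hST hW
    exact hT hi hj fun hij => hne (congrArg V hij)

theorem stmt_2 (κ : Cardinal.{u}) (hκ : ∀ μ : Cardinal.{u}, μ < κ → 2 ^ μ < κ)
    (X Y : Type u) [TopologicalSpace X] [TopologicalSpace Y]
    (hX : cellularity' X ≤ Order.succ κ) (hY : cellularity' Y ≤ κ.ord.cof) :
    cellularity' (X × Y) ≤ Order.succ κ := by
  have hlim : κ.IsStrongLimit := by
    refine ⟨?_, fun μ hμ => hκ μ hμ⟩
    rintro rfl
    have h := mk_lt_of_cellularity'_le_s2 hY (T := (∅ : Set (Set Y))) (V := id) (by simp) (by simp)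
    simp at h
  refine csInf_le' ?_
  rintro ⟨F, ⟨hF, hdisj⟩, hcard⟩
  have hbox : ∀ i : F, ∃ U : Set X, ∃ V : Set Y, (IsOpen U ∧ U.Nonempty) ∧
      (IsOpen V ∧ V.Nonempty) ∧ U ×ˢ V ⊆ i.1 := by
    intro i
    obtain ⟨hopen, ⟨x, y⟩, hxy⟩ := hF i i.2
    obtain ⟨U, V, hU, hV, hx, hy, hsub⟩ := isOpen_prod_iff.1 hopen x y hxy
    exact ⟨U, V, ⟨hU, x, hx⟩, ⟨hV, y, hy⟩, hsub⟩
  choose U V hU hV hUV using hbox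
  let G : SimpleGraph F :=
    { Adj := fun i j => i ≠ j ∧ Disjoint (V i) (V j)
      symm := ⟨fun i j h => ⟨h.1.symm, h.2.symm⟩⟩
      loopless := ⟨fun i h => h.1 rfl⟩ }
  rcases G.exists_isClique_or_isIndepSet hlim (hcard ▸ Order.lt_succ κ) with
    ⟨S, hS, hSκ⟩ | ⟨H, hH, hHκ⟩
  · exact hSκ.not_gt (mk_lt_of_cellularity'_le_s2 hY (fun i _ => hV i)
      fun i hi j hj hne => (hS hi hj hne).2)
  · refine (Order.succ_le_of_lt hHκ).not_gt
      (mk_lt_of_cellularity'_le_s2 hX (fun i _ => hU i) fun i hi j hj hne => ?_)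
    have hprod : Disjoint (U i ×ˢ V i) (U j ×ˢ V j) :=
      (hdisj i.2 j.2 (Subtype.coe_injective.ne hne)).mono (hUV i) (hUV j)
    exact (Set.disjoint_prod.1 hprod).resolve_right fun h => hH hi hj hne ⟨hne, h⟩
end

section
/- Let κ be an uncountable cardinal satisfying the partition relation κ → (κ)²₂, i.e., for every 2-coloring of the 2-element subsets of κ there is a homogeneous set of cardinality κ. If X is a topological space with c'(X) = κ, then c'(X × X) = κ. -/
universe u

open Cardinal

/-- The partition relation `κ → (κ)²₂`: for every 2-coloring of the 2-element subsets of a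
set of cardinality `κ` there is a homogeneous set of cardinality `κ`. -/
def PartitionRel (κ : Cardinal.{u}) : Prop :=
  ∀ (A : Type u), #A = κ →
    ∀ c : {s : Finset A // s.card = 2} → Fin 2,
      ∃ (H : Set A) (i : Fin 2), #H = κ ∧
        ∀ s : {s : Finset A // s.card = 2}, (s.1 : Set A) ⊆ H → c s = i

/-- The range of a family of pairwise disjoint nonempty open sets is a cellular family with as many
members as there are indices. -/
theorem exists_isCellularFamily_of_pairwise_disjoint {X ι : Type u} [TopologicalSpace X]
    (U : ι → Set X) (hU : ∀ i, IsOpen (U i) ∧ (U i).Nonempty)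
    (hd : Pairwise fun i j => Disjoint (U i) (U j)) :
    ∃ S : Set (Set X), IsCellularFamily S ∧ #S = #ι := by
  have hinj : Function.Injective U := by
    intro i j hij
    by_contra hne
    have h : Disjoint (U i) (U j) := hd hne
    rw [hij, disjoint_self] at h
    exact (hU j).2.ne_empty h
  refine ⟨Set.range U, ⟨?_, ?_⟩, mk_range_eq U hinj⟩
  · rintro _ ⟨i, rfl⟩
    exact hU i
  · rintro _ ⟨i, rfl⟩ _ ⟨j, rfl⟩ hne
    exact hd fun h => hne (congrArg U h)

/-- A cellular family of `X` gives one of `X × X` of the same cardinality, made of cylinders. -/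
theorem exists_isCellularFamily_prod {X : Type u} [TopologicalSpace X] {S : Set (Set X)}
    (hS : IsCellularFamily S) :
    ∃ T : Set (Set (X × X)), IsCellularFamily T ∧ #T = #S := by
  refine exists_isCellularFamily_of_pairwise_disjoint
    (fun U : S => Prod.fst ⁻¹' (U : Set X)) (fun U => ⟨?_, ?_⟩) fun U V hne => ?_
  · exact (hS.1 U U.2).1.preimage continuous_fst
  · obtain ⟨x, hx⟩ := (hS.1 U U.2).2
    exact ⟨(x, x), hx⟩
  · exact (hS.2 U.2 V.2 fun h => hne (Subtype.ext h)).preimage Prod.fst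

/-- A nonempty open subset of a product contains a nonempty open box. -/
theorem IsOpen.exists_nonempty_prod_subset {X Y : Type*} [TopologicalSpace X] [TopologicalSpace Y]
    {W : Set (X × Y)} (hW : IsOpen W) (hne : W.Nonempty) :
    ∃ (U : Set X) (V : Set Y),
      (IsOpen U ∧ U.Nonempty) ∧ (IsOpen V ∧ V.Nonempty) ∧ U ×ˢ V ⊆ W := by
  obtain ⟨⟨x, y⟩, hxy⟩ := hne
  obtain ⟨U, V, hU, hV, hx, hy, hs⟩ := isOpen_prod_iff.1 hW x y hxy
  exact ⟨U, V, ⟨hU, x, hx⟩, ⟨hV, y, hy⟩, hs⟩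

/-- The partition relation for a symmetric relation: some set of full cardinality is
homogeneous for it. -/
theorem PartitionRel.exists_pairwise {A : Type u} (hA : PartitionRel #A) (r : A → A → Prop)
    [Std.Symm r] :
    ∃ H : Set A, #H = #A ∧ (H.Pairwise r ∨ H.Pairwise fun a b => ¬ r a b) := by
  classical
  obtain ⟨H, i, hH, hi⟩ := hA A rfl
    fun s => if (s.1 : Set A).Pairwise r then 0 else 1
  have key : ∀ a ∈ H, ∀ b ∈ H, a ≠ b → (if r a b then (0 : Fin 2) else 1) = i := by
    intro a ha b hb hab
    have h := hi ⟨{a, b}, Finset.card_pair hab⟩ (by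
      simp [Set.insert_subset_iff, ha, hb])
    have hp : ((({a, b} : Finset A) : Set A).Pairwise r) ↔ r a b := by
      rw [Finset.coe_pair, Set.pairwise_pair_of_symm]
      exact ⟨fun h => h hab, fun h _ => h⟩
    simpa only [hp] using h
  refine ⟨H, hH, ?_⟩
  by_cases h0 : i = 0
  · left
    intro a ha b hb hab
    by_contra hn
    have h := key a ha b hb hab
    simp [hn, h0] at h
  · right
    intro a ha b hb hab hn
    have h := key a ha b hb hab
    rw [if_pos hn] at h
    exact h0 h.symm

/-- If `κ → (κ)²₂` and `X × X` has a cellular family of cardinality `κ`, then so has `X`. -/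
theorem PartitionRel.exists_isCellularFamily_of_prod {κ : Cardinal.{u}} (hκ : PartitionRel κ)
    {X : Type u} [TopologicalSpace X] {T : Set (Set (X × X))} (hT : IsCellularFamily T)
    (hcard : #T = κ) :
    ∃ S : Set (Set X), IsCellularFamily S ∧ #S = κ := by
  subst hcard
  have hbox := fun W : T => (hT.1 W W.2).1.exists_nonempty_prod_subset (hT.1 W W.2).2
  choose U V hU hV hUV using hbox
  have : Std.Symm fun W W' => Disjoint (U W) (U W') := ⟨fun _ _ h => h.symm⟩
  obtain ⟨H, hH, hUd | hUd⟩ := hκ.exists_pairwise fun W W' => Disjoint (U W) (U W')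
  · rw [← hH]
    exact exists_isCellularFamily_of_pairwise_disjoint (fun W : H => U W) (fun W => hU W)
      fun W W' hne => hUd W.2 W'.2 fun h => hne (Subtype.ext h)
  · rw [← hH]
    refine exists_isCellularFamily_of_pairwise_disjoint (fun W : H => V W) (fun W => hV W)
      fun W W' hne => ?_
    have hne' : (W : T) ≠ W' := fun h => hne (Subtype.ext h)
    have hd : Disjoint (U W ×ˢ V W) (U W' ×ˢ V W') :=
      (hT.2 W.1.2 W'.1.2 fun h => hne' (Subtype.ext h)).mono (hUV W) (hUV W')
    exact (Set.disjoint_prod.1 hd).resolve_left (hUd W.2 W'.2 hne')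

theorem stmt_3 (κ : Cardinal.{u}) (hκ : ℵ₀ < κ) (hpart : PartitionRel κ)
    (X : Type u) [TopologicalSpace X] (hX : cellularity' X = κ) :
    cellularity' (X × X) = κ := by
  have hmem : ¬ ∃ S : Set (Set X), IsCellularFamily S ∧ #S = κ := by
    have hne : {μ : Cardinal.{u} |
        ¬ ∃ S : Set (Set X), IsCellularFamily S ∧ #S = μ}.Nonempty := by
      by_contra h
      rw [Set.not_nonempty_iff_eq_empty] at h
      rw [cellularity', h, Cardinal.sInf_empty] at hX
      exact not_lt_zero (hX ▸ hκ)
    have h := csInf_mem hne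
    rw [← cellularity', hX] at h
    exact h
  have hmem' : ¬ ∃ T : Set (Set (X × X)), IsCellularFamily T ∧ #T = κ :=
    fun ⟨_, hT, hc⟩ => hmem (hpart.exists_isCellularFamily_of_prod hT hc)
  refine le_antisymm (csInf_le' hmem') (le_csInf ⟨κ, hmem'⟩ fun μ hμ => ?_)
  rw [← hX]
  refine csInf_le' fun ⟨S, hS, hc⟩ => hμ ?_
  rw [← hc]
  exact exists_isCellularFamily_prod hS
end

section
/- For every regular cardinal κ > ℵ₁ there is a compact Hausdorff totally disconnected topological space X such that c'(X) = κ⁺ and c'(X × X) > κ⁺. -/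
universe u

open Cardinal

universe v w

/-- A linear order in which the subsets smaller than the whole are strictly bounded and the proper
initial segments are small: a well order of this kind has the type of an infinite regular
cardinal. -/
class RegularOrder (L : Type u) [LinearOrder L] : Prop where
  infinite : Infinite L
  exists_bound : ∀ A : Set L, #A < #L → ∃ b, ∀ a ∈ A, a < b
  mk_Iio_lt : ∀ i : L, #(Set.Iio i) < #L

/-- `A` meets every set of points closed under a function. In a regular order of uncountable
cardinality this is stationarity. -/
def Stat {L : Type u} [LinearOrder L] (A : Set L) : Prop :=
  ∀ F : L → L, ∃ δ ∈ A, (∃ a, a < δ) ∧ ∀ a < δ, F a < δ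

/-- Subsets of `Iio δ` smaller than `K` are strictly bounded below `δ`. -/
def LargeCof (K : Type u) {L : Type u} [LinearOrder L] (δ : L) : Prop :=
  ∀ A : Set L, A ⊆ Set.Iio δ → #A < #K → ∃ b < δ, ∀ a ∈ A, a < b

theorem regularOrder_ord_toType {θ : Cardinal.{u}} (h : θ.IsRegular) :
    RegularOrder θ.ord.ToType where
  infinite := by
    rw [Cardinal.infinite_iff, mk_ord_toType]
    exact h.aleph0_le
  exists_bound A hA := by
    by_contra! hb
    have : Order.cof θ.ord.ToType ≤ #A := Order.cof_le fun b => by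
      obtain ⟨a, ha, hab⟩ := hb b
      exact ⟨a, ha, hab⟩
    rw [Ordinal.cof_toType, h.cof_ord] at this
    rw [mk_ord_toType] at hA
    exact absurd hA this.not_gt
  mk_Iio_lt i := by
    exact mk_Iio_lt i (by simp)

section RegularOrder

variable {L : Type u} [LinearOrder L]

theorem Stat.mono {A B : Set L} (hA : Stat A) (h : A ⊆ B) : Stat B := fun F => by
  obtain ⟨δ, hδ, h'⟩ := hA F
  exact ⟨δ, h hδ, h'⟩

theorem Stat.nonempty [Nonempty L] {A : Set L} (hA : Stat A) : A.Nonempty := by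
  obtain ⟨δ, hδ, -⟩ := hA id
  exact ⟨δ, hδ⟩

variable [RegularOrder L]

theorem exists_family_bound {ι : Type v} (hι : lift.{u} #ι < lift.{v} #L) (f : ι → L) :
    ∃ b, ∀ i, f i < b := by
  obtain ⟨b, hb⟩ := RegularOrder.exists_bound (Set.range f) (by
    have := mk_range_le_lift (f := f)
    rw [← lift_lt.{u, v}]
    exact this.trans_lt hι)
  exact ⟨b, fun i => hb _ ⟨i, rfl⟩⟩

theorem lift_mk_lt_of_finite (L : Type u) [LinearOrder L] [RegularOrder L] (ι : Type v) [Finite ι] :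
    lift.{u} #ι < lift.{v} #L := by
  have := RegularOrder.infinite (L := L)
  refine lt_of_lt_of_le (b := ℵ₀) ?_ ?_
  · simp
  · simp

theorem RegularOrder.exists_gt' (a : L) : ∃ b, a < b := by
  obtain ⟨b, hb⟩ := exists_family_bound (lift_mk_lt_of_finite L Unit) fun _ => a
  exact ⟨b, hb ()⟩

theorem exists_finset_bound (s : Finset L) : ∃ b, ∀ a ∈ s, a < b := by
  obtain ⟨b, hb⟩ := exists_family_bound (lift_mk_lt_of_finite L s) fun a => a.1
  exact ⟨b, fun a ha => hb ⟨a, ha⟩⟩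

theorem RegularOrder.nonempty (L : Type u) [LinearOrder L] [RegularOrder L] : Nonempty L := by
  have := RegularOrder.infinite (L := L)
  infer_instance

theorem RegularOrder.mk_Iic_lt (i : L) : #(Set.Iic i) < #L := by
  obtain ⟨b, hb⟩ := RegularOrder.exists_gt' i
  exact (mk_le_mk_of_subset (Set.Iic_subset_Iio.2 hb)).trans_lt (RegularOrder.mk_Iio_lt b)

theorem exists_Iic_bound (f : L → L) : ∃ F : L → L, ∀ a b, b ≤ a → f b < F a := by
  have : ∀ a : L, ∃ c : L, ∀ b : Set.Iic a, f b < c := fun a =>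
    exists_family_bound (by simpa using RegularOrder.mk_Iic_lt a) fun b : Set.Iic a => f b
  choose F hF using this
  exact ⟨F, fun a b h => hF a ⟨b, h⟩⟩

theorem exists_Iic_bound₂ (f : L → L → L) :
    ∃ F : L → L, ∀ a b c, b ≤ a → c ≤ a → f b c < F a := by
  choose G hG using fun b => exists_Iic_bound (f b)
  have : ∀ a : L, ∃ c : L, ∀ b : Set.Iic a, G b a < c := fun a =>
    exists_family_bound (by simpa using RegularOrder.mk_Iic_lt a) fun b : Set.Iic a => G b a
  choose F hF using this
  exact ⟨F, fun a b c hb hc => (hG b a c hc).trans (hF a ⟨b, hb⟩)⟩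

theorem Stat.exists_closed {A : Set L} (hA : Stat A) {ι : Type v}
    (hι : lift.{u} #ι < lift.{v} #L) (F : ι → L → L) (b : L) :
    ∃ δ ∈ A, b < δ ∧ ∀ i, ∀ a < δ, F i a < δ := by
  choose G hG using fun a => exists_family_bound hι fun i => F i a
  obtain ⟨δ, hδ, ⟨a, ha⟩, hF⟩ := hA fun a => max (G a) b
  exact ⟨δ, hδ, (le_max_right _ _).trans_lt (hF a ha),
    fun i a ha => (hG a i).trans ((le_max_left _ _).trans_lt (hF a ha))⟩

theorem Stat.exists_closed₁ {A : Set L} (hA : Stat A) (F : L → L) (b : L) :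
    ∃ δ ∈ A, b < δ ∧ ∀ a < δ, F a < δ := by
  obtain ⟨δ, h, hb, hF⟩ := hA.exists_closed (lift_mk_lt_of_finite L Unit) (fun _ => F) b
  exact ⟨δ, h, hb, hF ()⟩

theorem Stat.exists_gt {A : Set L} (hA : Stat A) (b : L) : ∃ δ ∈ A, b < δ := by
  obtain ⟨δ, h, hb, -⟩ := hA.exists_closed₁ id b
  exact ⟨δ, h, hb⟩

theorem Stat.exists_of_iUnion {ι : Type v} (hι : lift.{u} #ι < lift.{v} #L) {A : ι → Set L}
    (hA : Stat (⋃ i, A i)) : ∃ i, Stat (A i) := by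
  have := RegularOrder.nonempty L
  by_contra! h
  simp only [Stat] at h
  push Not at h
  choose F hF using h
  obtain ⟨δ, hδ, hb, hcl⟩ := hA.exists_closed hι F (Classical.arbitrary L)
  obtain ⟨i, hi⟩ := Set.mem_iUnion.1 hδ
  obtain ⟨a, ha, hFa⟩ := hF i δ hi ⟨_, hb⟩
  exact (hcl i a ha).not_ge hFa

theorem Stat.exists_fiber {ι : Type v} (hι : lift.{u} #ι < lift.{v} #L) {A : Set L}
    (hA : Stat A) (f : L → ι) : ∃ i, Stat {a ∈ A | f a = i} :=
  Stat.exists_of_iUnion hι <| hA.mono fun a ha => by simpa using ha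

/-- The pressing down lemma of Fodor. -/
theorem Stat.fodor {A : Set L} (hA : Stat A) (f : L → L) (hf : ∀ δ ∈ A, f δ < δ) :
    ∃ ξ, Stat {δ ∈ A | f δ = ξ} := by
  by_contra! h
  simp only [Stat] at h
  push Not at h
  choose F hF using h
  obtain ⟨G, hG⟩ := exists_Iic_bound₂ F
  obtain ⟨δ, hδ, hb, hcl⟩ := hA G
  obtain ⟨a, ha, hFa⟩ := hF (f δ) δ ⟨hδ, rfl⟩ hb
  exact ((hG _ _ _ (le_max_left _ _) (le_max_right _ _)).trans
    (hcl _ (max_lt (hf δ hδ) ha))).not_ge hFa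

theorem RegularOrder.mk_finset_Iio_lt (hL : ℵ₀ < #L) (i : L) : #(Finset (Set.Iio i)) < #L := by
  rcases finite_or_infinite (Set.Iio i) with h | h
  · exact (lt_aleph0_of_finite _).trans hL
  · rw [mk_finset_of_infinite]
    exact RegularOrder.mk_Iio_lt i

/-- Stationarily many finite sets have the same trace below their index. -/
theorem Stat.exists_trace (hL : ℵ₀ < #L) {A : Set L} (hA : Stat A) (c : L → Finset L) :
    ∃ R : Finset L, Stat {i ∈ A | (c i).filter (· < i) = R} := by
  have hb : ∀ i, (∃ a, a < i) → ∃ ξ < i, ∀ x ∈ c i, x < i → x ≤ ξ := by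
    rintro i ⟨a, ha⟩
    obtain ⟨m, hm, hm'⟩ := (insert a ((c i).filter (· < i))).exists_max_image id ⟨a, by simp⟩
    refine ⟨m, ?_, fun x hx hxi => hm' x (by simp [hx, hxi])⟩
    simp only [Finset.mem_insert, Finset.mem_filter] at hm
    rcases hm with rfl | hm
    exacts [ha, hm.2]
  have hA' : Stat {i ∈ A | ∃ a, a < i} := fun F => by
    obtain ⟨δ, hδ, h⟩ := hA F
    exact ⟨δ, ⟨hδ, h.1⟩, h⟩
  choose! f hf hf' using hb
  obtain ⟨ξ, hξ⟩ := hA'.fodor f fun i hi => hf i hi.2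
  obtain ⟨ζ, hζ⟩ := RegularOrder.exists_gt' ξ
  have key : ∃ t : Finset (Set.Iio ζ), Stat {i ∈ {δ ∈ {i ∈ A | ∃ a, a < i} | f δ = ξ} |
      ((c i).filter (· < i)).subtype (· ∈ Set.Iio ζ) = t} :=
    hξ.exists_fiber (by simpa using RegularOrder.mk_finset_Iio_lt hL ζ) _
  obtain ⟨t, ht⟩ := key
  refine ⟨t.map (Function.Embedding.subtype _), ht.mono ?_⟩
  rintro i ⟨⟨⟨hiA, hi⟩, hfi⟩, rfl⟩
  refine ⟨hiA, ?_⟩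
  rw [Finset.subtype_map_of_mem]
  intro x hx
  simp only [Finset.mem_filter] at hx
  exact ((hf' i hi x hx.1 hx.2).trans hfi.le).trans_lt hζ

/-- Splitting a stationary set into stationary pieces, after Ulam. -/
theorem Stat.exists_split {K : Type v} (hK : lift.{u} #K < lift.{v} #L) (g : L → L → K)
    (hg : ∀ β, Set.InjOn (g β) (Set.Iio β)) {S : Set L} (hS : Stat S)
    {I : Type w} [Nonempty I] (φ : I ↪ L) :
    ∃ h : L → I, ∀ i, Stat {β ∈ S | h β = i} := by
  classical
  have h1 : ∀ ξ, ∃ η, Stat {β ∈ {β ∈ S | ξ < β} | g β ξ = η} := fun ξ =>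
    Stat.exists_fiber hK (fun F => by
      obtain ⟨δ, hδ, h, h'⟩ := hS.exists_closed₁ F ξ
      exact ⟨δ, ⟨hδ, h⟩, ⟨ξ, h⟩, h'⟩) fun β => g β ξ
  choose η hη using h1
  obtain ⟨k, hk⟩ : ∃ k, ∀ b, ∃ ξ, η ξ = k ∧ b ≤ ξ := by
    by_contra! h
    choose b hb using h
    obtain ⟨c, hc⟩ := exists_family_bound hK b
    exact (hc (η c)).not_gt (hb (η c) c rfl)
  have hcard : #L ≤ #{ξ | η ξ = k} := by
    by_contra! h
    obtain ⟨b, hb⟩ := RegularOrder.exists_bound _ h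
    obtain ⟨ξ, h1, h2⟩ := hk b
    exact (hb ξ h1).not_ge h2
  obtain ⟨ψ⟩ := (Cardinal.le_def _ _).1 hcard
  let P : L → I → Prop := fun β i => (ψ (φ i)).1 < β ∧ g β (ψ (φ i)) = k
  refine ⟨fun β => if h : ∃ i, P β i then h.choose else Classical.arbitrary I, fun i => ?_⟩
  refine (hη (ψ (φ i))).mono ?_
  rintro β ⟨⟨hβ, hlt⟩, hk'⟩
  have hP : ∃ i, P β i := ⟨i, hlt, hk'.trans (ψ (φ i)).2⟩
  refine ⟨hβ, ?_⟩
  simp only [dif_pos hP]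
  have hs := hP.choose_spec
  have := hg β hs.1 hlt (hs.2.trans (hk'.trans (ψ (φ i)).2).symm)
  exact φ.injective (ψ.injective (Subtype.ext this))

variable [WellFoundedLT L]

/-- The points of large cofinality form a stationary set. -/
theorem stat_setOf_largeCof {K : Type u} [LinearOrder K] [WellFoundedLT K] [RegularOrder K]
    (hK : #K < #L) :
    Stat {δ : L | LargeCof K δ} := by
  intro F
  obtain ⟨G, hG⟩ := exists_Iic_bound fun a => max (F a) a
  have hbound : ∀ (ξ : K) (g : Set.Iio ξ → L), ∃ b, ∀ η, G (g η) < b := fun ξ g =>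
    exists_family_bound (by simpa using (RegularOrder.mk_Iio_lt ξ).trans hK) _
  choose b hb using hbound
  let f : K → L := WellFoundedLT.fix fun ξ g => b ξ fun η => g η η.2
  have hf : ∀ η ξ, η < ξ → G (f η) < f ξ := fun η ξ h => by
    have : f ξ = b ξ fun η => f η := WellFoundedLT.fix_eq _ ξ
    rw [this]
    exact hb ξ (fun η => f η) ⟨η, h⟩
  have hmono : StrictMono f := fun η ξ h =>
    ((le_max_right _ _).trans_lt (hG (f η) _ le_rfl)).trans (hf η ξ h)
  obtain ⟨δ, hδ, hmin⟩ := WellFounded.has_min (wellFounded_lt (α := L)) {d | ∀ ξ, f ξ < d}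
    (exists_family_bound (by simpa using hK) f)
  have hcof : ∀ a < δ, ∃ ξ, a ≤ f ξ := fun a ha => by
    by_contra! h
    exact hmin a h ha
  obtain ⟨ξ₀⟩ := RegularOrder.nonempty K
  refine ⟨δ, fun A hA hAK => ?_, ⟨f ξ₀, hδ ξ₀⟩, fun a ha => ?_⟩
  · have : Nonempty K := ⟨ξ₀⟩
    choose! e he using hcof
    obtain ⟨ξ, hξ⟩ := RegularOrder.exists_bound (e '' A) (mk_image_le.trans_lt hAK)
    exact ⟨f ξ, hδ ξ, fun a ha => (he a (hA ha)).trans_lt (hmono (hξ _ ⟨a, ha, rfl⟩))⟩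
  · obtain ⟨ξ, hξ⟩ := hcof a ha
    obtain ⟨η, hη⟩ := RegularOrder.exists_gt' ξ
    exact (((le_max_left _ _).trans_lt (hG (f ξ) a hξ)).trans (hf ξ η hη)).trans (hδ η)

theorem stat_univ (hL : ℵ₀ < #L) : Stat (Set.univ : Set L) := by
  have := regularOrder_ord_toType.{u} isRegular_aleph0
  exact (stat_setOf_largeCof (K := (ℵ₀ : Cardinal.{u}).ord.ToType) (by simpa using hL)).mono
    (Set.subset_univ _)

end RegularOrder

section Pick

variable {W : Type u}

/-- The largest first difference between the reals coded by two points of `τ`. -/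
noncomputable def sep (r : W → ℕ → Bool) (τ : Finset W) : ℕ :=
  (τ ×ˢ τ).sup fun p => PiNat.firstDiff (r p.1) (r p.2)

/-- The restriction to `n` of the real coded by `x`. -/
def res (r : W → ℕ → Bool) (n : ℕ) (x : W) : Fin n → Bool := fun m => r x m

theorem firstDiff_le_sep (r : W → ℕ → Bool) {τ : Finset W} {x y : W} (hx : x ∈ τ) (hy : y ∈ τ) :
    PiNat.firstDiff (r x) (r y) ≤ sep r τ :=
  Finset.le_sup (f := fun p : W × W => PiNat.firstDiff (r p.1) (r p.2)) (b := (x, y))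
    (by simp [hx, hy])

theorem le_firstDiff_of_res_eq {r : W → ℕ → Bool} (hr : r.Injective) {x y : W} (hxy : x ≠ y)
    {n : ℕ} (h : res r n x = res r n y) : n ≤ PiNat.firstDiff (r x) (r y) := by
  by_contra! hlt
  exact PiNat.apply_firstDiff_ne (hr.ne hxy) (congrFun h ⟨_, hlt⟩)

theorem injOn_res_of_sep_lt {r : W → ℕ → Bool} (hr : r.Injective) {τ : Finset W} {n : ℕ}
    (h : sep r τ < n) : Set.InjOn (res r n) τ := by
  intro x hx y hy hxy
  by_contra hne
  exact ((le_firstDiff_of_res_eq hr hne hxy).trans (firstDiff_le_sep r hx hy)).not_gt h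

theorem sep_lt_of_injOn_res {r : W → ℕ → Bool} {τ : Finset W} {n : ℕ} (hn : 0 < n)
    (h : Set.InjOn (res r n) τ) : sep r τ < n := by
  rw [sep, Finset.sup_lt_iff (by simpa using hn)]
  rintro ⟨x, y⟩ hxy
  simp only [Finset.mem_product] at hxy
  by_contra! hle
  have hxy' : x = y := h hxy.1 hxy.2
    (funext fun m => PiNat.apply_eq_of_lt_firstDiff (m.2.trans_le hle))
  simp [hxy', PiNat.firstDiff] at hle
  omega

theorem lift_mk_lt_of_countable (hW : ℵ₀ < #W) (ι : Type v) [Countable ι] :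
    lift.{u} #ι < lift.{v} #W := by
  refine lt_of_le_of_lt (b := ℵ₀) ?_ ?_
  · simp
  · simpa using hW

variable [LinearOrder W]

/-- `i` is the least `ν ∈ τ` below `μ = max τ` with `sep r τ < e μ ν`. -/
def IsPick (e : W → W → ℕ) (r : W → ℕ → Bool) (τ : Finset W) (i : W) : Prop :=
  i ∈ τ ∧ ∃ μ ∈ τ, (∀ x ∈ τ, x ≤ μ) ∧ i < μ ∧ sep r τ < e μ i ∧
    ∀ x ∈ τ, x < i → e μ x ≤ sep r τ

theorem IsPick.unique {e : W → W → ℕ} {r : W → ℕ → Bool} {τ : Finset W} {i j : W}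
    (hi : IsPick e r τ i) (hj : IsPick e r τ j) : i = j := by
  obtain ⟨hiτ, μ, hμ, hmax, -, hi1, hi2⟩ := hi
  obtain ⟨hjτ, ν, hν, hmax', -, hj1, hj2⟩ := hj
  obtain rfl := le_antisymm (hmax' μ hμ) (hmax ν hν)
  rcases lt_trichotomy i j with h | h | h
  · exact absurd hi1 (hj2 i hiτ h).not_gt
  · exact h
  · exact absurd hj1 (hi2 j hjτ h).not_gt

variable [RegularOrder W]

theorem exists_isPick (hW : ℵ₀ < #W) {e : W → W → ℕ} (he : ∀ μ, Set.InjOn (e μ) (Set.Iio μ))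
    {r : W → ℕ → Bool} (hr : r.Injective) {H : Set W} (hH : Stat H) (c : W → Finset W) :
    ∃ i ∈ H, ∃ j, ∀ A B : Finset W, i ∈ A → A ⊆ c i → j ∈ B → B ⊆ c j → IsPick e r (A ∪ B) i := by
  have := RegularOrder.nonempty W
  obtain ⟨R, hR⟩ := hH.exists_trace hW c
  obtain ⟨k, hk⟩ := hR.exists_fiber (lift_mk_lt_of_countable hW ℕ)
    fun i => (c i ×ˢ c i).sup fun p => e p.1 p.2
  obtain ⟨s, hs⟩ := hk.exists_fiber (lift_mk_lt_of_countable hW (Fin k → Bool)) (res r k)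
  set D := {a ∈ {a ∈ {i ∈ H | (c i).filter (· < i) = R} |
    ((c a ×ˢ c a).sup fun p => e p.1 p.2) = k} | res r k a = s}
  have hDR : ∀ i ∈ D, ∀ x, x ∈ R ↔ x ∈ c i ∧ x < i := fun i hi x => by
    rw [← hi.1.1.2]; simp
  have hDk : ∀ i ∈ D, ∀ x ∈ c i, ∀ y ∈ c i, e x y ≤ k := fun i hi x hx y hy => by
    rw [← hi.1.2]
    exact Finset.le_sup (f := fun p : W × W => e p.1 p.2) (b := (x, y)) (by simp [hx, hy])
  let T : (n : ℕ) → W → Finset (Fin n → Bool) × Prop := fun n i =>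
    ((c i \ R).image (res r n), Set.InjOn (res r n) (c i))
  let cls : (n : ℕ) → Finset (Fin n → Bool) × Prop → Set W := fun n t => {i ∈ D | T n i = t}
  have hgood : Stat {i ∈ D | ∀ n, Stat (cls n (T n i))} := by
    let E : Option (Σ n, Finset (Fin n → Bool) × Prop) → Set W := fun o =>
      o.elim {i ∈ D | ∀ n, Stat (cls n (T n i))} fun p => {i ∈ cls p.1 p.2 | ¬ Stat (cls p.1 p.2)}
    have hE : Stat (⋃ o, E o) := hs.mono fun i hi => by
      by_cases h : ∀ n, Stat (cls n (T n i))
      · exact Set.mem_iUnion.2 ⟨none, hi, h⟩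
      · push Not at h
        obtain ⟨n, hn⟩ := h
        exact Set.mem_iUnion.2 ⟨some ⟨n, T n i⟩, ⟨hi, rfl⟩, hn⟩
    obtain ⟨o, ho⟩ := Stat.exists_of_iUnion (lift_mk_lt_of_countable hW _) hE
    rcases o with _ | ⟨n, t⟩
    · exact ho
    · obtain ⟨i, -, hi⟩ := ho.nonempty
      exact absurd (ho.mono fun _ h => h.1) hi
  obtain ⟨i₀, hi₀, hi₀'⟩ := hgood.nonempty
  obtain ⟨b₀, hb₀⟩ := exists_finset_bound (c i₀)
  obtain ⟨j₀, ⟨hj₀, hj₀'⟩, hb₀'⟩ := hgood.exists_gt b₀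
  obtain ⟨n, hn⟩ := exists_gt (sep r (c i₀ ∪ c j₀))
  have hn0 : 0 < n := by omega
  have hinj := injOn_res_of_sep_lt hr hn
  rw [Finset.coe_union] at hinj
  have hclsinj : ∀ i₁ i, Set.InjOn (res r n) (c i₁) → i ∈ cls n (T n i₁) →
      Set.InjOn (res r n) (c i) := fun i₁ i h hi => by
    have := congrArg Prod.snd hi.2
    exact this.symm.mp h
  have hclsinter : ∀ i ∈ cls n (T n i₀), ∀ j ∈ cls n (T n j₀), Set.InjOn (res r n) (c i ∪ c j) := by
    intro i hi j hj
    have hii := hclsinj _ _ (hinj.mono Set.subset_union_left) hi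
    have hjj := hclsinj _ _ (hinj.mono Set.subset_union_right) hj
    have hmix : ∀ x ∈ c i, ∀ y ∈ c j, res r n x = res r n y → x = y := by
      intro x hx y hy hxy
      by_cases hxR : x ∈ R
      · exact hjj ((hDR j hj.1 x).1 hxR).1 hy hxy
      by_cases hyR : y ∈ R
      · exact hii hx ((hDR i hi.1 y).1 hyR).1 hxy
      exfalso
      have hx' : res r n x ∈ (c i₀ \ R).image (res r n) := by
        have h : (c i \ R).image (res r n) = (c i₀ \ R).image (res r n) := congrArg Prod.fst hi.2
        rw [← h]
        exact Finset.mem_image_of_mem _ (by simp [hx, hxR])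
      have hy' : res r n y ∈ (c j₀ \ R).image (res r n) := by
        have h : (c j \ R).image (res r n) = (c j₀ \ R).image (res r n) := congrArg Prod.fst hj.2
        rw [← h]
        exact Finset.mem_image_of_mem _ (by simp [hy, hyR])
      simp only [Finset.mem_image, Finset.mem_sdiff] at hx' hy'
      obtain ⟨x', ⟨hx', -⟩, hxx⟩ := hx'
      obtain ⟨y', ⟨hy', hyR'⟩, hyy⟩ := hy'
      have hxy' : x' = y' := hinj (Or.inl hx') (Or.inr hy') (by rw [hxx, hyy, hxy])
      refine hyR' ((hDR j₀ hj₀ y').2 ⟨hy', ?_⟩)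
      rw [← hxy']
      exact (hb₀ x' hx').trans hb₀'
    rintro x (hx | hx) y (hy | hy) hxy
    · exact hii hx hy hxy
    · exact hmix x hx y hy hxy
    · exact (hmix y hy x hx hxy.symm).symm
    · exact hjj hx hy hxy
  choose F hF hF' using (hi₀' n).exists_gt
  choose G hG using fun a => exists_finset_bound (c a)
  obtain ⟨j, hj, hjb, hjcl⟩ := (hj₀' n).exists_closed (lift_mk_lt_of_finite W Bool)
    (fun o => cond o F G) b₀
  have hjF : ∀ a < j, F a < j := hjcl true
  have hjG : ∀ a < j, G a < j := hjcl false
  have hΘ : (⋃ μ ∈ c j, {θ ∈ Set.Iio μ | e μ θ < n}).Finite := by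
    refine (c j).finite_toSet.biUnion fun μ _ => ?_
    refine Set.Finite.of_finite_image ((Set.finite_Iio n).subset ?_)
      ((he μ).mono fun _ h => h.1)
    rintro _ ⟨θ, hθ, rfl⟩
    exact hθ.2
  obtain ⟨a, haj, ha⟩ : ∃ a < j, ∀ μ ∈ c j, ∀ θ < μ, θ < j → e μ θ < n → θ ≤ a := by
    obtain ⟨a, ha, hmax⟩ :=
      (insert b₀ (hΘ.toFinset.filter (· < j))).exists_max_image id ⟨b₀, by simp⟩
    refine ⟨a, ?_, fun μ hμ θ hθ hθj hen => hmax θ ?_⟩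
    · simp only [Finset.mem_insert, Finset.mem_filter] at ha
      rcases ha with rfl | ha
      exacts [hjb, ha.2]
    · simp only [Finset.mem_insert, Finset.mem_filter, Set.Finite.mem_toFinset, Set.mem_iUnion]
      exact Or.inr ⟨⟨μ, hμ, hθ, hen⟩, hθj⟩
  have hi := hF a
  have hij := hjF a haj
  have hai := hF' a
  set i := F a
  have hij' : ∀ x ∈ c i, x < j := fun x hx => (hG i x hx).trans (hjG i hij)
  refine ⟨i, hi.1.1.1.1, j, fun A B hiA hA hjB hB => ⟨by simp [hiA], B.max' ⟨j, hjB⟩, ?_⟩⟩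
  have hμB := B.max'_mem ⟨j, hjB⟩
  have hjμ := B.le_max' j hjB
  have hmax : ∀ x ∈ B, x ≤ B.max' ⟨j, hjB⟩ := fun x => B.le_max' x
  set μ := B.max' ⟨j, hjB⟩
  have hsep : sep r (A ∪ B) < n := sep_lt_of_injOn_res hn0 <|
    (hclsinter i hi j hj).mono <| by
      rw [Finset.coe_union]
      exact Set.union_subset_union hA hB
  have hksep : k ≤ sep r (A ∪ B) :=
    (le_firstDiff_of_res_eq hr hij.ne (hi.1.2.trans hj.1.2.symm)).trans
      (firstDiff_le_sep r (by simp [hiA]) (by simp [hjB]))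
  refine ⟨by simp [hμB], fun x hx => ?_, hij.trans_le hjμ, hsep.trans_le ?_, fun x hx hxi => ?_⟩
  · rcases Finset.mem_union.1 hx with hx | hx
    · exact (hij' x (hA hx)).le.trans hjμ
    · exact hmax x hx
  · by_contra! hlt
    exact (ha μ (hB hμB) i (hij.trans_le hjμ) hij hlt).not_gt hai
  · refine (hDk j hj.1 μ (hB hμB) x ?_).trans hksep
    rcases Finset.mem_union.1 hx with hx | hx
    · exact ((hDR j hj.1 x).1 ((hDR i hi.1 x).2 ⟨hA hx, hxi⟩)).1
    · exact hB hx

end Pick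

section Walk

variable {L K : Type u} [LinearOrder L] [LinearOrder K]

/-- A cofinal subset of `Iio β` read off from `g : L → K`, which is meant to be injective
on `Iio β`. -/
def ladder (g : L → L → K) (β : L) : Set L :=
  {x | x < β ∧ ∀ y < β, g β y < g β x → y < x}

/-- `γ` is the first element of `ladder g β` not below `α`. -/
def IsStep (g : L → L → K) (α β γ : L) : Prop :=
  γ ∈ ladder g β ∧ α ≤ γ ∧ ∀ γ' ∈ ladder g β, α ≤ γ' → γ ≤ γ'

theorem IsStep.unique {g : L → L → K} {α β γ γ' : L} (h : IsStep g α β γ) (h' : IsStep g α β γ') :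
    γ = γ' :=
  le_antisymm (h.2.2 _ h'.1 h'.2.1) (h'.2.2 _ h.1 h.2.1)

theorem exists_mem_ladder [WellFoundedLT K] (g : L → L → K) {α β : L} (h : α < β) :
    ∃ γ ∈ ladder g β, α ≤ γ := by
  obtain ⟨γ, ⟨hγ, hγβ⟩, hmin⟩ := WellFounded.has_min (InvImage.wf (g β) wellFounded_lt)
    {γ | α ≤ γ ∧ γ < β} ⟨α, le_rfl, h⟩
  refine ⟨γ, ⟨hγβ, fun y hy hlt => ?_⟩, hγ⟩
  by_contra! hle
  exact hmin y ⟨hγ.trans hle, hy⟩ hlt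

theorem mk_ladder_inter_lt [WellFoundedLT K] [RegularOrder K] {g : L → L → K}
    (hg : ∀ β, Set.InjOn (g β) (Set.Iio β)) {δ β : L} (h : δ < β) :
    #↑(ladder g β ∩ Set.Iio δ) < #K := by
  obtain ⟨z, hz, hδz⟩ := exists_mem_ladder g h
  refine lt_of_le_of_lt ?_ (RegularOrder.mk_Iio_lt (g β z))
  rw [← mk_image_eq_of_injOn (g β) (ladder g β ∩ Set.Iio δ) ((hg β).mono fun x hx => hx.1.1)]
  refine mk_le_mk_of_subset ?_
  rintro _ ⟨x, ⟨hx, hxδ⟩, rfl⟩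
  have hxz : x < z := hxδ.trans_le hδz
  refine lt_of_not_ge fun hle => ?_
  rcases hle.lt_or_eq with hlt | heq
  · exact (hx.2 z hz.1 hlt).not_gt hxz
  · exact hxz.ne' (hg β hz.1 hx.1 heq)

variable [WellFoundedLT L]

theorem exists_isStep [WellFoundedLT K] (g : L → L → K) {α β : L} (h : α < β) :
    ∃ γ, IsStep g α β γ := by
  obtain ⟨γ, hγ, hmin⟩ := WellFounded.has_min (wellFounded_lt (α := L))
    {γ | γ ∈ ladder g β ∧ α ≤ γ} (exists_mem_ladder g h)
  exact ⟨γ, hγ.1, hγ.2, fun γ' h h' => not_lt.1 (hmin γ' ⟨h, h'⟩)⟩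

open Classical in
/-- The points above `α` visited by the walk from `β` down to `α` along the ladders. -/
noncomputable def walk (g : L → L → K) (α : L) : L → Finset L :=
  WellFoundedLT.fix fun β ih =>
    if h : ∃ γ, IsStep g α β γ then insert β (ih h.choose h.choose_spec.1.1) else ∅

theorem walk_of_le (g : L → L → K) {α β : L} (h : β ≤ α) : walk g α β = ∅ := by
  rw [walk, WellFoundedLT.fix_eq, dif_neg]
  rintro ⟨γ, hγ, hαγ, -⟩
  exact (hαγ.trans_lt hγ.1).not_ge h

theorem walk_of_isStep {g : L → L → K} {α β γ : L} (h : IsStep g α β γ) :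
    walk g α β = insert β (walk g α γ) := by
  have h' : ∃ γ, IsStep g α β γ := ⟨γ, h⟩
  rw [walk, WellFoundedLT.fix_eq, dif_pos h', h.unique h'.choose_spec]

theorem mem_walk_self [WellFoundedLT K] (g : L → L → K) {α β : L} (h : α < β) :
    β ∈ walk g α β := by
  obtain ⟨γ, hγ⟩ := exists_isStep g h
  rw [walk_of_isStep hγ]
  exact Finset.mem_insert_self _ _

variable [WellFoundedLT K] [RegularOrder K]

theorem LargeCof.exists_walk_eq {g : L → L → K} (hg : ∀ β, Set.InjOn (g β) (Set.Iio β)) {δ : L}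
    (hδ : LargeCof K δ) (β : L) (h : δ ≤ β) :
    ∃ ζ < δ, ∀ α, ζ ≤ α → α < δ → walk g α β = walk g δ β ∪ walk g α δ := by
  induction β using WellFoundedLT.induction with
  | ind β ih =>
    rcases h.eq_or_lt with rfl | hlt
    · have := RegularOrder.infinite (L := K)
      obtain ⟨b, hb, -⟩ := hδ ∅ (by simp) (by simpa using pos_iff_ne_zero.2 (mk_ne_zero K))
      exact ⟨b, hb, fun α _ _ => by simp [walk_of_le g le_rfl]⟩
    · obtain ⟨γ, hγ⟩ := exists_isStep g hlt
      obtain ⟨ζ, hζ, hζ'⟩ := ih γ hγ.1.1 hγ.2.1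
      obtain ⟨b, hb, hb'⟩ := hδ _ Set.inter_subset_right (mk_ladder_inter_lt hg hlt)
      refine ⟨max ζ b, max_lt hζ hb, fun α hα hαδ => ?_⟩
      have hstep : IsStep g α β γ := by
        refine ⟨hγ.1, hαδ.le.trans hγ.2.1, fun γ' h h' => hγ.2.2 γ' h ?_⟩
        by_contra! hlt'
        exact ((hb' γ' ⟨h, hlt'⟩).trans_le ((le_max_right _ _).trans hα)).not_ge h'
      rw [walk_of_isStep hstep, walk_of_isStep hγ, hζ' α ((le_max_left _ _).trans hα) hαδ,
        Finset.insert_union]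

variable [RegularOrder L] {W : Type u} [LinearOrder W] [RegularOrder W]

theorem exists_forall_isPick (hW : ℵ₀ < #W) (hWK : #W < #K) (hKL : #K < #L)
    {e : W → W → ℕ} (he : ∀ μ, Set.InjOn (e μ) (Set.Iio μ)) {r : W → ℕ → Bool} (hr : r.Injective)
    {g : L → L → K} (hg : ∀ β, Set.InjOn (g β) (Set.Iio β)) {h : L → W}
    (hh : ∀ i, Stat {δ ∈ {δ : L | LargeCof K δ} | h δ = i}) {H : Set W} (hH : Stat H)
    (x : L → Finset L) (hx : ∀ ε, ∀ α ∈ x ε, ε < α) :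
    ∃ ε δ, ∀ α ∈ x ε, ∀ β ∈ x δ, α < β ∧ ∃ i ∈ H, IsPick e r ((walk g α β).image h) i := by
  have := RegularOrder.infinite (L := K)
  have hWL : lift.{u} #W < lift.{u} #L := by simpa using hWK.trans hKL
  have hΛ : ∀ δ : L, LargeCof K δ → ∀ β, δ ≤ β → ∃ ζ < δ, ∀ α, ζ ≤ α → α < δ →
      walk g α β = walk g δ β ∪ walk g α δ := fun δ hδ => hδ.exists_walk_eq hg
  choose! Λ hΛlt hΛ using hΛ
  have hz : ∀ δ : L, LargeCof K δ → ∃ ζ < δ, ∀ β ∈ x δ, Λ δ β < ζ := fun δ hδ => by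
    obtain ⟨b, hb, hb'⟩ := hδ (Λ δ '' x δ) (by
      rintro _ ⟨β, hβ, rfl⟩
      exact hΛlt δ hδ β (hx δ β hβ).le) (by
      refine lt_of_lt_of_le (b := ℵ₀) ?_ (by simp)
      exact (((x δ).finite_toSet).image _).lt_aleph0)
    exact ⟨b, hb, fun β hβ => hb' _ ⟨β, hβ, rfl⟩⟩
  choose! z hzlt hz using hz
  choose ζ hζ using fun i => (hh i).fodor z fun δ hδ => hzlt δ hδ.1
  obtain ⟨ζ₁, hζ₁⟩ := exists_family_bound hWL ζ
  choose gx hgx using fun a => exists_finset_bound (x a)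
  choose P hPmem hPgt hPcl using fun j a => (hh j).exists_closed₁ gx a
  obtain ⟨γ, hγ, hγζ, hγcl⟩ :=
    (stat_setOf_largeCof (L := L) hKL).exists_closed hWL P ζ₁
  choose D hDmem hDgt using fun i => (hζ i).exists_gt γ
  obtain ⟨b, hb, hb'⟩ := hγ (Set.range fun i => Λ γ (D i)) (by
    rintro _ ⟨i, rfl⟩
    exact hΛlt γ hγ _ (hDgt i).le) (mk_range_le.trans_lt hWK)
  set ζ₂ := max ζ₁ b
  have hζ₂ : ζ₂ < γ := max_lt hγζ hb
  have hPγ : ∀ j, P j ζ₂ < γ := fun j => hγcl j _ hζ₂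
  let ε : W → L := fun j => max ζ₂ (Λ (P j ζ₂) γ)
  have hε : ∀ j, ε j < P j ζ₂ := fun j =>
    max_lt (hPgt _ _) (hΛlt _ (hPmem _ _).1 _ (hPγ j).le)
  obtain ⟨i, hi, j, hij⟩ := exists_isPick hW he hr hH fun i =>
    ((x (D i)).biUnion fun β => (walk g (D i) β ∪ walk g γ (D i)).image h) ∪
      ((x (ε i)).biUnion fun α => (walk g α γ).image h)
  refine ⟨ε j, D i, fun α hα β hβ => ?_⟩
  have hεα := hx _ _ hα
  have hζα : ζ₂ < α := (le_max_left _ _).trans_lt hεα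
  have hαP : α < P j ζ₂ := (hgx _ _ hα).trans (hPcl _ _ _ (hε j))
  have hαγ : α < γ := hαP.trans (hPγ j)
  have hαD : α < D i := hαγ.trans (hDgt i)
  have hDβ := hx _ _ hβ
  refine ⟨hαD.trans hDβ, i, hi, ?_⟩
  have h1 : walk g α β = walk g (D i) β ∪ walk g α (D i) := by
    refine hΛ _ (hDmem i).1.1 _ hDβ.le α ?_ hαD
    refine ((hz _ (hDmem i).1.1 β hβ).le.trans ?_).trans hζα.le
    rw [(hDmem i).2]
    exact (hζ₁ i).le.trans (le_max_left _ _)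
  have h2 : walk g α (D i) = walk g γ (D i) ∪ walk g α γ :=
    hΛ _ hγ _ (hDgt i).le α
      (((hb' _ ⟨i, rfl⟩).le.trans (le_max_right _ _)).trans hζα.le) hαγ
  have h3 : walk g α γ = walk g (P j ζ₂) γ ∪ walk g α (P j ζ₂) :=
    hΛ _ (hPmem _ _).1 _ (hPγ j).le α ((le_max_right _ _).trans hεα.le) hαP
  rw [h1, h2, ← Finset.union_assoc, Finset.image_union]
  refine hij _ _ ?_ ?_ ?_ ?_
  · exact Finset.mem_image.2 ⟨D i, Finset.mem_union_right _ (mem_walk_self g (hDgt i)),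
      (hDmem i).1.2⟩
  · exact (Finset.subset_biUnion_of_mem
      (fun β => (walk g (D i) β ∪ walk g γ (D i)).image h) hβ).trans Finset.subset_union_left
  · refine Finset.mem_image.2 ⟨P j ζ₂, ?_, (hPmem _ _).2⟩
    rw [h3]
    exact Finset.mem_union_right _ (mem_walk_self g hαP)
  · exact (Finset.subset_biUnion_of_mem
      (fun α => (walk g α γ).image h) hα).trans Finset.subset_union_right

end Walk

section Cellular

variable {X Y : Type u} [TopologicalSpace X] [TopologicalSpace Y]

theorem isCellularFamily_range {ι : Type u} {V : ι → Set X}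
    (hV : ∀ i, IsOpen (V i) ∧ (V i).Nonempty) (hd : Pairwise (Function.onFun Disjoint V)) :
    IsCellularFamily (Set.range V) ∧ #(Set.range V) = #ι := by
  refine ⟨⟨?_, hd.range_pairwise⟩, mk_range_eq V fun i j hij => ?_⟩
  · rintro _ ⟨i, rfl⟩
    exact hV i
  · by_contra hne
    have := hd hne
    rw [Function.onFun, hij, disjoint_self] at this
    exact (hV j).2.ne_empty this

theorem IsCellularFamily.mono {S T : Set (Set X)} (hS : IsCellularFamily S) (h : T ⊆ S) :
    IsCellularFamily T :=
  ⟨fun U hU => hS.1 U (h hU), hS.2.subset h⟩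

theorem IsCellularFamily.preimage {S : Set (Set X)} (hS : IsCellularFamily S) {f : Y → X}
    (hf : Continuous f) (hne : ∀ U ∈ S, (f ⁻¹' U).Nonempty) :
    ∃ T : Set (Set Y), IsCellularFamily T ∧ #T = #S := by
  obtain ⟨h1, h2⟩ := isCellularFamily_range (V := fun U : S => f ⁻¹' U)
    (fun U => ⟨(hS.1 U U.2).1.preimage hf, hne U U.2⟩)
    fun U V hUV => (hS.2 U.2 V.2 (Subtype.coe_ne_coe.2 hUV)).preimage f
  exact ⟨_, h1, h2⟩

theorem mk_lt_of_isCellularFamily_sum {μ : Cardinal.{u}} (hμ : ℵ₀ ≤ μ)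
    (hX : ∀ S : Set (Set X), IsCellularFamily S → #S < μ)
    (hY : ∀ S : Set (Set Y), IsCellularFamily S → #S < μ)
    (S : Set (Set (X ⊕ Y))) (hS : IsCellularFamily S) : #S < μ := by
  obtain ⟨S₁, h₁, h₁'⟩ := (hS.mono (Set.sep_subset S fun U => (Sum.inl ⁻¹' U).Nonempty)).preimage
    (continuous_inl (X := X) (Y := Y)) fun U hU => hU.2
  obtain ⟨S₂, h₂, h₂'⟩ := (hS.mono (Set.sep_subset S fun U => (Sum.inr ⁻¹' U).Nonempty)).preimage
    (continuous_inr (X := X) (Y := Y)) fun U hU => hU.2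
  have hsub : S ⊆ {U ∈ S | (Sum.inl ⁻¹' U).Nonempty} ∪ {U ∈ S | (Sum.inr ⁻¹' U).Nonempty} := by
    intro U hU
    obtain ⟨x | y, hx⟩ := (hS.1 U hU).2
    · exact Or.inl ⟨hU, x, hx⟩
    · exact Or.inr ⟨hU, y, hx⟩
  refine ((mk_le_mk_of_subset hsub).trans (mk_union_le _ _)).trans_lt ?_
  rw [← h₁', ← h₂']
  exact add_lt_of_lt hμ (hX _ h₁) (hY _ h₂)

theorem IsCellularFamily.mk_le {S : Set (Set X)} (hS : IsCellularFamily S) : #S ≤ #X := by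
  choose f hf using fun U : S => (hS.1 U U.2).2
  refine mk_le_of_injective (f := f) fun U V hUV => ?_
  by_contra hne
  exact (Set.disjoint_left.1 (hS.2 U.2 V.2 (Subtype.coe_ne_coe.2 hne)) (hf U)) (hUV ▸ hf V)

theorem IsCellularFamily.mk_lt_cellularity' {S : Set (Set X)} (hS : IsCellularFamily S) :
    #S < cellularity' X := by
  have hne : {μ : Cardinal.{u} | ¬ ∃ S : Set (Set X), IsCellularFamily S ∧ #S = μ}.Nonempty :=
    ⟨Order.succ #X, fun ⟨T, hT, h⟩ => (Order.lt_succ #X).not_ge (h ▸ hT.mk_le)⟩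
  by_contra! hle
  obtain ⟨T, hTS, hT⟩ := le_mk_iff_exists_subset.1 hle
  exact csInf_mem hne ⟨T, hS.mono hTS, hT⟩

theorem cellularity'_le {μ : Cardinal.{u}}
    (h : ∀ S : Set (Set X), IsCellularFamily S → #S < μ) : cellularity' X ≤ μ :=
  csInf_le' fun ⟨S, hS, hSμ⟩ => (h S hS).ne hSμ

end Cellular

section CliqueSpace

variable {L : Type u} [LinearOrder L]

/-- The space of (indicator functions of) sets all of whose increasing pairs satisfy `G`. -/
def cliqueSpace (G : L → L → Prop) : Set (L → Bool) :=
  {A | ∀ α β, α < β → A α = true → A β = true → G α β}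

theorem isClosed_cliqueSpace (G : L → L → Prop) : IsClosed (cliqueSpace G) := by
  have : cliqueSpace G = ⋂ α, ⋂ β, {A | α < β → A α = true → A β = true → G α β} := by
    ext A
    simp [cliqueSpace]
  rw [this]
  refine isClosed_iInter fun α => isClosed_iInter fun β => ?_
  have hc : Continuous fun A : L → Bool => (A α, A β) := by fun_prop
  exact (isClosed_discrete {p : Bool × Bool | α < β → p.1 = true → p.2 = true → G α β}).preimage hc

instance (G : L → L → Prop) : CompactSpace (cliqueSpace G) :=
  isCompact_iff_compactSpace.1 (isClosed_cliqueSpace G).isCompact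

/-- The basic clopen set of cliques containing `α`. -/
def cliquesAt (G : L → L → Prop) (α : L) : Set (cliqueSpace G) := {A | A.1 α = true}

theorem isOpen_cliquesAt (G : L → L → Prop) (α : L) : IsOpen (cliquesAt G α) := by
  have hc : Continuous fun A : cliqueSpace G => A.1 α :=
    (continuous_apply α).comp continuous_subtype_val
  exact (isOpen_discrete {true}).preimage hc

theorem cliquesAt_nonempty (G : L → L → Prop) (α : L) : (cliquesAt G α).Nonempty := by
  refine ⟨⟨fun β => decide (β = α), fun β γ h hβ hγ => ?_⟩, by simp [cliquesAt]⟩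
  simp only [decide_eq_true_eq] at hβ hγ
  exact absurd h (by simp [hβ, hγ])

theorem exists_finset_of_isOpen {G : L → L → Prop} {U : Set (cliqueSpace G)} (hU : IsOpen U)
    {p : cliqueSpace G} (hp : p ∈ U) :
    ∃ F : Finset L, ∀ q : cliqueSpace G, (∀ a ∈ F, q.1 a = p.1 a) → q ∈ U := by
  obtain ⟨O, hO, rfl⟩ := isOpen_induced_iff.1 hU
  obtain ⟨F, u, hu, hF⟩ := isOpen_pi_iff.1 hO p.1 hp
  refine ⟨F, fun q hq => hF fun a ha => ?_⟩
  rw [hq a ha]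
  exact (hu a ha).2

theorem mk_lt_of_isCellularFamily_cliqueSpace [WellFoundedLT L] [RegularOrder L] (hL : ℵ₀ < #L)
    {G : L → L → Prop}
    (hG : ∀ x : L → Finset L, (∀ ε, ∀ α ∈ x ε, ε < α) →
      ∃ ε δ, ∀ α ∈ x ε, ∀ β ∈ x δ, α < β ∧ G α β)
    (S : Set (Set (cliqueSpace G))) (hS : IsCellularFamily S) : #S < #L := by
  by_contra! hle
  obtain ⟨ψ⟩ := (Cardinal.le_def _ _).1 hle
  choose p hp using fun i => (hS.1 (ψ i) (ψ i).2).2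
  choose F hF using fun i => exists_finset_of_isOpen (hS.1 (ψ i) (ψ i).2).1 (hp i)
  let s : L → Finset L := fun i => (F i).filter fun a => (p i).1 a = true
  have hs : ∀ i a, a ∈ s i ↔ a ∈ F i ∧ (p i).1 a = true := fun i a => Finset.mem_filter
  obtain ⟨R, hR⟩ := (stat_univ hL).exists_trace hL F
  obtain ⟨R', hR'⟩ := hR.exists_trace hL s
  choose y hy hyε using hR'.exists_gt
  have hFR : ∀ ε a, a ∈ F (y ε) → a < y ε → a ∈ R := fun ε a h h' => by
    rw [← (hy ε).1.2]
    simp [h, h']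
  have hRF : ∀ ε a, a ∈ R → a ∈ F (y ε) ∧ a < y ε := fun ε a h => by
    rw [← (hy ε).1.2] at h
    simpa using h
  have hsR : ∀ ε a, a ∈ s (y ε) → a < y ε → a ∈ R' := fun ε a h h' => by
    rw [← (hy ε).2]
    simp [h, h']
  have hRs : ∀ ε a, a ∈ R' → a ∈ s (y ε) := fun ε a h => by
    rw [← (hy ε).2] at h
    exact (Finset.mem_filter.1 h).1
  let x : L → Finset L := fun ε => insert (y ε) ((F (y ε)).filter (y ε ≤ ·))
  have hxF : ∀ ε a, a ∈ F (y ε) → y ε ≤ a → a ∈ x ε := fun ε a h h' => by simp [x, h, h']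
  obtain ⟨ε, δ, hεδ⟩ := hG x fun ε α hα => by
    refine (hyε ε).trans_le ?_
    simp only [x, Finset.mem_insert, Finset.mem_filter] at hα
    rcases hα with rfl | hα
    exacts [le_rfl, hα.2]
  have hlt : y ε < y δ := (hεδ _ (by simp [x]) _ (by simp [x])).1
  let q : L → Bool := fun a => decide (a ∈ s (y ε) ∪ s (y δ))
  have hq : q ∈ cliqueSpace G := by
    intro α β hαβ hα hβ
    simp only [q, decide_eq_true_eq, Finset.mem_union] at hα hβ
    have h₁ : α ∈ s (y ε) → β ∈ s (y ε) → G α β := fun h h' =>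
      (p (y ε)).2 α β hαβ ((hs _ _).1 h).2 ((hs _ _).1 h').2
    have h₂ : α ∈ s (y δ) → β ∈ s (y δ) → G α β := fun h h' =>
      (p (y δ)).2 α β hαβ ((hs _ _).1 h).2 ((hs _ _).1 h').2
    rcases hα with hα | hα <;> rcases hβ with hβ | hβ
    · exact h₁ hα hβ
    · rcases lt_or_ge α (y ε) with h | h
      · exact h₂ (hRs _ _ (hsR _ _ hα h)) hβ
      rcases lt_or_ge β (y δ) with h' | h'
      · exact h₁ hα (hRs _ _ (hsR _ _ hβ h'))
      exact (hεδ α (hxF _ _ ((hs _ _).1 hα).1 h) β (hxF _ _ ((hs _ _).1 hβ).1 h')).2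
    · rcases lt_or_ge α (y δ) with h | h
      · exact h₁ (hRs _ _ (hsR _ _ hα h)) hβ
      rcases lt_or_ge β (y ε) with h' | h'
      · exact h₂ hα (hRs _ _ (hsR _ _ hβ h'))
      exact absurd hαβ
        (hεδ β (hxF _ _ ((hs _ _).1 hβ).1 h') α (hxF _ _ ((hs _ _).1 hα).1 h)).1.not_gt
    · exact h₂ hα hβ
  have hmem : ∀ i, (∀ a ∈ F i, a ∈ s (y ε) ∪ s (y δ) ↔ a ∈ s i) →
      (⟨q, hq⟩ : cliqueSpace G) ∈ (ψ i).1 :=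
    fun i hi => hF i _ fun a ha => by
      have := hi a ha
      rw [hs] at this
      rw [Bool.eq_iff_iff]
      simpa [q, ha] using this
  have hε : (⟨q, hq⟩ : cliqueSpace G) ∈ (ψ (y ε)).1 := hmem _ fun a ha => by
    refine ⟨fun h => (Finset.mem_union.1 h).elim id fun h => ?_, Finset.mem_union_left _⟩
    rcases lt_or_ge a (y δ) with h' | h'
    · exact hRs _ _ (hsR _ _ h h')
    · exact absurd (hεδ a (hxF _ _ ha (hlt.le.trans h')) a (hxF _ _ ((hs _ _).1 h).1 h')).1
        (lt_irrefl a)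
  have hδ : (⟨q, hq⟩ : cliqueSpace G) ∈ (ψ (y δ)).1 := hmem _ fun a ha => by
    refine ⟨fun h => (Finset.mem_union.1 h).elim (fun h => ?_) id, Finset.mem_union_right _⟩
    rcases lt_or_ge a (y ε) with h' | h'
    · exact hRs _ _ (hsR _ _ h h')
    rcases lt_or_ge a (y δ) with h'' | h''
    · exact absurd (hRF ε a (hFR δ a ha h'')).2 h'.not_gt
    · exact absurd (hεδ a (hxF _ _ ((hs _ _).1 h).1 h') a (hxF _ _ ha h'')).1 (lt_irrefl a)
  refine Set.disjoint_left.1 (hS.2 (ψ (y ε)).2 (ψ (y δ)).2 fun h => ?_) hε hδ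
  exact hlt.ne (ψ.injective (Subtype.ext h))

theorem mk_cliqueSpace_bot_le : #(cliqueSpace fun _ _ : L => False) ≤ #(Option L) := by
  classical
  refine mk_le_of_injective
    (f := fun A => if h : ∃ k, A.1 k = true then some h.choose else none) fun A B hAB => ?_
  have huniq : ∀ (A : cliqueSpace fun _ _ : L => False) k l,
      A.1 k = true → A.1 l = true → k = l := fun A k l hk hl => by
    rcases lt_trichotomy k l with h | h | h
    exacts [(A.2 k l h hk hl).elim, h, (A.2 l k h hl hk).elim]
  have hmem : ∀ (A : cliqueSpace fun _ _ : L => False) k,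
      A.1 k = true ↔ (if h : ∃ k, A.1 k = true then some h.choose else none) = some k := by
    intro A k
    split_ifs with h
    · simp only [Option.some.injEq]
      exact ⟨fun hk => huniq A _ _ h.choose_spec hk, fun hk => hk ▸ h.choose_spec⟩
    · simp only [iff_false]
      exact fun hk => h ⟨k, hk⟩
  refine Subtype.ext (funext fun k => ?_)
  rw [Bool.eq_iff_iff, hmem A, hmem B]
  simp only at hAB
  rw [hAB]

end CliqueSpace

theorem exists_injOn_of_mk_le {α K : Type u} [Nonempty K] {s : Set α} (h : #s ≤ #K) :
    ∃ f : α → K, Set.InjOn f s := by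
  obtain ⟨φ⟩ := (Cardinal.le_def _ _).1 h
  refine ⟨Function.extend Subtype.val φ fun _ => Classical.arbitrary K, fun a ha b hb hab => ?_⟩
  have h1 := Subtype.val_injective.extend_apply φ (fun _ => Classical.arbitrary K) ⟨a, ha⟩
  have h2 := Subtype.val_injective.extend_apply φ (fun _ => Classical.arbitrary K) ⟨b, hb⟩
  simp only at h1 h2
  rw [h1, h2] at hab
  exact congrArg Subtype.val (φ.injective hab)

theorem exists_disjoint_relations {κ : Cardinal.{u}} (hreg : κ.IsRegular) (hκ : aleph 1 < κ) :
    ∃ G : Bool → (Order.succ κ).ord.ToType → (Order.succ κ).ord.ToType → Prop,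
      (∀ α β, G true α β → ¬ G false α β) ∧
      ∀ b, ∀ x : (Order.succ κ).ord.ToType → Finset (Order.succ κ).ord.ToType,
        (∀ ε, ∀ α ∈ x ε, ε < α) → ∃ ε δ, ∀ α ∈ x ε, ∀ β ∈ x δ, α < β ∧ G b α β := by
  have hsucc := isRegular_succ hreg.aleph0_le
  have := regularOrder_ord_toType hsucc
  have := regularOrder_ord_toType hreg
  have := regularOrder_ord_toType isRegular_aleph_one.{u}
  let L := (Order.succ κ).ord.ToType
  let K := κ.ord.ToType
  let W := (aleph.{u} 1).ord.ToType
  have hLcard : #L = Order.succ κ := mk_ord_toType _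
  have hKcard : #K = κ := mk_ord_toType _
  have hWcard : #W = aleph 1 := mk_ord_toType _
  have hW : ℵ₀ < #W := by rw [hWcard]; exact aleph0_lt_aleph_one
  have hWK : #W < #K := by rwa [hWcard, hKcard]
  have hKL : #K < #L := by rw [hKcard, hLcard]; exact Order.lt_succ κ
  have := RegularOrder.nonempty K
  have := RegularOrder.nonempty W
  have hg : ∀ β : L, ∃ f : L → K, Set.InjOn f (Set.Iio β) := fun β => by
    refine exists_injOn_of_mk_le ?_
    rw [hKcard, ← Order.lt_succ_iff]
    exact (RegularOrder.mk_Iio_lt β).trans_eq hLcard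
  choose g hg using hg
  have he : ∀ μ : W, ∃ f : W → ℕ, Set.InjOn f (Set.Iio μ) := fun μ => by
    refine Set.countable_iff_exists_injOn.1 ?_
    rw [← le_aleph0_iff_set_countable, ← Order.lt_succ_iff, succ_aleph0]
    exact (RegularOrder.mk_Iio_lt μ).trans_eq hWcard
  choose e he using he
  obtain ⟨r, hr⟩ : ∃ r : W → ℕ → Bool, r.Injective := by
    have : lift.{0} #W ≤ lift.{u} #(ℕ → Bool) := by
      simpa [hWcard] using aleph_one_le_continuum
    obtain ⟨φ⟩ := lift_mk_le'.1 this
    exact ⟨φ, φ.injective⟩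
  obtain ⟨φW⟩ := (Cardinal.le_def W L).1 (hWK.trans hKL).le
  obtain ⟨h, hh⟩ := (stat_setOf_largeCof (L := L) hKL).exists_split (by simpa using hKL) g hg φW
  obtain ⟨φB⟩ := lift_mk_le'.1 (lift_mk_lt_of_finite W Bool).le
  obtain ⟨t, ht⟩ := (stat_univ hW).exists_split (lift_mk_lt_of_countable hW ℕ) e he φB
  refine ⟨fun b α β => ∃ i ∈ {i ∈ Set.univ | t i = b}, IsPick e r ((walk g α β).image h) i,
    ?_, fun b x hx => exists_forall_isPick hW hWK hKL he hr hg hh (ht b) x hx⟩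
  rintro α β ⟨i, hi, hip⟩ ⟨j, hj, hjp⟩
  obtain rfl := hip.unique hjp
  exact Bool.noConfusion (hi.2.symm.trans hj.2)

theorem stmt_4 (κ : Cardinal.{u}) (hreg : κ.IsRegular) (hκ : Cardinal.aleph 1 < κ) :
    ∃ (X : Type u) (_ : TopologicalSpace X),
      CompactSpace X ∧ T2Space X ∧ TotallyDisconnectedSpace X ∧
      cellularity' X = Order.succ κ ∧ Order.succ κ < cellularity' (X × X) := by
  have hsucc := isRegular_succ hreg.aleph0_le
  have := regularOrder_ord_toType hsucc
  obtain ⟨G, hdisj, hG⟩ := exists_disjoint_relations hreg hκ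
  let Y := cliqueSpace fun _ _ : κ.ord.ToType => False
  have hLcard : #(Order.succ κ).ord.ToType = Order.succ κ := mk_ord_toType _
  have hcc : ∀ b, ∀ S : Set (Set (cliqueSpace (G b))), IsCellularFamily S → #S < Order.succ κ :=
    fun b S hS => by
      refine (mk_lt_of_isCellularFamily_cliqueSpace ?_ (hG b) S hS).trans_eq hLcard
      rw [hLcard]
      exact hreg.aleph0_le.trans_lt (Order.lt_succ κ)
  have hY : ∀ S : Set (Set Y), IsCellularFamily S → #S < Order.succ κ := fun S hS => by
    rw [Order.lt_succ_iff]
    refine (hS.mk_le.trans mk_cliqueSpace_bot_le).trans ?_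
    rw [mk_option, mk_ord_toType]
    exact (add_one_eq hreg.aleph0_le).le
  refine ⟨cliqueSpace (G true) ⊕ (cliqueSpace (G false) ⊕ Y), inferInstance, inferInstance,
    inferInstance, inferInstance, le_antisymm ?_ ?_, ?_⟩
  · exact cellularity'_le <| mk_lt_of_isCellularFamily_sum hsucc.aleph0_le (hcc true) <|
      mk_lt_of_isCellularFamily_sum hsucc.aleph0_le (hcc false) hY
  · obtain ⟨h1, h2⟩ := isCellularFamily_range
      (X := cliqueSpace (G true) ⊕ (cliqueSpace (G false) ⊕ Y)) (ι := κ.ord.ToType)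
      (V := fun k => Sum.inr '' (Sum.inr '' cliquesAt _ k))
      (fun k => ⟨isOpenMap_inr _ (isOpenMap_inr _ (isOpen_cliquesAt _ k)),
        ((cliquesAt_nonempty _ k).image _).image _⟩)
      fun k l hkl => by
        refine Set.disjoint_image_of_injective Sum.inr_injective
          (Set.disjoint_image_of_injective Sum.inr_injective (Set.disjoint_left.2 ?_))
        intro A hA hA'
        rcases hkl.lt_or_gt with h | h
        · exact A.2 _ _ h hA hA'
        · exact A.2 _ _ h hA' hA
    rw [Order.succ_le_iff]
    exact ((mk_ord_toType κ).symm.trans h2.symm).trans_lt h1.mk_lt_cellularity'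
  · obtain ⟨h1, h2⟩ := isCellularFamily_range
      (X := (cliqueSpace (G true) ⊕ (cliqueSpace (G false) ⊕ Y)) ×
        (cliqueSpace (G true) ⊕ (cliqueSpace (G false) ⊕ Y)))
      (ι := (Order.succ κ).ord.ToType)
      (V := fun α => (Sum.inl '' cliquesAt _ α) ×ˢ (Sum.inr '' (Sum.inl '' cliquesAt _ α)))
      (fun α => ⟨(isOpenMap_inl _ (isOpen_cliquesAt _ α)).prod
          (isOpenMap_inr _ (isOpenMap_inl _ (isOpen_cliquesAt _ α))),
        ((cliquesAt_nonempty _ α).image _).prod (((cliquesAt_nonempty _ α).image _).image _)⟩)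
      fun α β hαβ => by
        refine Set.disjoint_left.2 ?_
        rintro _ ⟨⟨A, hA, hA1⟩, ⟨_, ⟨B, hB, rfl⟩, hB1⟩⟩ ⟨⟨A', hA', hA2⟩, ⟨_, ⟨B', hB', rfl⟩, hB2⟩⟩
        obtain rfl := Sum.inl_injective (hA1.trans hA2.symm)
        obtain rfl := Sum.inl_injective (Sum.inr_injective (hB1.trans hB2.symm))
        rcases hαβ.lt_or_gt with h | h
        · exact hdisj _ _ (A.2 _ _ h hA hA') (B.2 _ _ h hB hB')
        · exact hdisj _ _ (A.2 _ _ h hA' hA) (B.2 _ _ h hB' hB)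
    exact (hLcard.symm.trans h2.symm).trans_lt h1.mk_lt_cellularity'
end

section
/- For every singular cardinal κ there is a compact Hausdorff totally disconnected topological space X such that c'(X) = κ⁺ and c'(X × X) > κ⁺. -/
universe u

open Cardinal

open Order
open Filter (atTop)

/-! ### Well-orders of regular type -/

theorem exists_wellFounded_rec {T A : Type*} [LinearOrder T] [WellFoundedLT T] [Inhabited A]
    (Φ : T → (T → A) → A) :
    ∃ f : T → A, ∀ t, f t = Φ t (fun r => if r < t then f r else default) := by
  classical
  refine ⟨(wellFounded_lt (α := T)).fix fun t ih =>
    Φ t (fun r => if h : r < t then ih r h else default), fun t => ?_⟩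
  rw [WellFounded.fix_eq]
  congr 1

/-- The least strict upper bound of a set in a well-order (junk if there is none). -/
noncomputable def strictSup {α : Type*} [LinearOrder α] [WellFoundedLT α] [Nonempty α]
    (s : Set α) : α :=
  open Classical in
  if h : {b | ∀ x ∈ s, x < b}.Nonempty then (wellFounded_lt (α := α)).min _ h
  else Classical.arbitrary α

section strictSup

variable {α : Type*} [LinearOrder α] [WellFoundedLT α] [Nonempty α] {s : Set α}

theorem lt_strictSup (h : ∃ b, ∀ x ∈ s, x < b) {x : α} (hx : x ∈ s) : x < strictSup s := by
  have h' : {b | ∀ x ∈ s, x < b}.Nonempty := h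
  rw [strictSup, dif_pos h']
  exact WellFounded.min_mem _ _ h' x hx

theorem strictSup_le {b : α} (h : ∀ x ∈ s, x < b) : strictSup s ≤ b := by
  have h' : {b | ∀ x ∈ s, x < b}.Nonempty := ⟨b, h⟩
  rw [strictSup, dif_pos h']
  exact WellFounded.min_le _ (show b ∈ {b | ∀ x ∈ s, x < b} from h)

theorem exists_le_of_lt_strictSup {b : α} (h : b < strictSup s) : ∃ x ∈ s, b ≤ x := by
  by_contra! hc
  exact (strictSup_le hc).not_gt h

end strictSup

namespace Cardinal.IsRegular

variable {c : Cardinal.{u}}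

theorem nonempty_toType (hc : c.IsRegular) : Nonempty c.ord.ToType := by
  rw [← mk_ne_zero_iff, mk_ord_toType]
  exact hc.ne_zero

theorem exists_forall_mem_lt (hc : c.IsRegular) {s : Set c.ord.ToType} (hs : #s < c) :
    ∃ b, ∀ x ∈ s, x < b := by
  rw [← not_isCofinal_iff]
  intro h
  have := Order.cof_le h
  rw [Ordinal.cof_toType, hc.cof_ord] at this
  exact this.not_gt hs

theorem exists_forall_lt (hc : c.IsRegular) {ι : Type u} (hι : #ι < c) (F : ι → c.ord.ToType) :
    ∃ b, ∀ i, F i < b := by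
  obtain ⟨b, hb⟩ := hc.exists_forall_mem_lt (mk_range_le.trans_lt hι : #(Set.range F) < c)
  exact ⟨b, fun i => hb _ ⟨i, rfl⟩⟩

end Cardinal.IsRegular

theorem mk_Iio_ord_toType_lt {c : Cardinal.{u}} (b : c.ord.ToType) : #(Set.Iio b) < c := by
  simpa using mk_Iio_lt b (by simp)

/-! ### Club guessing -/

theorem exists_gt_closed_under {c : Cardinal.{u}} (hc : c.IsRegular) (hc' : ℵ₀ < c)
    (p : c.ord.ToType → c.ord.ToType) (t₀ : c.ord.ToType) :
    ∃ t, t₀ < t ∧ ∀ s < t, p s < t := by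
  have := hc.nonempty_toType
  have hq : ∀ s, ∃ b, s < b ∧ ∀ r ≤ s, p r < b := by
    intro s
    obtain ⟨b₀, hb₀⟩ := hc.exists_forall_lt (ι := PUnit.{u + 1})
      (by simpa using one_lt_aleph0.trans hc') (fun _ => s)
    obtain ⟨b, hb⟩ := hc.exists_forall_lt (mk_Iio_ord_toType_lt b₀) (fun r => p r.1)
    refine ⟨max b b₀, lt_max_of_lt_right (hb₀ ⟨⟩), fun r hr => lt_max_of_lt_left ?_⟩
    exact hb ⟨r, hr.trans_lt (hb₀ ⟨⟩)⟩
  choose q hq₁ hq₂ using hq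
  have hbd : ∃ b, ∀ x ∈ Set.range (fun n : ℕ => q^[n] t₀), x < b := by
    obtain ⟨b, hb⟩ := hc.exists_forall_lt (ι := ULift.{u} ℕ) (by simpa using hc')
      (fun n => q^[n.down] t₀)
    exact ⟨b, by rintro _ ⟨n, rfl⟩; exact hb ⟨n⟩⟩
  refine ⟨strictSup (Set.range (fun n : ℕ => q^[n] t₀)), lt_strictSup hbd ⟨0, rfl⟩, fun s hs => ?_⟩
  obtain ⟨_, ⟨n, rfl⟩, hn⟩ := exists_le_of_lt_strictSup hs
  refine (hq₂ _ _ hn).trans (lt_strictSup hbd ⟨n + 1, ?_⟩)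
  simp [Function.iterate_succ_apply']

theorem exists_club_guessing {θ : Cardinal.{u}} (hθ : θ.IsRegular) :
    ∃ C : (succ (succ θ)).ord.ToType → Set (succ (succ θ)).ord.ToType,
      ∀ p : (succ (succ θ)).ord.ToType → (succ (succ θ)).ord.ToType,
        ∃ a, θ ≤ #(C a) ∧ ∀ t ∈ C a, ∀ s < t, p s < t := by
  classical
  have h1 : (succ θ).IsRegular := isRegular_succ hθ.aleph0_le
  have h2 : (succ (succ θ)).IsRegular := isRegular_succ h1.aleph0_le
  have h12 : succ θ < succ (succ θ) := lt_succ _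
  have hθ2 : θ < succ (succ θ) := (lt_succ θ).trans h12
  have hω : ℵ₀ < succ (succ θ) := h1.aleph0_le.trans_lt h12
  set T := (succ (succ θ)).ord.ToType with hT
  have : Nonempty T := h2.nonempty_toType
  let W := (succ θ).ord.ToType
  choose A hA hAc using fun δ : T => Order.exists_cof_eq (Set.Iio δ)
  let Cl : (T → T) → Set T := fun p => {t | ∀ s < t, p s < t}
  -- the last closure point of `p` below `b`
  have hπ : ∀ (p : T → T) (b : T), ∃ x, IsGreatest {x | x ∈ Cl p ∧ x ≤ b} x := by
    intro p b
    let x := strictSup {y | ∃ z, z ∈ Cl p ∧ z ≤ b ∧ y < z}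
    have hbd : ∃ c, ∀ y ∈ {y | ∃ z, z ∈ Cl p ∧ z ≤ b ∧ y < z}, y < c :=
      ⟨b, fun y ⟨z, _, hz, hy⟩ => hy.trans_le hz⟩
    refine ⟨x, ⟨fun s hs => ?_, strictSup_le fun y ⟨z, _, hz, hy⟩ => hy.trans_le hz⟩, ?_⟩
    · obtain ⟨y, ⟨z, hz, hzb, hyz⟩, hsy⟩ := exists_le_of_lt_strictSup hs
      exact lt_strictSup hbd ⟨z, hz, hzb, hz s (hsy.trans_lt hyz)⟩
    · rintro z ⟨hz, hzb⟩
      by_contra! hlt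
      exact lt_irrefl x (lt_strictSup hbd ⟨z, hz, hzb, hlt⟩)
  choose π hπ using hπ
  by_contra! hcon
  -- `hcon` applied to the projected sequences
  have key : ∀ p : T → T, ∃ q : T → T, ∀ δ, θ ≤ #((π p) '' (Subtype.val '' A δ)) →
      ∃ t ∈ (π p) '' (Subtype.val '' A δ), t ∉ Cl q := by
    intro p
    obtain ⟨q, hq⟩ := hcon (fun δ => (π p) '' (Subtype.val '' A δ))
    refine ⟨q, fun δ hδ => ?_⟩
    obtain ⟨t, ht, s, hs, hqs⟩ := hq δ hδ
    exact ⟨t, ht, fun h => (h s hs).not_ge hqs⟩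
  choose Q hQ using key
  have hsup : ∀ F : W → T, ∃ b, ∀ w, F w < b := fun F =>
    h2.exists_forall_lt (by rw [mk_ord_toType]; exact h12) F
  obtain ⟨P, hP⟩ := @exists_wellFounded_rec W (T → T) _ _ ⟨id⟩ (fun w f t =>
      strictSup ((fun v => max (f v t) (Q (f v) t)) '' Set.Iio w))
  have hPlt : ∀ v w, v < w → ∀ t, P v t < P w t ∧ Q (P v) t < P w t := by
    intro v w hvw t
    have hmem : max (P v t) (Q (P v) t) < P w t := by
      rw [hP w]
      refine lt_strictSup ?_ ⟨v, hvw, by simp [hvw]⟩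
      obtain ⟨b, hb⟩ := hsup fun v => max ((if v < w then P v else id) t)
        (Q (if v < w then P v else id) t)
      exact ⟨b, by rintro _ ⟨v, _, rfl⟩; exact hb v⟩
    exact ⟨(le_max_left _ _).trans_lt hmem, (le_max_right _ _).trans_lt hmem⟩
  choose p hp using fun t => hsup fun w => P w t
  have hClp : ∀ w, Cl p ⊆ Cl (P w) := fun w t ht s hs => (hp s w).trans (ht s hs)
  have hClP : ∀ v w, v ≤ w → Cl (P w) ⊆ Cl (P v) := by
    intro v w hvw t ht s hs
    rcases hvw.eq_or_lt with rfl | hvw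
    · exact ht s hs
    · exact (hPlt v w hvw s).1.trans (ht s hs)
  have hπanti : ∀ b v w, v ≤ w → π (P w) b ≤ π (P v) b := fun b v w hvw =>
    (hπ (P v) b).2 ⟨hClP v w hvw (hπ (P w) b).1.1, (hπ (P w) b).1.2⟩
  -- a limit of closure points of cofinality `θ`
  choose nx hnx₁ hnx₂ using fun t => exists_gt_closed_under h2 hω p t
  obtain ⟨y, hy⟩ := @exists_wellFounded_rec θ.ord.ToType T _ _ ⟨Classical.arbitrary T⟩
    (fun v f => nx (strictSup (f '' Set.Iio v)))
  have hybd : ∀ F : θ.ord.ToType → T, ∃ b, ∀ w, F w < b := fun F =>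
    h2.exists_forall_lt (by rw [mk_ord_toType]; exact hθ2) F
  have hymono : StrictMono y := by
    intro v w hvw
    rw [hy w]
    suffices h : y v < strictSup ((fun r => if r < w then y r else Classical.arbitrary T) ''
        Set.Iio w) from h.trans (hnx₁ _)
    refine lt_strictSup ?_ ⟨v, hvw, by simp [hvw]⟩
    obtain ⟨b, hb⟩ := hybd fun v => if v < w then y v else (Classical.arbitrary T)
    exact ⟨b, by rintro _ ⟨v, _, rfl⟩; exact hb v⟩
  have hyCl : ∀ v, y v ∈ Cl p := fun v => by rw [hy v]; exact hnx₂ _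
  let δ := strictSup (Set.range y)
  have hyδ : ∀ v, y v < δ := fun v => lt_strictSup
    (by obtain ⟨b, hb⟩ := hybd y; exact ⟨b, by rintro _ ⟨v, rfl⟩; exact hb v⟩) ⟨v, rfl⟩
  have hycof : ∀ x < δ, ∃ v, x ≤ y v := by
    intro x hx
    obtain ⟨_, ⟨v, rfl⟩, hv⟩ := exists_le_of_lt_strictSup hx
    exact ⟨v, hv⟩
  have hcofδ : Order.cof (Set.Iio δ) = θ := by
    rw [← Order.cof_congr_of_strictMono (f := fun v => (⟨y v, hyδ v⟩ : Set.Iio δ))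
      (fun v w h => hymono h)
      (fun x => by obtain ⟨v, hv⟩ := hycof x.1 x.2; exact ⟨_, ⟨v, rfl⟩, hv⟩),
      Ordinal.cof_toType, hθ.cof_ord]
  -- the projections stabilise
  have hstab : ∀ b : T, ∃ w, ∀ w' ≥ w, π (P w') b = π (P w) b := by
    intro b
    have : Nonempty W := h1.nonempty_toType
    obtain ⟨_, ⟨w, rfl⟩, hw⟩ := (wellFounded_lt (α := T)).has_min
      (Set.range fun w => π (P w) b) (Set.range_nonempty _)
    exact ⟨w, fun w' hw' => le_antisymm (hπanti b w w' hw') (not_lt.1 (hw _ ⟨w', rfl⟩))⟩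
  choose st hst using hstab
  obtain ⟨w, hw⟩ := h1.exists_forall_lt (ι := A δ)
    (by rw [hAc, hcofδ]; exact lt_succ θ) (fun b => st b.1.1)
  obtain ⟨w', hw'⟩ := h1.exists_forall_lt (ι := PUnit.{u + 1})
    (by simpa using one_lt_aleph0.trans_le h1.aleph0_le) (fun _ => w)
  have hcard : θ ≤ #((π (P w)) '' (Subtype.val '' A δ)) := by
    have hcofin : IsCofinal {x : Set.Iio δ | x.1 ∈ (π (P w)) '' (Subtype.val '' A δ)} := by
      intro x
      obtain ⟨v, hv⟩ := hycof x.1 x.2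
      obtain ⟨b, hb, hvb⟩ := hA δ ⟨y v, hyδ v⟩
      refine ⟨⟨π (P w) b.1, (hπ _ _).1.2.trans_lt b.2⟩, ⟨b.1, ⟨b, hb, rfl⟩, rfl⟩, ?_⟩
      exact hv.trans ((hπ (P w) b.1).2 ⟨hClp w (hyCl v), hvb⟩)
    refine (hcofδ.symm.le.trans (Order.cof_le hcofin)).trans ?_
    exact mk_le_of_injective (f := fun x => ⟨x.1.1, x.2⟩) fun x y h => by
      simpa [Subtype.ext_iff] using h
  obtain ⟨t, ⟨_, ⟨b, hb, rfl⟩, rfl⟩, ht⟩ := hQ (P w) δ hcard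
  apply ht
  have hbw : st b.1 < w := hw ⟨b, hb⟩
  have heq : π (P w) b.1 = π (P w') b.1 := by
    rw [hst b.1 w hbw.le, hst b.1 w' (hbw.trans (hw' ⟨⟩)).le]
  rw [heq]
  exact fun s hs => (hPlt w w' (hw' ⟨⟩) s).2.trans ((hπ (P w') b.1).1.1 s hs)

/-! ### Sequences of functions increasing modulo bounded sets -/

section Bounding

variable {κ : Cardinal.{u}} {I : Type u} [LinearOrder I] {c : I → Cardinal.{u}}

theorem exists_eventual_bound (hω : ∀ i, ℵ₀ ≤ c i) (hc : ∀ θ < κ, ∀ᶠ i in atTop, θ < c i)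
    {T : Type u} (hT : #T ≤ κ) (F : T → I → Ordinal.{u})
    (hF : ∀ x i, F x i < (succ (c i)).ord) :
    ∃ h : I → Ordinal.{u}, (∀ i, h i < (succ (c i)).ord) ∧
      ∀ x, ∀ᶠ i in atTop, F x i < h i := by
  have hT' : #T ≤ #κ.ord.ToType := by simpa using hT
  obtain ⟨e⟩ := hT'
  let r : T → Ordinal.{u} := fun x => (Ordinal.ToType.mk.symm (e x)).1
  have hr : ∀ x, r x < κ.ord := fun x => (Ordinal.ToType.mk.symm (e x)).2
  have hrinj : Function.Injective r := fun x y h =>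
    e.injective (Ordinal.ToType.mk.symm.injective (Subtype.ext h))
  refine ⟨fun i => ⨆ x : {x : T // r x < (c i).ord}, (F x.1 i + 1), fun i => ?_, fun x => ?_⟩
  · apply Ordinal.iSup_add_one_lt_of_lt_cof
    · rw [(isRegular_succ (hω i)).cof_ord]
      refine lt_of_le_of_lt ?_ (lt_succ (c i))
      have h := mk_le_of_injective (α := ULift.{u + 1} {x : T // r x < (c i).ord})
        (β := Set.Iio (c i).ord) (f := fun x => ⟨r x.down.1, x.down.2⟩) fun x y h => by
          ext
          exact hrinj (Subtype.mk.inj h)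
      rw [mk_Iio_ordinal, mk_uLift, lift_le] at h
      simpa using h
    · exact fun x => hF _ _
  · have := hc (r x).card (lt_ord.1 (hr x))
    filter_upwards [this] with i hi
    have hx : r x < (c i).ord := lt_ord.2 hi
    refine lt_of_lt_of_le (Order.lt_add_one_iff.2 le_rfl)
      (Ordinal.le_iSup (fun x : {x : T // r x < (c i).ord} => F x.1 i + 1) ⟨x, hx⟩)

theorem exists_eventual_bound_uniform (hω : ∀ i, ℵ₀ ≤ c i)
    (hc : ∀ θ < κ, ∀ᶠ i in atTop, θ < c i)
    {T : Type u} (hT : #T ≤ κ) (F : T → I → Ordinal.{u})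
    (hF : ∀ x i, F x i < (succ (c i)).ord) (E : Set T) (hE : #E < κ) :
    ∃ h : I → Ordinal.{u}, (∀ i, h i < (succ (c i)).ord) ∧
      (∀ x, ∀ᶠ i in atTop, F x i < h i) ∧ ∀ᶠ i in atTop, ∀ x ∈ E, F x i < h i := by
  obtain ⟨h₁, h₁lt, hh₁⟩ := exists_eventual_bound hω hc hT F hF
  classical
  refine ⟨fun i => if #E < c i then max (h₁ i) (⨆ x : E, (F x.1 i + 1)) else h₁ i,
    fun i => ?_, fun x => ?_, ?_⟩
  · dsimp only
    split_ifs with hi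
    · refine max_lt (h₁lt i) ?_
      apply Ordinal.iSup_add_one_lt_of_lt_cof
      · rw [(isRegular_succ (hω i)).cof_ord]
        exact hi.trans (lt_succ _)
      · exact fun x => hF _ _
    · exact h₁lt i
  · filter_upwards [hh₁ x] with i hi
    split_ifs
    · exact lt_max_of_lt_left hi
    · exact hi
  · filter_upwards [hc _ hE] with i hi x hx
    rw [if_pos hi]
    exact lt_max_of_lt_right (lt_of_lt_of_le (Order.lt_add_one_iff.2 le_rfl)
      (Ordinal.le_iSup (fun x : E => F x.1 i + 1) ⟨x, hx⟩))

theorem exists_eventually_increasing (hω : ∀ i, ℵ₀ ≤ c i)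
    (hc : ∀ θ < κ, ∀ᶠ i in atTop, θ < c i)
    (E : (succ κ).ord.ToType → Set (succ κ).ord.ToType) (hE : ∀ δ, #(E δ) < κ) :
    ∃ f : (succ κ).ord.ToType → I → Ordinal.{u}, (∀ δ i, f δ i < (succ (c i)).ord) ∧
      (∀ x δ, x < δ → ∀ᶠ i in atTop, f x i < f δ i) ∧
      ∀ δ, ∀ᶠ i in atTop, ∀ x ∈ E δ, x < δ → f x i < f δ i := by
  let A := {h : I → Ordinal.{u} // ∀ i, h i < (succ (c i)).ord}
  have : Inhabited A := ⟨⟨fun _ => 0, fun i => by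
    rw [lt_ord, Ordinal.card_zero]; exact (bot_le).trans_lt (lt_succ (c i))⟩⟩
  have step : ∀ (δ : (succ κ).ord.ToType) (f : (succ κ).ord.ToType → A), ∃ h : A,
      (∀ x < δ, ∀ᶠ i in atTop, (f x).1 i < h.1 i) ∧
        ∀ᶠ i in atTop, ∀ x ∈ E δ, x < δ → (f x).1 i < h.1 i := by
    intro δ f
    obtain ⟨h, hlt, h₁, h₂⟩ := exists_eventual_bound_uniform hω hc (T := Set.Iio δ)
      (lt_succ_iff.1 (mk_Iio_ord_toType_lt δ)) (fun x => (f x.1).1) (fun x => (f x.1).2)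
      {x | x.1 ∈ E δ} (lt_of_le_of_lt (mk_le_of_injective (β := E δ)
        (f := fun x => ⟨x.1.1, x.2⟩) fun x y h => by simpa [Subtype.ext_iff] using h) (hE δ))
    refine ⟨⟨h, hlt⟩, fun x hx => h₁ ⟨x, hx⟩, ?_⟩
    filter_upwards [h₂] with i hi x hx hxδ
    exact hi ⟨x, hxδ⟩ hx
  choose Φ hΦ₁ hΦ₂ using step
  obtain ⟨f, hf⟩ := exists_wellFounded_rec Φ
  refine ⟨fun δ => (f δ).1, fun δ => (f δ).2, fun x δ hx => ?_, fun δ => ?_⟩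
  · have := hΦ₁ δ (fun r => if r < δ then f r else default) x hx
    rwa [← hf, if_pos hx] at this
  · have := hΦ₂ δ (fun r => if r < δ then f r else default)
    rw [← hf] at this
    filter_upwards [this] with i hi x hx hxδ
    have := hi x hx hxδ
    rwa [if_pos hxδ] at this

end Bounding

theorem exists_small_cofinal {κ : Cardinal.{u}} (hsing : κ.ord.cof < κ)
    (δ : (succ κ).ord.ToType) :
    ∃ A ⊆ Set.Iio δ, (∀ x < δ, ∃ y ∈ A, x ≤ y) ∧ #A < κ := by
  obtain ⟨A, hA, hAc⟩ := Order.exists_cof_eq (Set.Iio δ)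
  refine ⟨Subtype.val '' A, by rintro _ ⟨x, _, rfl⟩; exact x.2, fun x hx => ?_, ?_⟩
  · obtain ⟨y, hy, h⟩ := hA ⟨x, hx⟩
    exact ⟨y, ⟨y, hy, rfl⟩, h⟩
  · refine mk_image_le.trans_lt ?_
    rw [hAc]
    refine lt_of_le_of_ne ((Order.cof_le_cardinalMk _).trans
      (lt_succ_iff.1 (mk_Iio_ord_toType_lt δ))) fun h => ?_
    have := Order.cof_ord_cof (Set.Iio δ)
    rw [h] at this
    exact hsing.ne this

/-! ### Bounded projections -/

/-- The least element of `S` that is at least `x`. -/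
noncomputable def ordinalCeil (S : Set Ordinal.{u}) (x : Ordinal.{u}) : Ordinal.{u} :=
  sInf {s ∈ S | x ≤ s}

section ordinalCeil

variable {S : Set Ordinal.{u}} {x y s : Ordinal.{u}}

theorem ordinalCeil_mem (h : ∃ s ∈ S, x ≤ s) : ordinalCeil S x ∈ S :=
  (csInf_mem (s := {s ∈ S | x ≤ s}) h).1

theorem le_ordinalCeil (h : ∃ s ∈ S, x ≤ s) : x ≤ ordinalCeil S x :=
  (csInf_mem (s := {s ∈ S | x ≤ s}) h).2

theorem ordinalCeil_le (hs : s ∈ S) (h : x ≤ s) : ordinalCeil S x ≤ s :=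
  csInf_le' (s := {s ∈ S | x ≤ s}) ⟨hs, h⟩

theorem ordinalCeil_mono (h : ∃ s ∈ S, y ≤ s) (hxy : x ≤ y) :
    ordinalCeil S x ≤ ordinalCeil S y :=
  ordinalCeil_le (ordinalCeil_mem h) (hxy.trans (le_ordinalCeil h))

end ordinalCeil

theorem exists_ordinalCeil_bound {κ θ : Cardinal.{u}} (hκ : ℵ₀ ≤ κ) (hθ : θ.IsRegular)
    (hθκ : succ (succ θ) ≤ κ) {I : Type u} [LinearOrder I] [Nonempty I] (hI : #I < θ)
    {f : (succ κ).ord.ToType → I → Ordinal.{u}}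
    (hf : ∀ x δ, x < δ → ∀ᶠ i in atTop, f x i < f δ i)
    {A : (succ κ).ord.ToType → Set (succ κ).ord.ToType}
    (hA : ∀ δ, A δ ⊆ Set.Iio δ) (hAcof : ∀ δ, ∀ x < δ, ∃ y ∈ A δ, x ≤ y)
    (hE : ∀ δ, ∀ᶠ i in atTop, ∀ a ∈ A δ, ∀ b, (∀ x ∈ A δ, x < a → x < b) →
      (∀ b' < b, ∃ x ∈ A δ, x < a ∧ b' ≤ x) → f b i < f δ i)
    (S : I → Set Ordinal.{u}) (hS : ∀ i, #(S i) < lift.{u + 1} θ)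
    (hS' : ∀ i η, ∃ s ∈ S i, f η i ≤ s) :
    ∃ ξ, ∀ η, ∀ᶠ i in atTop, f η i ≤ ordinalCeil (S i) (f ξ i) := by
  classical
  have hV := isRegular_succ hκ
  have : Nonempty (succ κ).ord.ToType := hV.nonempty_toType
  have : Inhabited (succ κ).ord.ToType := ⟨Classical.arbitrary _⟩
  have hmono : ∀ x δ, x ≤ δ → ∀ᶠ i in atTop, f x i ≤ f δ i := by
    intro x δ h
    rcases h.eq_or_lt with rfl | h
    · exact .of_forall fun _ => le_rfl
    · exact (hf x δ h).mono fun _ h => h.le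
  have hgt : ∀ x : (succ κ).ord.ToType, ∃ y, x < y := fun x => by
    obtain ⟨b, hb⟩ := hV.exists_forall_lt (ι := PUnit.{u + 1})
      (by simpa using one_lt_aleph0.trans_le hV.aleph0_le) (fun _ => x)
    exact ⟨b, hb ⟨⟩⟩
  by_contra! hcon
  have hnext : ∀ ξ, ∃ η, ξ < η ∧ ∃ᶠ i in atTop, ordinalCeil (S i) (f ξ i) < f η i := by
    intro ξ
    obtain ⟨η, hη⟩ := hcon ξ
    have hη' : ∃ᶠ i in atTop, ordinalCeil (S i) (f ξ i) < f η i := by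
      simpa only [Filter.not_eventually, not_le] using hη
    refine ⟨η, ?_, hη'⟩
    by_contra! hle
    obtain ⟨i, hi, hi'⟩ := (hη'.and_eventually (hmono _ _ hle)).exists
    exact absurd (hi.trans_le (hi'.trans (le_ordinalCeil (hS' i ξ)))) (lt_irrefl _)
  set T := (succ (succ θ)).ord.ToType with hT
  obtain ⟨C, hC⟩ := exists_club_guessing hθ
  have hTκ : #T < succ κ := by rw [hT, mk_ord_toType]; exact lt_succ_iff.2 hθκ
  have hbd : ∀ F : T → (succ κ).ord.ToType, ∃ b, ∀ t, F t < b := hV.exists_forall_lt hTκ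
  have hbd' : ∀ (F : T → (succ κ).ord.ToType) (s : Set T), ∃ b, ∀ x ∈ F '' s, x < b := by
    intro F s
    obtain ⟨b, hb⟩ := hbd F
    exact ⟨b, by rintro _ ⟨t, _, rfl⟩; exact hb t⟩
  let X : (T → (succ κ).ord.ToType) → T → (succ κ).ord.ToType :=
    fun n t => strictSup (n '' Set.Iio t)
  let H : (T → (succ κ).ord.ToType) → T → T → I → Ordinal.{u} :=
    fun n a s i => ⨆ r : {r : T // r ∈ C a ∧ r ≤ s}, f (X n r.1) i
  let spec : (T → (succ κ).ord.ToType) → T → (succ κ).ord.ToType →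
      (succ κ).ord.ToType → Prop := fun n t m v =>
    X n t ≤ m ∧ m < v ∧ (∃ᶠ i in atTop, ordinalCeil (S i) (f m i) < f v i) ∧
      ∀ a, (∃ η, ∀ᶠ i in atTop, H n a t i < f η i) → ∀ᶠ i in atTop, H n a t i < f m i
  have step : ∀ t n, ∃ v, ∃ m, spec n t m v := by
    intro t n
    have h1 : ∀ a, ∃ m₀, (∃ η, ∀ᶠ i in atTop, H n a t i < f η i) →
        ∀ᶠ i in atTop, H n a t i < f m₀ i := by
      intro a
      by_cases h : ∃ η, ∀ᶠ i in atTop, H n a t i < f η i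
      · exact ⟨h.choose, fun _ => h.choose_spec⟩
      · exact ⟨default, fun h' => absurd h' h⟩
    choose m₀ hm₀ using h1
    obtain ⟨b, hb⟩ := hbd m₀
    obtain ⟨v, hv, hv'⟩ := hnext (max b (X n t))
    refine ⟨v, max b (X n t), le_max_right _ _, hv, hv', fun a ha => ?_⟩
    filter_upwards [hm₀ a ha, hmono (m₀ a) (max b (X n t)) ((hb a).le.trans (le_max_left _ _))]
      with i h1 h2
    exact h1.trans_le h2
  choose Φ hΦ using step
  obtain ⟨N, hN⟩ := exists_wellFounded_rec Φ
  have hspec : ∀ t, ∃ m, spec N t m (N t) := by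
    intro t
    obtain ⟨m, hm⟩ := hΦ t (fun r => if r < t then N r else default)
    rw [← hN t] at hm
    have hX : ∀ r ≤ t, X (fun r => if r < t then N r else default) r = X N r := by
      intro r hr
      simp only [X]
      congr 1
      refine Set.image_congr fun q hq => ?_
      rw [if_pos (lt_of_lt_of_le hq hr)]
    have hH : ∀ a, H (fun r => if r < t then N r else default) a t = H N a t := by
      intro a
      funext i
      simp only [H]
      congr 1
      funext r
      rw [hX r.1 r.2.2]
    refine ⟨m, ?_⟩
    simp only [spec, hX t le_rfl, hH] at hm
    exact hm
  choose M hXM hMN hfreq hHM using hspec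
  have hNX : ∀ s t, s < t → N s < X N t := fun s t h => lt_strictSup (hbd' N _) ⟨s, h, rfl⟩
  have hXN : ∀ s, X N s < N s := fun s => (hXM s).trans_lt (hMN s)
  let δ := strictSup (N '' Set.univ)
  have hNδ : ∀ s, N s < δ := fun s => lt_strictSup (hbd' N _) ⟨s, trivial, rfl⟩
  choose Y hYA hNY using fun s => hAcof δ (N s) (hNδ s)
  have hYN : ∀ s, ∃ t, Y s ≤ N t := fun s => by
    obtain ⟨_, ⟨t, _, rfl⟩, ht⟩ := exists_le_of_lt_strictSup (show Y s < δ from hA δ (hYA s))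
    exact ⟨t, ht⟩
  choose p hp using hYN
  obtain ⟨a, hCa, hap⟩ := hC p
  have hδE : ∀ᶠ i in atTop, ∀ t ∈ C a, f (X N t) i < f δ i := by
    filter_upwards [hE δ] with i hi t ht
    have hYX : ∀ s < t, Y s < X N t := fun s hs =>
      (hp s).trans_lt (hNX _ _ (hap t ht s hs))
    obtain ⟨b, ⟨hbA, hbX⟩, hbmin⟩ := (wellFounded_lt (α := (succ κ).ord.ToType)).has_min
      {b | b ∈ A δ ∧ X N t ≤ b} ⟨Y t, hYA t, (hXN t).le.trans (hNY t)⟩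
    refine hi b hbA _ (fun x hx hxb => ?_) fun b' hb' => ?_
    · by_contra! h
      exact hbmin x ⟨hx, h⟩ hxb
    · obtain ⟨_, ⟨s, hs, rfl⟩, hb's⟩ := exists_le_of_lt_strictSup hb'
      exact ⟨Y s, hYA s, (hYX s hs).trans_le hbX, hb's.trans (hNY s)⟩
  have hHlt : ∀ s, ∀ᶠ i in atTop, H N a s i < f (M s) i := by
    intro s
    apply hHM
    obtain ⟨η, hη⟩ := hgt δ
    refine ⟨η, ?_⟩
    filter_upwards [hδE, hf δ η hη] with i h1 h2
    exact lt_of_le_of_lt (Ordinal.iSup_le fun r => (h1 r.1 r.2.1).le) h2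
  have hsucc : ∀ s : C a, ∃ i, ordinalCeil (S i) (f (M s) i) < f (N s) i ∧
      H N a s i < f (M s) i ∧ ∀ t ∈ C a, s.1 < t → f (N s) i ≤ H N a t i := by
    intro s
    have h3 : ∀ᶠ i in atTop, ∀ t ∈ C a, s.1 < t → f (N s) i ≤ H N a t i := by
      by_cases h : ∃ t ∈ C a, s.1 < t
      · obtain ⟨t₀, ⟨ht₀, hst₀⟩, hmin⟩ := (wellFounded_lt (α := T)).has_min
          {t | t ∈ C a ∧ s.1 < t} h
        filter_upwards [hf _ _ (hNX _ _ hst₀)] with i hi t ht hst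
        exact hi.le.trans (Ordinal.le_iSup (fun r : {r : T // r ∈ C a ∧ r ≤ t} => f (X N r.1) i)
          ⟨t₀, ht₀, not_lt.1 (hmin t ⟨ht, hst⟩)⟩)
      · push Not at h
        exact .of_forall fun i t ht hst => absurd hst (h t ht).not_gt
    obtain ⟨i, h1, h2, h4⟩ := ((hfreq s).and_eventually ((hHlt s).and h3)).exists
    exact ⟨i, h1, h2, h4⟩
  choose j hj₁ hj₂ hj₃ using hsucc
  obtain ⟨i, hi⟩ := infinite_pigeonhole_card j θ hCa hθ.aleph0_le (by rwa [hθ.cof_ord])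
  have hstrict : StrictMono fun s : j ⁻¹' {i} => ordinalCeil (S i) (f (M s.1) i) := by
    rintro ⟨s, hs⟩ ⟨t, ht⟩ hst
    have hs : j s = i := hs
    have ht : j t = i := ht
    have hst : s < t := hst
    have h1 := hj₁ s
    have h2 := hj₂ t
    have h3 := hj₃ s t t.2 hst
    rw [hs] at h1 h3
    rw [ht] at h2
    exact h1.trans_le (h3.trans (h2.le.trans (le_ordinalCeil (hS' i _))))
  have hle := mk_le_of_injective
    (f := fun s : ULift.{u + 1} (j ⁻¹' {i}) =>
      (⟨ordinalCeil (S i) (f (M s.down.1) i), ordinalCeil_mem (hS' i _)⟩ : S i))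
    fun s t h => by
      have := hstrict.injective (Subtype.mk.inj h)
      exact ULift.ext _ _ this
  rw [mk_uLift] at hle
  exact ((lift_le.2 hi).trans hle).not_gt (hS i)

/-! ### Exact upper bounds -/

/-- Small pointwise projections of the sequence `f` are eventually bounded by a single one. -/
def HasCeilBounds (κ : Cardinal.{u}) {I V : Type u} [LinearOrder I] (f : V → I → Ordinal.{u}) :
    Prop :=
  ∀ θ : Cardinal.{u}, θ.IsRegular → #I < θ → succ (succ θ) ≤ κ →
    ∀ S : I → Set Ordinal.{u}, (∀ i, #(S i) < lift.{u + 1} θ) →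
      (∀ i η, ∃ s ∈ S i, f η i ≤ s) →
      ∃ ξ, ∀ η, ∀ᶠ i in atTop, f η i ≤ ordinalCeil (S i) (f ξ i)

/-- `g` is an exact upper bound of `f` modulo bounded sets. -/
def IsExactUpperBound {I V : Type u} [LinearOrder I] (f : V → I → Ordinal.{u})
    (g : I → Ordinal.{u}) : Prop :=
  (∀ η, ∀ᶠ i in atTop, f η i ≤ g i) ∧
    ∀ d : I → Ordinal.{u}, (∀ᶠ i in atTop, d i < g i) → ∃ ξ, ∀ᶠ i in atTop, d i < f ξ i

theorem not_strictAnti_of_infinite {α : Type*} [LinearOrder α] [WellFoundedLT α] [Infinite α]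
    (h : α → Ordinal.{u}) : ¬ StrictAnti h := by
  intro hh
  obtain ⟨g, hg⟩ := exists_increasing_or_nonincreasing_subseq (· < ·) (Infinite.natEmbedding α)
  rcases hg with hg | hg
  · obtain ⟨n, hn⟩ := WellFounded.not_rel_apply_succ (r := (· < · : Ordinal.{u} → _ → Prop))
      fun n => h (Infinite.natEmbedding α (g n))
    exact hn (hh (hg n (n + 1) n.lt_succ_self))
  · obtain ⟨n, hn⟩ := WellFounded.not_rel_apply_succ (r := (· < · : α → _ → Prop))
      fun n => Infinite.natEmbedding α (g n)
    refine (not_lt.1 (hg n (n + 1) n.lt_succ_self)).lt_of_ne (fun h => ?_) |> hn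
    have := g.injective ((Infinite.natEmbedding α).injective h)
    omega

theorem exists_isExactUpperBound {κ : Cardinal.{u}} (hκ : ℵ₀ ≤ κ) {I : Type u} [LinearOrder I]
    [Nonempty I] [NoMaxOrder I]
    (hI : ℵ₀ ≤ #I) (hIκ : succ (succ (succ #I)) ≤ κ)
    {f : (succ κ).ord.ToType → I → Ordinal.{u}}
    (hf : ∀ x δ, x < δ → ∀ᶠ i in atTop, f x i < f δ i) (hB : HasCeilBounds κ f)
    {l : I → Ordinal.{u}} (hl : ∀ η i, f η i < l i) :
    ∃ g, (∀ i, g i ≤ l i) ∧ IsExactUpperBound f g := by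
  classical
  have hV := isRegular_succ hκ
  have : Nonempty (succ κ).ord.ToType := hV.nonempty_toType
  have hW := isRegular_succ hI
  set W := (succ #I).ord.ToType with hWdef
  by_contra! hcon
  let S : (W → I → Ordinal.{u}) → W → I → Set Ordinal.{u} :=
    fun d α i => insert (l i) ((fun β => d β i) '' Set.Iio α)
  have hS : ∀ d α i, #(S d α i) < lift.{u + 1} (succ #I) := by
    intro d α i
    refine (mk_insert_le).trans_lt (add_lt_of_lt (aleph0_le_lift.2 hW.aleph0_le) ?_
      (one_lt_aleph0.trans_le (aleph0_le_lift.2 hW.aleph0_le)))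
    refine lt_of_le_of_lt ?_ (lift_lt.2 (mk_Iio_ord_toType_lt α))
    rw [← mk_uLift]
    refine mk_le_of_surjective (f := fun β : ULift.{u + 1} (Set.Iio α) =>
      ⟨d β.down.1 i, β.down.1, β.down.2, rfl⟩) ?_
    rintro ⟨_, β, hβ, rfl⟩
    exact ⟨⟨β, hβ⟩, rfl⟩
  have hS' : ∀ d α i η, ∃ s ∈ S d α i, f η i ≤ s := fun d α i η =>
    ⟨l i, Set.mem_insert _ _, (hl η i).le⟩
  let spec : (W → I → Ordinal.{u}) → W → (I → Ordinal.{u}) → (succ κ).ord.ToType → Prop :=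
    fun d α e ξ => (∀ η, ∀ᶠ i in atTop, f η i ≤ ordinalCeil (S d α i) (f ξ i)) ∧
      (∀ᶠ i in atTop, e i < ordinalCeil (S d α i) (f ξ i)) ∧
      ∀ ξ', ∃ᶠ i in atTop, f ξ' i ≤ e i
  have step : ∀ α d, ∃ e ξ, spec d α e ξ := by
    intro α d
    obtain ⟨ξ, hξ⟩ := hB _ hW (lt_succ _) hIκ (S d α) (hS d α) (hS' d α)
    have := hcon (fun i => ordinalCeil (S d α i) (f ξ i))
      (fun i => ordinalCeil_le (Set.mem_insert _ _) (hl ξ i).le)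
    simp only [IsExactUpperBound, not_and, not_forall, not_exists] at this
    obtain ⟨e, he, he'⟩ := this hξ
    exact ⟨e, ξ, hξ, he, fun ξ' => by
      simpa only [Filter.not_eventually, not_lt] using he' ξ'⟩
  choose Φ hΦ using step
  obtain ⟨d, hd⟩ := @exists_wellFounded_rec W (I → Ordinal.{u}) _ _ ⟨0⟩ Φ
  have hspec : ∀ α, ∃ ξ, spec d α (d α) ξ := by
    intro α
    obtain ⟨ξ, hξ⟩ := hΦ α (fun r => if r < α then d r else (0 : I → Ordinal.{u}))
    have hSd : S (fun r => if r < α then d r else (0 : I → Ordinal.{u})) α = S d α := by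
      funext i
      simp only [S]
      congr 1
      refine Set.image_congr fun q hq => ?_
      rw [if_pos (show q < α from hq)]
    refine ⟨ξ, ?_⟩
    have h' := hd α
    change d α = Φ α (fun r => if r < α then d r else (0 : I → Ordinal.{u})) at h'
    rw [h']
    simp only [spec, hSd] at hξ ⊢
    exact hξ
  choose ξ hξ₁ hξ₂ hξ₃ using hspec
  obtain ⟨ζ, hζ⟩ := hV.exists_forall_lt (ι := W)
    (by rw [hWdef, mk_ord_toType]
        exact lt_succ_iff.2 (((lt_succ _).trans (lt_succ _)).le.trans hIκ)) ξ
  let H : W → I → Ordinal.{u} := fun α i => ordinalCeil (S d α i) (f ζ i)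
  have hpick : ∀ α, ∃ i, d α i < H α i ∧ f ζ i ≤ d α i := by
    intro α
    obtain ⟨i, h1, h2, h3⟩ := ((hξ₃ α ζ).and_eventually ((hξ₂ α).and (hf _ _ (hζ α)))).exists
    exact ⟨i, h2.trans_le (ordinalCeil_mono (hS' d α i _) h3.le), h1⟩
  choose j hj₁ hj₂ using hpick
  obtain ⟨i, hi⟩ := infinite_pigeonhole_card j (succ #I) (by rw [hWdef, mk_ord_toType])
    hW.aleph0_le (by rw [hW.cof_ord]; exact lt_succ _)
  · have : Infinite (j ⁻¹' {i}) := infinite_iff.2 (hW.aleph0_le.trans hi)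
    refine not_strictAnti_of_infinite (fun α : j ⁻¹' {i} => H α.1 i) ?_
    rintro ⟨α, hα⟩ ⟨β, hβ⟩ hαβ
    have hα : j α = i := hα
    have h1 := hj₁ α
    have h2 := hj₂ α
    rw [hα] at h1 h2
    have hmem : d α i ∈ S d β i := Set.mem_insert_of_mem _ ⟨α, hαβ, rfl⟩
    exact (ordinalCeil_le hmem h2).trans_lt h1

theorem IsExactUpperBound.eventually_le_cof {κ : Cardinal.{u}} (hκ : ℵ₀ ≤ κ) {I : Type u}
    [LinearOrder I] [Nonempty I] [NoMaxOrder I]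
    {f : (succ κ).ord.ToType → I → Ordinal.{u}}
    (hf : ∀ x δ, x < δ → ∀ᶠ i in atTop, f x i < f δ i) (hB : HasCeilBounds κ f)
    {l : I → Ordinal.{u}} (hl : ∀ η i, f η i < l i) {g : I → Ordinal.{u}}
    (hg : IsExactUpperBound f g) {θ : Cardinal.{u}} (hθ : θ.IsRegular) (hIθ : #I < θ)
    (hθκ : succ (succ θ) ≤ κ) : ∀ᶠ i in atTop, θ ≤ (g i).cof := by
  classical
  have hV := isRegular_succ hκ
  have : Nonempty (succ κ).ord.ToType := hV.nonempty_toType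
  have hgt : ∀ x : (succ κ).ord.ToType, ∃ y, x < y := fun x => by
    obtain ⟨b, hb⟩ := hV.exists_forall_lt (ι := PUnit.{u + 1})
      (by simpa using one_lt_aleph0.trans_le hV.aleph0_le) (fun _ => x)
    exact ⟨b, hb ⟨⟩⟩
  have hfg : ∀ ξ, ∀ᶠ i in atTop, f ξ i < g i := by
    intro ξ
    obtain ⟨η, hη⟩ := hgt ξ
    filter_upwards [hf _ _ hη, hg.1 η] with i h1 h2
    exact h1.trans_le h2
  by_contra hcon
  have hcon' : ∃ᶠ i in atTop, (g i).cof < θ := by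
    simpa only [Filter.not_eventually, not_le] using hcon
  choose K hK hKc using fun i => Order.exists_cof_eq (Set.Iio (g i))
  let S : I → Set Ordinal.{u} := fun i =>
    insert (l i) (if (g i).cof < θ then Subtype.val '' K i else ∅)
  obtain ⟨ξ, hξ⟩ := hB θ hθ hIθ hθκ S (fun i => by
      refine (mk_insert_le).trans_lt (add_lt_of_lt (aleph0_le_lift.2 hθ.aleph0_le) ?_
        (one_lt_aleph0.trans_le (aleph0_le_lift.2 hθ.aleph0_le)))
      split_ifs with h
      · refine mk_image_le.trans_lt ?_
        rw [hKc, Ordinal.cof_Iio, ← Ordinal.lift_cof]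
        exact lift_lt.2 h
      · rw [mk_eq_zero]
        exact aleph0_pos.trans_le (aleph0_le_lift.2 hθ.aleph0_le))
    (fun i η => ⟨l i, Set.mem_insert _ _, (hl η i).le⟩)
  let k : I → Ordinal.{u} := fun i => ordinalCeil (S i) (f ξ i)
  have hk : ∀ i, (g i).cof < θ → f ξ i < g i → k i < g i := by
    intro i hi hlt
    obtain ⟨y, hy, hxy⟩ := hK i ⟨f ξ i, hlt⟩
    refine lt_of_le_of_lt (ordinalCeil_le (s := y.1) (Set.mem_insert_of_mem _ ?_) hxy) y.2
    rw [if_pos hi]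
    exact ⟨y, hy, rfl⟩
  obtain ⟨ζ, hζ⟩ := hg.2 (fun i => if k i < g i then k i else f ξ i) (by
    filter_upwards [hfg ξ] with i hi
    split_ifs with h
    · exact h
    · exact hi)
  obtain ⟨i, h1, h2, h3, h4⟩ := (hcon'.and_eventually (hζ.and ((hξ ζ).and (hfg ξ)))).exists
  rw [if_pos (hk i h1 h4)] at h2
  exact h2.not_ge h3

/-! ### Scales below a singular cardinal -/

theorem Cardinal.succ_lt_of_cof_ord_lt {κ : Cardinal.{u}} (hκ : ℵ₀ ≤ κ) (hsing : κ.ord.cof < κ)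
    {θ : Cardinal.{u}} (h : θ < κ) : succ θ < κ := by
  refine (succ_le_of_lt h).lt_of_ne fun heq => ?_
  rcases lt_or_ge θ ℵ₀ with hθ | hθ
  · exact (isSuccLimit_aleph0.succ_lt hθ).not_ge (heq ▸ hκ)
  · have := (isRegular_succ hθ).cof_ord
    rw [heq] at this
    exact hsing.ne this

theorem exists_cofinal_cardinals {κ : Cardinal.{u}} (hκ : ℵ₀ ≤ κ) (hsing : κ.ord.cof < κ) :
    ∃ c : κ.ord.cof.ord.ToType → Cardinal.{u}, (∀ i, ℵ₀ ≤ c i) ∧ (∀ i, c i < κ) ∧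
      ∀ θ < κ, ∀ᶠ i in atTop, θ < c i := by
  have hreg : κ.ord.cof.IsRegular := isRegular_cof (isSuccLimit_ord hκ)
  have : NoMaxOrder κ.ord.cof.ord.ToType := noMaxOrder hreg.aleph0_le
  have : Nonempty κ.ord.cof.ord.ToType := hreg.nonempty_toType
  obtain ⟨A, hA, hAc⟩ := Order.exists_cof_eq κ.ord.ToType
  rw [Ordinal.cof_toType] at hAc
  obtain ⟨φ⟩ := Cardinal.eq.1 ((mk_ord_toType κ.ord.cof).trans hAc.symm)
  let r : κ.ord.ToType → Cardinal.{u} := fun x => (Ordinal.ToType.mk.symm x).1.card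
  have hrlt : ∀ x, r x < κ := fun x => lt_ord.1 (Ordinal.ToType.mk.symm x).2
  have hr : Monotone r := fun x y h => Ordinal.card_le_card (Ordinal.ToType.mk.symm.monotone h)
  refine ⟨fun i => max ℵ₀ (⨆ i' : Set.Iic i, r (φ i').1), fun i => le_max_left _ _,
    fun i => max_lt ?_ ?_, fun θ hθ => ?_⟩
  · exact hreg.aleph0_le.trans_lt hsing
  · apply Cardinal.iSup_lt_of_lt_cof_ord
    · obtain ⟨j, hj⟩ := exists_gt i
      exact (mk_le_mk_of_subset fun x hx => lt_of_le_of_lt hx hj).trans_lt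
        (mk_Iio_ord_toType_lt j)
    · exact fun _ => hrlt _
  · have hθ' := succ_lt_of_cof_ord_lt hκ hsing hθ
    obtain ⟨y, hy, hxy⟩ := hA (Ordinal.ToType.mk ⟨(succ θ).ord, ord_lt_ord.2 hθ'⟩)
    obtain ⟨i₀, hi₀⟩ := φ.surjective ⟨y, hy⟩
    filter_upwards [Filter.eventually_ge_atTop i₀] with i hi
    refine (lt_succ θ).trans_le ?_
    have h1 : succ θ ≤ r y := by
      refine le_trans ?_ (hr hxy)
      simp [r]
    refine h1.trans (le_max_of_le_right ?_)
    have h2 := le_ciSup (bddAbove_of_small (s := Set.range fun i' : Set.Iic i => r (φ i').1))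
      ⟨i₀, hi⟩
    simpa [hi₀] using h2

/-- `F` is cofinal, modulo bounded sets, in the product of the ordinals `G i`. -/
structure IsScale {V I : Type u} [LinearOrder V] [LinearOrder I] (F : V → I → Ordinal.{u})
    (G : I → Ordinal.{u}) : Prop where
  lt : ∀ α i, F α i < G i
  sum_cof_lt : ∀ j, Cardinal.sum (fun i : Set.Iio j => (G i.1).cof) < (G j).cof
  cofinal : ∀ χ : I → Ordinal.{u}, (∀ i, χ i < G i) → ∃ ξ, ∀ η ≥ ξ, ∀ᶠ i in atTop, χ i < F η i

theorem exists_isExactUpperBound_of_singular {κ : Cardinal.{u}} (hκ : ℵ₀ ≤ κ)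
    (hsing : κ.ord.cof < κ) :
    ∃ (f : (succ κ).ord.ToType → κ.ord.cof.ord.ToType → Ordinal.{u})
      (g : κ.ord.cof.ord.ToType → Ordinal.{u}),
      (∀ x δ, x < δ → ∀ᶠ i in atTop, f x i < f δ i) ∧ (∀ i, (g i).cof < κ) ∧
      IsExactUpperBound f g ∧ ∀ θ < κ, ∀ᶠ i in atTop, θ < (g i).cof := by
  have hreg : κ.ord.cof.IsRegular := isRegular_cof (isSuccLimit_ord hκ)
  have : NoMaxOrder κ.ord.cof.ord.ToType := noMaxOrder hreg.aleph0_le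
  have : Nonempty κ.ord.cof.ord.ToType := hreg.nonempty_toType
  have : Nonempty (succ κ).ord.ToType := (isRegular_succ hκ).nonempty_toType
  have hsucc : ∀ {θ}, θ < κ → succ θ < κ := succ_lt_of_cof_ord_lt hκ hsing
  have hI : #κ.ord.cof.ord.ToType < κ := by rwa [mk_ord_toType]
  obtain ⟨c, hcω, hcκ, hc⟩ := exists_cofinal_cardinals hκ hsing
  choose A hA hAcof hAc using exists_small_cofinal hsing
  obtain ⟨f, hfc, hf, hfE⟩ := exists_eventually_increasing hcω hc
    (fun δ => (fun a => strictSup (A δ ∩ Set.Iio a)) '' A δ)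
    (fun δ => mk_image_le.trans_lt (hAc δ))
  have hB : HasCeilBounds κ f := by
    intro θ hθ hIθ hθκ S hS hS'
    refine exists_ordinalCeil_bound hκ hθ hθκ hIθ hf hA hAcof (fun δ => ?_) S hS hS'
    filter_upwards [hfE δ] with i hi a ha b hb hb'
    have hbd : ∃ b, ∀ x ∈ A δ ∩ Set.Iio a, x < b := ⟨a, fun x hx => hx.2⟩
    have hbe : strictSup (A δ ∩ Set.Iio a) = b := by
      refine le_antisymm (strictSup_le fun x hx => hb x hx.1 hx.2) (not_lt.1 fun h => ?_)
      obtain ⟨x, hx, hxa, hbx⟩ := hb' _ h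
      exact hbx.not_gt (lt_strictSup hbd ⟨hx, hxa⟩)
    refine hi b ⟨a, ha, hbe⟩ ?_
    rw [← hbe]
    exact (strictSup_le fun x hx => hx.2).trans_lt (hA δ ha)
  obtain ⟨g, hgl, hg⟩ := exists_isExactUpperBound hκ (by rw [mk_ord_toType]; exact hreg.aleph0_le)
    (hsucc (hsucc (hsucc hI))).le hf hB hfc
  refine ⟨f, g, hf, fun i => ?_, hg, fun θ hθ => ?_⟩
  · refine (Ordinal.cof_le_card _).trans_lt (lt_of_le_of_lt ?_ (hsucc (hcκ i)))
    simpa using Ordinal.card_le_card (hgl i)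
  · have hm := max_lt hI hθ
    have := hg.eventually_le_cof hκ hf hB hfc
      (isRegular_succ ((by rw [mk_ord_toType]; exact hreg.aleph0_le :
        ℵ₀ ≤ #κ.ord.cof.ord.ToType).trans (le_max_left _ θ)))
      ((le_max_left _ _).trans_lt (lt_succ _)) (hsucc (hsucc (hsucc hm))).le
    filter_upwards [this] with i hi
    exact (le_max_right _ _).trans_lt ((lt_succ _).trans_le hi)

theorem exists_isScale {κ : Cardinal.{u}} (hκ : ℵ₀ ≤ κ) (hsing : κ.ord.cof < κ) :
    ∃ (F : (succ κ).ord.ToType → κ.ord.cof.ord.ToType → Ordinal.{u})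
      (G : κ.ord.cof.ord.ToType → Ordinal.{u}), IsScale F G ∧ ∀ i, (G i).cof < κ := by
  classical
  have hreg : κ.ord.cof.IsRegular := isRegular_cof (isSuccLimit_ord hκ)
  have : NoMaxOrder κ.ord.cof.ord.ToType := noMaxOrder hreg.aleph0_le
  have : Nonempty κ.ord.cof.ord.ToType := hreg.nonempty_toType
  obtain ⟨f, g, hf, hgκ, hg, hgcof⟩ := exists_isExactUpperBound_of_singular hκ hsing
  have hsum : ∀ (j : κ.ord.cof.ord.ToType)
      (e : κ.ord.cof.ord.ToType → κ.ord.cof.ord.ToType),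
      Cardinal.sum (fun i : Set.Iio j => (g (e i)).cof) < κ := by
    intro j e
    refine (sum_le_mk_mul_iSup _).trans_lt (mul_lt_of_lt hκ
      ((mk_Iio_ord_toType_lt j).trans hsing) ?_)
    exact Cardinal.iSup_lt_of_lt_cof_ord (mk_Iio_ord_toType_lt j) fun _ => hgκ _
  have step : ∀ (j : κ.ord.cof.ord.ToType)
      (e : κ.ord.cof.ord.ToType → κ.ord.cof.ord.ToType), ∃ k, j ≤ k ∧
      Cardinal.sum (fun i : Set.Iio j => (g (e i)).cof) < (g k).cof := fun j e =>
    ((Filter.eventually_ge_atTop j).and (hgcof _ (hsum j e))).exists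
  choose Φ hΦ₁ hΦ₂ using step
  obtain ⟨e, he⟩ := @exists_wellFounded_rec _ _ _ _ ⟨Classical.arbitrary _⟩ Φ
  have he₁ : ∀ j, j ≤ e j := fun j => by rw [he j]; exact hΦ₁ _ _
  have he₂ : ∀ j, Cardinal.sum (fun i : Set.Iio j => (g (e i)).cof) < (g (e j)).cof := by
    intro j
    rw [he j]
    refine lt_of_eq_of_lt ?_ (hΦ₂ j _)
    congr 1
    funext i
    rw [if_pos (show i.1 < j from i.2)]
  have heinj : Function.Injective e := by
    have : StrictMono fun j => (g (e j)).cof := fun i j hij =>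
      (le_sum (fun i : Set.Iio j => (g (e i)).cof) ⟨i, hij⟩).trans_lt (he₂ j)
    exact fun i j h => this.injective (by simp only [h])
  have hetend : Filter.Tendsto e atTop atTop := Filter.tendsto_atTop_mono he₁ Filter.tendsto_id
  have hpos : ∀ j, 0 < g (e j) := fun j => by
    rw [pos_iff_ne_zero]
    intro h0
    have := he₂ j
    rw [h0, Ordinal.cof_zero] at this
    exact not_lt_bot this
  refine ⟨fun η j => if f η (e j) < g (e j) then f η (e j) else 0, fun j => g (e j),
    ⟨fun α i => ?_, he₂, fun χ hχ => ?_⟩, fun i => hgκ _⟩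
  · split_ifs with h
    · exact h
    · exact hpos i
  · obtain ⟨ξ, hξ⟩ := hg.2 (Function.extend e χ 0) (by
      have h0 : ∀ᶠ i in atTop, (0 : Cardinal) < (g i).cof :=
        hgcof 0 (aleph0_pos.trans_le hκ)
      filter_upwards [h0] with k hk
      by_cases h : ∃ j, e j = k
      · obtain ⟨j, rfl⟩ := h
        rw [heinj.extend_apply]
        exact hχ j
      · rw [Function.extend_apply' _ _ _ h]
        rw [Pi.zero_apply, pos_iff_ne_zero]
        intro hk0
        rw [hk0, Ordinal.cof_zero] at hk
        exact lt_irrefl _ hk)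
    refine ⟨ξ, fun η hη => ?_⟩
    have h1 : ∀ᶠ i in atTop, Function.extend e χ 0 i < f η i := by
      rcases hη.eq_or_lt with rfl | hη
      · exact hξ
      · filter_upwards [hξ, hf _ _ hη] with i h1 h2
        exact h1.trans h2
    obtain ⟨η', hη'⟩ : ∃ η', η < η' := by
      obtain ⟨b, hb⟩ := (isRegular_succ hκ).exists_forall_lt (ι := PUnit.{u + 1})
        (by simpa using one_lt_aleph0.trans_le (isRegular_succ hκ).aleph0_le) (fun _ => η)
      exact ⟨b, hb ⟨⟩⟩
    filter_upwards [hetend.eventually h1, hetend.eventually (hf _ _ hη'),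
      hetend.eventually (hg.1 η')] with i h1 h2 h3
    rw [if_pos (h2.trans_le h3)]
    rwa [heinj.extend_apply] at h1

/-! ### The colouring attached to a scale -/

/-- `i` is the last index at which `F α` is not below `F β`. -/
def IsLastReversal {V I : Type u} [LinearOrder I] (F : V → I → Ordinal.{u}) (i : I) (α β : V) :
    Prop :=
  F β i < F α i ∧ ∀ j > i, F α j < F β j

theorem IsLastReversal.index_unique {V I : Type u} [LinearOrder I] {F : V → I → Ordinal.{u}}
    {i j : I} {α β : V} (hi : IsLastReversal F i α β) (hj : IsLastReversal F j α β) : i = j := by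
  rcases lt_trichotomy i j with h | h | h
  · exact absurd hj.1 (hi.2 j h).not_gt
  · exact h
  · exact absurd hi.1 (hj.2 i h).not_gt

theorem exists_forall_mem_gt_of_disjoint {κ : Cardinal.{u}} (hκ : ℵ₀ ≤ κ)
    {a : (succ κ).ord.ToType → Finset (succ κ).ord.ToType}
    (hd : ∀ ζ ζ', ζ ≠ ζ' → Disjoint (a ζ) (a ζ')) (b : (succ κ).ord.ToType) :
    ∃ ζ, ∀ α ∈ a ζ, b < α := by
  by_contra! hcon
  choose y hy hyb using hcon
  have hV := isRegular_succ hκ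
  have : NoMaxOrder (succ κ).ord.ToType := noMaxOrder hV.aleph0_le
  obtain ⟨b', hb'⟩ := exists_gt b
  have hinj : Function.Injective fun ζ => (⟨y ζ, (hyb ζ).trans_lt hb'⟩ : Set.Iio b') := by
    intro ζ ζ' h
    by_contra hne
    have h : y ζ = y ζ' := Subtype.mk.inj h
    exact Finset.disjoint_left.1 (hd ζ ζ' hne) (hy ζ) (h ▸ hy ζ')
  have := mk_le_of_injective hinj
  rw [mk_ord_toType] at this
  exact this.not_gt (mk_Iio_ord_toType_lt b')

theorem IsScale.exists_isLastReversal {κ : Cardinal.{u}} (hκ : ℵ₀ ≤ κ) {I : Type u}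
    [LinearOrder I] [Nonempty I] (hI : #I ≤ κ)
    {F : (succ κ).ord.ToType → I → Ordinal.{u}} {G : I → Ordinal.{u}} (hFG : IsScale F G)
    (hG : ∀ i, (G i).cof < κ) {a : (succ κ).ord.ToType → Finset (succ κ).ord.ToType}
    (hne : ∀ ζ, (a ζ).Nonempty) (hd : ∀ ζ ζ', ζ ≠ ζ' → Disjoint (a ζ) (a ζ')) :
    ∃ i₀, ∀ i ≥ i₀, ∃ ζ ζ', ζ ≠ ζ' ∧
      ∀ α ∈ a ζ, ∀ β ∈ a ζ', α < β ∧ IsLastReversal F i α β := by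
  classical
  have hV := isRegular_succ hκ
  have : Nonempty (succ κ).ord.ToType := hV.nonempty_toType
  have hpos : ∀ i, 0 < G i := fun i =>
    lt_of_le_of_lt (bot_le) (hFG.lt (Classical.arbitrary _) i)
  -- at almost all indices the family is unbounded
  have hgood : ∀ᶠ i in atTop, ∀ ν < G i, ∃ ζ, ∀ α ∈ a ζ, ν < F α i := by
    by_contra hcon
    have hcon' : ∃ᶠ i in atTop, ∃ ν < G i, ∀ ζ, ∃ α ∈ a ζ, F α i ≤ ν := by
      simpa only [Filter.not_eventually, not_forall, not_exists, not_lt, exists_prop] using hcon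
    let χ : I → Ordinal.{u} := fun i =>
      if h : ∃ ν < G i, ∀ ζ, ∃ α ∈ a ζ, F α i ≤ ν then h.choose else 0
    obtain ⟨ξ, hξ⟩ := hFG.cofinal χ fun i => by
      simp only [χ]
      split_ifs with h
      · exact h.choose_spec.1
      · exact hpos i
    obtain ⟨ζ, hζ⟩ := exists_forall_mem_gt_of_disjoint hκ hd ξ
    have hall : ∀ᶠ i in atTop, ∀ α ∈ a ζ, χ i < F α i :=
      (Filter.eventually_all_finset _).2 fun α hα => hξ α (hζ α hα).le
    obtain ⟨i, hi, hi'⟩ := (hcon'.and_eventually hall).exists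
    obtain ⟨α, hα, hle⟩ := hi.choose_spec.2 ζ
    have := hi' α hα
    simp only [χ, dif_pos hi] at this
    exact this.not_ge hle
  obtain ⟨i₁, hi₁⟩ := Filter.eventually_atTop.1 hgood
  choose K hK hKc using fun i => Order.exists_cof_eq (G i).ToType
  simp only [Ordinal.cof_toType] at hKc
  have hZ : ∀ (i : I) (k : (G i).ToType), ∃ ζ, i₁ ≤ i →
      ∀ α ∈ a ζ, (Ordinal.ToType.mk.symm k).1 < F α i := by
    intro i k
    by_cases h : i₁ ≤ i
    · obtain ⟨ζ, hζ⟩ := hi₁ i h (Ordinal.ToType.mk.symm k).1 (Ordinal.ToType.mk.symm k).2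
      exact ⟨ζ, fun _ => hζ⟩
    · exact ⟨Classical.arbitrary _, fun h' => absurd h' h⟩
  choose Z hZ using hZ
  let χ : I → Ordinal.{u} := fun j =>
    ⨆ p : Σ i : Set.Iio j, K i, (a (Z p.1 p.2)).sup (F · j)
  obtain ⟨ξ, hξ⟩ := hFG.cofinal χ fun j => by
    apply Ordinal.iSup_lt_of_lt_cof
    · rw [mk_sigma]
      simpa only [hKc] using hFG.sum_cof_lt j
    · intro p
      exact (Finset.sup_lt_iff (hpos j)).2 fun α _ => hFG.lt α j
  obtain ⟨b, hb⟩ := hV.exists_forall_lt (ι := Σ i : I, Σ k : K i, a (Z i k)) (by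
    refine lt_succ_iff.2 ?_
    rw [mk_sigma]
    refine (sum_le_mk_mul_iSup _).trans (mul_le_of_le hκ hI (ciSup_le' fun i => ?_))
    rw [mk_sigma]
    refine (sum_le_mk_mul_iSup _).trans (mul_le_of_le hκ ?_ (ciSup_le' fun k => ?_))
    · rw [hKc]
      exact (hG i).le
    · exact (lt_aleph0_of_finite _).le.trans hκ) fun p => p.2.2.1
  obtain ⟨ζ', hζ'⟩ := exists_forall_mem_gt_of_disjoint hκ hd (max ξ b)
  have hall : ∀ᶠ i in atTop, ∀ β ∈ a ζ', χ i < F β i :=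
    (Filter.eventually_all_finset _).2 fun β hβ => hξ β ((le_max_left _ _).trans (hζ' β hβ).le)
  obtain ⟨i₂, hi₂⟩ := Filter.eventually_atTop.1 hall
  refine ⟨max i₁ i₂, fun i hi => ?_⟩
  have hν : (a ζ').sup (F · i) < G i := (Finset.sup_lt_iff (hpos i)).2 fun α _ => hFG.lt α i
  obtain ⟨k, hk, hνk⟩ := hK i (Ordinal.ToType.mk ⟨_, hν⟩)
  have hlt : ∀ α ∈ a (Z i k), ∀ β ∈ a ζ', α < β := fun α hα β hβ =>
    (hb ⟨i, ⟨k, hk⟩, ⟨α, hα⟩⟩).trans ((le_max_right _ _).trans_lt (hζ' β hβ))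
  refine ⟨Z i k, ζ', fun h => ?_, fun α hα β hβ => ⟨hlt α hα β hβ, ?_, fun j hj => ?_⟩⟩
  · obtain ⟨α, hα⟩ := hne ζ'
    exact lt_irrefl α (hlt α (h ▸ hα) α hα)
  · refine lt_of_le_of_lt ?_ (hZ i k ((le_max_left _ _).trans hi) α hα)
    refine (Finset.le_sup (f := (F · i)) hβ).trans ?_
    have := Ordinal.ToType.mk.symm.monotone hνk
    rw [OrderIso.symm_apply_apply] at this
    exact this
  · refine lt_of_le_of_lt ?_ (hi₂ j ((le_max_right _ _).trans (hi.trans hj.le)) β hβ)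
    refine (Finset.le_sup (f := (F · j)) hα).trans ?_
    exact Ordinal.le_iSup (fun p : Σ i : Set.Iio j, K i => (a (Z p.1 p.2)).sup (F · j))
      ⟨⟨i, hj⟩, ⟨k, hk⟩⟩

/-! ### The Δ-system lemma for finite sets -/

section DeltaSystem

variable {c : Cardinal.{u}}

theorem exists_injective_comp_eq (hc : c.IsRegular) {B : Type u} (hB : #B < c)
    (f : c.ord.ToType → B) :
    ∃ (b : B) (e : c.ord.ToType → c.ord.ToType), Function.Injective e ∧ ∀ ζ, f (e ζ) = b := by
  obtain ⟨b, hb⟩ := infinite_pigeonhole_card f c (by simp) hc.aleph0_le (by rwa [hc.cof_ord])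
  have hb' : #c.ord.ToType ≤ #(f ⁻¹' {b}) := by simpa using hb
  obtain ⟨e⟩ := hb'
  exact ⟨b, fun ζ => (e ζ).1, fun x y h => e.injective (Subtype.ext h), fun ζ => (e ζ).2⟩

theorem exists_pairwise_disjoint_comp (hc : c.IsRegular) (hω : ℵ₀ < c) {A : Type u}
    [DecidableEq A] (d : c.ord.ToType → Finset A) (hd : ∀ α, #{ζ | α ∈ d ζ} < c) :
    ∃ e : c.ord.ToType → c.ord.ToType, Function.Injective e ∧
      ∀ ζ ζ', ζ ≠ ζ' → d (e ζ) ∩ d (e ζ') = ∅ := by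
  have : Nonempty c.ord.ToType := hc.nonempty_toType
  have step : ∀ (t : c.ord.ToType) (e : c.ord.ToType → c.ord.ToType), ∃ v,
      (∀ s < t, e s < v) ∧ ∀ s < t, d (e s) ∩ d v = ∅ := by
    intro t e
    have h1 : #(⋃ s : Set.Iio t, Set.Iic (e s)) < c := by
      rw [card_iUnion_lt_iff_forall_of_isRegular hc (mk_Iio_ord_toType_lt t)]
      intro s
      have : NoMaxOrder c.ord.ToType := noMaxOrder hc.aleph0_le
      obtain ⟨b, hb⟩ := exists_gt (e s)
      exact (mk_le_mk_of_subset fun x hx => lt_of_le_of_lt hx hb).trans_lt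
        (mk_Iio_ord_toType_lt b)
    have h2 : #(⋃ s : Set.Iio t, ⋃ α : d (e s), {ζ | α.1 ∈ d ζ}) < c := by
      rw [card_iUnion_lt_iff_forall_of_isRegular hc (mk_Iio_ord_toType_lt t)]
      intro s
      rw [card_iUnion_lt_iff_forall_of_isRegular hc ((lt_aleph0_of_finite _).trans hω)]
      exact fun α => hd _
    have h3 := (mk_union_le _ _).trans_lt (add_lt_of_lt hc.aleph0_le h1 h2)
    obtain ⟨v, hv⟩ : ∃ v, v ∉ (⋃ s : Set.Iio t, Set.Iic (e s)) ∪
        ⋃ s : Set.Iio t, ⋃ α : d (e s), {ζ | α.1 ∈ d ζ} := by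
      by_contra! hcon
      rw [Set.eq_univ_of_forall hcon, mk_univ, mk_ord_toType] at h3
      exact lt_irrefl _ h3
    simp only [Set.mem_union, Set.mem_iUnion, not_or, not_exists] at hv
    refine ⟨v, fun s hs => not_le.1 (hv.1 ⟨s, hs⟩), fun s hs => ?_⟩
    rw [← Finset.disjoint_iff_inter_eq_empty, Finset.disjoint_left]
    exact fun α hα => hv.2 ⟨s, hs⟩ ⟨α, hα⟩
  choose Φ hΦ₁ hΦ₂ using step
  obtain ⟨e, he⟩ := @exists_wellFounded_rec _ _ _ _ ⟨Classical.arbitrary _⟩ Φ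
  have he₁ : StrictMono e := by
    intro s t hst
    have := hΦ₁ t (fun r => if r < t then e r else Classical.arbitrary _) s hst
    rw [if_pos hst] at this
    exact this.trans_eq (he t).symm
  have he₂ : ∀ s t, s < t → d (e s) ∩ d (e t) = ∅ := by
    intro s t hst
    have := hΦ₂ t (fun r => if r < t then e r else Classical.arbitrary _) s hst
    rw [if_pos hst] at this
    have h' := he t
    change e t = Φ t (fun r => if r < t then e r else Classical.arbitrary _) at h'
    rwa [h']
  refine ⟨e, he₁.injective, fun ζ ζ' h => ?_⟩
  rcases lt_or_gt_of_ne h with h | h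
  · exact he₂ _ _ h
  · rw [Finset.inter_comm]
    exact he₂ _ _ h

theorem exists_deltaSystem_of_card (hc : c.IsRegular) (hω : ℵ₀ < c) {A : Type u}
    [DecidableEq A] (n : ℕ) : ∀ d : c.ord.ToType → Finset A, (∀ ζ, (d ζ).card = n) →
    ∃ (r : Finset A) (e : c.ord.ToType → c.ord.ToType), Function.Injective e ∧
      ∀ ζ ζ', ζ ≠ ζ' → d (e ζ) ∩ d (e ζ') = r := by
  induction n with
  | zero =>
    intro d hd
    refine ⟨∅, id, Function.injective_id, fun ζ ζ' _ => ?_⟩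
    simp [Finset.card_eq_zero.1 (hd ζ)]
  | succ n ih =>
    intro d hd
    by_cases h : ∀ α, #{ζ | α ∈ d ζ} < c
    · obtain ⟨e, he, he'⟩ := exists_pairwise_disjoint_comp hc hω d h
      exact ⟨∅, e, he, he'⟩
    · push Not at h
      obtain ⟨α, hα⟩ := h
      have hα' : #c.ord.ToType ≤ #{ζ | α ∈ d ζ} := by simpa using hα
      obtain ⟨e⟩ := hα'
      obtain ⟨r, e', he', hr⟩ := ih (fun ζ => (d (e ζ).1).erase α) fun ζ => by
        rw [Finset.card_erase_of_mem (e ζ).2, hd]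
        rfl
      refine ⟨insert α r, fun ζ => (e (e' ζ)).1,
        fun x y h => he' (e.injective (Subtype.ext h)), fun ζ ζ' h => ?_⟩
      rw [← hr ζ ζ' h]
      have h1 : α ∈ d (e (e' ζ)).1 := (e (e' ζ)).2
      have h2 : α ∈ d (e (e' ζ')).1 := (e (e' ζ')).2
      ext x
      by_cases hx : x = α
      · subst hx
        simp [h1, h2]
      · simp [hx]

theorem exists_deltaSystem (hc : c.IsRegular) (hω : ℵ₀ < c) {A : Type u}
    [DecidableEq A] (d : c.ord.ToType → Finset A) :
    ∃ (r : Finset A) (e : c.ord.ToType → c.ord.ToType), Function.Injective e ∧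
      ∀ ζ ζ', ζ ≠ ζ' → d (e ζ) ∩ d (e ζ') = r := by
  obtain ⟨n, e, he, hn⟩ := exists_injective_comp_eq hc (B := ULift.{u} ℕ) (by simpa using hω)
    fun ζ => ⟨(d ζ).card⟩
  obtain ⟨r, e', he', hr⟩ := exists_deltaSystem_of_card hc hω n.down (fun ζ => d (e ζ))
    fun ζ => congrArg ULift.down (hn ζ)
  exact ⟨r, fun ζ => e (e' ζ), he.comp he', hr⟩

end DeltaSystem

/-! ### Clique spaces and cellularity -/

/-- The set of (indicators of) cliques of a graph on `V`; `E α β` is consulted for `α < β`. -/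
def cliques {V : Type u} [LinearOrder V] (E : V → V → Prop) : Set (V → Bool) :=
  {x | ∀ α β, α < β → x α = true → x β = true → E α β}

section cliques

variable {V : Type u} [LinearOrder V] {E : V → V → Prop}

theorem isClosed_cliques : IsClosed (cliques E) := by
  have : cliques E = ⋂ (α) (β) (_ : α < β), {x | x α = true → x β = true → E α β} := by
    ext x
    simp [cliques]
  rw [this]
  refine isClosed_iInter fun α => isClosed_iInter fun β => isClosed_iInter fun _ => ?_
  exact (isClosed_discrete {p : Bool × Bool | p.1 = true → p.2 = true → E α β}).preimage
    (f := fun x : V → Bool => (x α, x β)) (by fun_prop)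

instance : CompactSpace (cliques E) := isCompact_iff_compactSpace.1 isClosed_cliques.isCompact

theorem exists_finset_forall_mem_of_isOpen {U : Set (cliques E)} (hU : IsOpen U)
    {x : cliques E} (hx : x ∈ U) :
    ∃ d : Finset V, ∀ y : cliques E, (∀ α ∈ d, y.1 α = x.1 α) → y ∈ U := by
  obtain ⟨O, hO, rfl⟩ := isOpen_induced_iff.1 hU
  obtain ⟨d, u, hu, hsub⟩ := isOpen_pi_iff.1 hO x.1 hx
  refine ⟨d, fun y hy => hsub fun α hα => ?_⟩
  rw [hy α hα]
  exact (hu α hα).2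

theorem indicator_mem_cliques (s : Finset V) (hs : ∀ α ∈ s, ∀ β ∈ s, α < β → E α β) :
    (fun α => decide (α ∈ s)) ∈ cliques E := by
  intro α β hαβ hα hβ
  exact hs α (by simpa using hα) β (by simpa using hβ) hαβ

end cliques

/-- Among any `c` nonempty open sets, two distinct ones meet. -/
def HasChainCondition (c : Cardinal.{u}) (X : Type u) [TopologicalSpace X] : Prop :=
  ∀ U : c.ord.ToType → Set X, (∀ ζ, IsOpen (U ζ) ∧ (U ζ).Nonempty) →
    ∃ ζ ζ', ζ ≠ ζ' ∧ (U ζ ∩ U ζ').Nonempty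

theorem hasChainCondition_cliques {c : Cardinal.{u}} (hc : c.IsRegular) (hω : ℵ₀ < c)
    {V : Type u} [LinearOrder V] {E : V → V → Prop}
    (hE : ∀ a : c.ord.ToType → Finset V, (∀ ζ, (a ζ).Nonempty) →
      (∀ ζ ζ', ζ ≠ ζ' → Disjoint (a ζ) (a ζ')) →
      ∃ ζ ζ', ζ ≠ ζ' ∧ ∀ α ∈ a ζ, ∀ β ∈ a ζ', α < β ∧ E α β) :
    HasChainCondition c (cliques E) := by
  intro U hU
  choose x hx using fun ζ => (hU ζ).2
  choose d₀ hd₀ using fun ζ => exists_finset_forall_mem_of_isOpen (hU ζ).1 (hx ζ)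
  obtain ⟨r, e₀, he₀, hr₀⟩ := exists_deltaSystem hc hω d₀
  obtain ⟨q, e₁, he₁, hq⟩ := exists_injective_comp_eq hc (B := r.powerset)
    ((lt_aleph0_of_finite _).trans hω)
    fun ζ => ⟨r.filter fun α => (x (e₀ ζ)).1 α = true, by simp⟩
  let e := fun ζ => e₀ (e₁ ζ)
  have he : Function.Injective e := he₀.comp he₁
  let d := fun ζ => d₀ (e ζ)
  let p := fun ζ => (d ζ).filter fun α => (x (e ζ)).1 α = true
  have hpE : ∀ ζ, ∀ α ∈ p ζ, ∀ β ∈ p ζ, α < β → E α β := fun ζ α hα β hβ h =>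
    (x (e ζ)).2 α β h (Finset.mem_filter.1 hα).2 (Finset.mem_filter.1 hβ).2
  have hr : ∀ ζ ζ', ζ ≠ ζ' → d ζ ∩ d ζ' = r := fun ζ ζ' h => hr₀ _ _ fun h' => h (he₁ h')
  have hagree : ∀ ζ ζ', ∀ α ∈ r, (x (e ζ)).1 α = (x (e ζ')).1 α := by
    intro ζ ζ' α hα
    have h := congrArg Subtype.val ((hq ζ).trans (hq ζ').symm)
    have hmem := Finset.ext_iff.1 h α
    simp only [Finset.mem_filter, hα, true_and] at hmem
    exact Bool.eq_iff_iff.2 hmem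
  -- it suffices to find two indices whose positive parts form a clique together
  have hmeet : ∀ ζ ζ', ζ ≠ ζ' → (∀ α ∈ p ζ ∪ p ζ', ∀ β ∈ p ζ ∪ p ζ', α < β → E α β) →
      ∃ ζ ζ', ζ ≠ ζ' ∧ (U ζ ∩ U ζ').Nonempty := by
    intro ζ ζ' hne hcl
    have key : ∀ ζ ζ', ζ ≠ ζ' → ∀ α ∈ d ζ, decide (α ∈ p ζ ∪ p ζ') = (x (e ζ)).1 α := by
      intro ζ ζ' hne α hα
      rw [Bool.eq_iff_iff, decide_eq_true_iff]
      simp only [p, Finset.mem_union, Finset.mem_filter, hα, true_and]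
      refine or_iff_left_of_imp fun h => ?_
      rw [hagree ζ ζ' α (hr ζ ζ' hne ▸ Finset.mem_inter.2 ⟨hα, h.1⟩)]
      exact h.2
    refine ⟨e ζ, e ζ', fun h => hne (he h), ⟨_, indicator_mem_cliques _ hcl⟩, ?_, ?_⟩
    · exact hd₀ _ _ (key ζ ζ' hne)
    · refine hd₀ _ _ fun α hα => ?_
      dsimp only
      rw [← key ζ' ζ hne.symm α hα, Finset.union_comm]
  have hpr : ∀ ζ ζ', ζ ≠ ζ' → ∀ α ∈ p ζ, α ∈ r → α ∈ p ζ' := by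
    intro ζ ζ' hne α hα hαr
    refine Finset.mem_filter.2 ⟨?_, ?_⟩
    · rw [← hr ζ ζ' hne] at hαr
      exact (Finset.mem_inter.1 hαr).2
    · rw [hagree ζ' ζ α hαr]
      exact (Finset.mem_filter.1 hα).2
  by_cases hemp : ∃ ζ, p ζ ⊆ r
  · obtain ⟨ζ, hζ⟩ := hemp
    have : NoMaxOrder c.ord.ToType := noMaxOrder hc.aleph0_le
    obtain ⟨ζ', hζ'⟩ := exists_gt ζ
    have hsub : p ζ ⊆ p ζ' := fun α hα => hpr ζ ζ' hζ'.ne α hα (hζ hα)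
    refine hmeet ζ ζ' hζ'.ne ?_
    rw [Finset.union_eq_right.2 hsub]
    exact hpE ζ'
  · push Not at hemp
    obtain ⟨ζ, ζ', hne, h⟩ := hE (fun ζ => p ζ \ r)
      (fun ζ => by rw [Finset.sdiff_nonempty]; exact hemp ζ)
      (fun ζ ζ' hne => by
        rw [Finset.disjoint_left]
        intro α hα hα'
        rw [Finset.mem_sdiff] at hα hα'
        refine hα.2 ?_
        rw [← hr ζ ζ' hne]
        exact Finset.mem_inter.2 ⟨(Finset.mem_filter.1 hα.1).1, (Finset.mem_filter.1 hα'.1).1⟩)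
    refine hmeet ζ ζ' hne fun α hα β hβ hαβ => ?_
    by_cases h1 : α ∈ p ζ ∧ β ∈ p ζ
    · exact hpE ζ α h1.1 β h1.2 hαβ
    by_cases h2 : α ∈ p ζ' ∧ β ∈ p ζ'
    · exact hpE ζ' α h2.1 β h2.2 hαβ
    rw [Finset.mem_union] at hα hβ
    have hr' := hpr ζ ζ' hne
    have hr'' := hpr ζ' ζ hne.symm
    rcases hα with hα | hα
    · have hβ' : β ∈ p ζ' := by tauto
      refine (h α (Finset.mem_sdiff.2 ⟨hα, fun hαr => ?_⟩) β
        (Finset.mem_sdiff.2 ⟨hβ', fun hβr => ?_⟩)).2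
      · exact h2 ⟨hr' α hα hαr, hβ'⟩
      · exact h1 ⟨hα, hr'' β hβ' hβr⟩
    · have hβ' : β ∈ p ζ := by tauto
      refine absurd (h β (Finset.mem_sdiff.2 ⟨hβ', fun hβr => ?_⟩) α
        (Finset.mem_sdiff.2 ⟨hα, fun hαr => ?_⟩)).1 hαβ.not_gt
      · exact h2 ⟨hα, hr' β hβ' hβr⟩
      · exact h1 ⟨hr'' α hα hαr, hβ'⟩

theorem HasChainCondition.sum {c : Cardinal.{u}} (hc : c.IsRegular) {X Y : Type u}
    [TopologicalSpace X] [TopologicalSpace Y] (hX : HasChainCondition c X)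
    (hY : HasChainCondition c Y) : HasChainCondition c (X ⊕ Y) := by
  intro U hU
  obtain ⟨b, e, he, hb⟩ := exists_injective_comp_eq hc (B := ULift.{u} Prop)
    ((lt_aleph0_of_finite _).trans_le hc.aleph0_le)
    fun ζ => ⟨(Sum.inl ⁻¹' U ζ).Nonempty⟩
  by_cases h : b.down
  · obtain ⟨ζ, ζ', hne, x, hx⟩ := hX (fun ζ => Sum.inl ⁻¹' U (e ζ)) fun ζ =>
      ⟨(hU _).1.preimage continuous_inl, by
        have := congrArg ULift.down (hb ζ)
        exact this.mpr h⟩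
    exact ⟨e ζ, e ζ', fun h => hne (he h), _, hx⟩
  · obtain ⟨ζ, ζ', hne, x, hx⟩ := hY (fun ζ => Sum.inr ⁻¹' U (e ζ)) fun ζ =>
      ⟨(hU _).1.preimage continuous_inr, by
        have := congrArg ULift.down (hb ζ)
        obtain ⟨x | x, hx⟩ := (hU (e ζ)).2
        · exact absurd (this.mp ⟨x, hx⟩) h
        · exact ⟨x, hx⟩⟩
    exact ⟨e ζ, e ζ', fun h => hne (he h), _, hx⟩

theorem hasChainCondition_of_mk_lt {c : Cardinal.{u}} {X : Type u} [TopologicalSpace X]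
    (hX : #X < c) : HasChainCondition c X := by
  intro U hU
  by_contra! hcon
  choose x hx using fun ζ => (hU ζ).2
  have hinj : Function.Injective x := by
    intro ζ ζ' h
    by_contra hne
    exact Set.notMem_empty (x ζ) (hcon ζ ζ' hne ▸ ⟨hx ζ, h ▸ hx ζ'⟩)
  have := mk_le_of_injective hinj
  rw [mk_ord_toType] at this
  exact this.not_gt hX

section cellularity

variable {X : Type u} [TopologicalSpace X] {c : Cardinal.{u}}

theorem cellularity'_le_of_hasChainCondition (hX : HasChainCondition c X) :
    cellularity' X ≤ c := by
  refine csInf_le' ?_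
  rintro ⟨S, ⟨hS, hd⟩, hSc⟩
  obtain ⟨e⟩ := Cardinal.eq.1 ((mk_ord_toType c).trans hSc.symm)
  obtain ⟨ζ, ζ', hne, hmeet⟩ := hX (fun ζ => (e ζ).1) fun ζ => hS _ (e ζ).2
  have := hd (e ζ).2 (e ζ').2 fun h => hne (e.injective (Subtype.ext h))
  exact Set.not_disjoint_iff_nonempty_inter.2 hmeet this

theorem lt_cellularity' {ι : Type u} (U : ι → Set X) (hU : ∀ i, IsOpen (U i) ∧ (U i).Nonempty)
    (hd : ∀ i j, i ≠ j → Disjoint (U i) (U j)) : #ι < cellularity' X := by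
  have hne : {μ : Cardinal.{u} | ¬ ∃ S : Set (Set X), IsCellularFamily S ∧ #S = μ}.Nonempty := by
    refine ⟨succ #(Set X), ?_⟩
    rintro ⟨S, _, hS⟩
    exact ((mk_set_le S).trans_lt (lt_succ _)).ne hS
  by_contra! hle
  apply csInf_mem hne
  change cellularity' X ≤ #ι at hle
  obtain ⟨s, hs⟩ := le_mk_iff_exists_set.1 hle
  have hinj : Function.Injective U := by
    intro i j h
    by_contra hij
    have := hd i j hij
    rw [h, disjoint_self] at this
    exact (hU j).2.ne_empty this
  refine ⟨U '' s, ⟨?_, ?_⟩, (mk_image_eq hinj).trans hs⟩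
  · rintro _ ⟨i, _, rfl⟩
    exact hU i
  · rintro _ ⟨i, _, rfl⟩ _ ⟨j, _, rfl⟩ hij
    exact hd i j fun h => hij (h ▸ rfl)

end cellularity

/-! ### The product space -/

theorem exists_cofinal_compl_cofinal {μ : Cardinal.{u}} (hμ : ℵ₀ ≤ μ) :
    ∃ U : Set μ.ord.ToType, (∀ i₀, ∃ i ≥ i₀, i ∈ U) ∧ ∀ i₀, ∃ i ≥ i₀, i ∉ U := by
  have hcard : #(μ.ord.ToType × ULift.{u} Bool) ≤ #μ.ord.ToType := by
    rw [mk_prod, lift_id, lift_id, mk_ord_toType]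
    exact (mul_eq_left hμ ((lt_aleph0_of_finite _).le.trans hμ) (by simp)).le
  obtain ⟨φ⟩ := hcard
  have key : ∀ b i₀, ∃ i, φ (i, b) ≥ i₀ := by
    intro b i₀
    by_contra! hlt
    have hinj : Function.Injective fun i => (⟨φ (i, b), hlt i⟩ : Set.Iio i₀) := by
      intro i j h
      simpa using φ.injective (Subtype.ext_iff.1 h)
    have := mk_le_of_injective hinj
    rw [mk_ord_toType] at this
    exact this.not_gt (mk_Iio_ord_toType_lt i₀)
  refine ⟨Set.range fun i => φ (i, ⟨true⟩), fun i₀ => ?_, fun i₀ => ?_⟩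
  · obtain ⟨i, hi⟩ := key ⟨true⟩ i₀
    exact ⟨_, hi, i, rfl⟩
  · obtain ⟨i, hi⟩ := key ⟨false⟩ i₀
    refine ⟨_, hi, ?_⟩
    rintro ⟨j, hj⟩
    simpa using φ.injective hj

theorem isOpen_setOf_apply_eq_true {V : Type u} [LinearOrder V] {E : V → V → Prop} (α : V) :
    IsOpen {x : cliques E | x.1 α = true} :=
  (isOpen_discrete {true}).preimage (f := fun x : cliques E => x.1 α)
    ((continuous_apply α).comp continuous_subtype_val)

theorem exists_cliques_apply_eq_true {V : Type u} [LinearOrder V] (E : V → V → Prop) (α : V) :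
    ∃ x : cliques E, x.1 α = true := by
  refine ⟨⟨_, indicator_mem_cliques {α} ?_⟩, by simp⟩
  intro β hβ γ hγ h
  rw [Finset.mem_singleton] at hβ hγ
  exact absurd h (by simp [hβ, hγ])

/-- If no pair is an edge of both graphs, then the square of a space containing both clique spaces
as open subspaces has at least as many disjoint open sets as there are vertices. -/
theorem mk_lt_cellularity'_prod_self {V : Type u} [LinearOrder V] {E₀ E₁ : V → V → Prop}
    (hE : ∀ α β, E₀ α β → ¬ E₁ α β) (Y : Type u) [TopologicalSpace Y] :
    #V < cellularity' (((cliques E₀ ⊕ cliques E₁) ⊕ Y) × ((cliques E₀ ⊕ cliques E₁) ⊕ Y)) := by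
  refine lt_cellularity' (fun α : V =>
    ((Sum.inl ∘ Sum.inl) '' {x : cliques E₀ | x.1 α = true}) ×ˢ
      ((Sum.inl ∘ Sum.inr) '' {x : cliques E₁ | x.1 α = true})) (fun α => ⟨?_, ?_⟩) ?_
  · exact ((isOpenMap_inl.comp isOpenMap_inl) _ (isOpen_setOf_apply_eq_true α)).prod
      ((isOpenMap_inl.comp isOpenMap_inr) _ (isOpen_setOf_apply_eq_true α))
  · exact Set.Nonempty.prod (Set.Nonempty.image _ (exists_cliques_apply_eq_true E₀ α))
      (Set.Nonempty.image _ (exists_cliques_apply_eq_true E₁ α))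
  · intro α β hne
    rw [Set.disjoint_left]
    rintro _ ⟨⟨x, hxα, hx⟩, y, hyα, hy⟩ ⟨⟨x', hxβ, hx'⟩, y', hyβ, hy'⟩
    obtain rfl : x = x' := by simpa using hx.trans hx'.symm
    obtain rfl : y = y' := by simpa using hy.trans hy'.symm
    rcases lt_or_gt_of_ne hne with h | h
    · exact hE α β (x.2 α β h hxα hxβ) (y.2 α β h hyα hyβ)
    · exact hE β α (x.2 β α h hxβ hxα) (y.2 β α h hyβ hyα)

/-- The singletons of `D` are disjoint open sets in a space containing its one-point
compactification as an open subspace. -/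
theorem mk_lt_cellularity'_sum_onePoint (D : Type u) [TopologicalSpace D] [DiscreteTopology D]
    (X : Type u) [TopologicalSpace X] : #D < cellularity' (X ⊕ OnePoint D) := by
  refine lt_cellularity' (fun d : D => (Sum.inr ∘ OnePoint.some) '' {d}) (fun d => ⟨?_, ?_⟩) ?_
  · exact (isOpenMap_inr.comp OnePoint.isOpenMap_coe) _ (isOpen_discrete _)
  · exact (Set.singleton_nonempty d).image _
  · intro d d' h
    simpa using h

theorem stmt_6 (κ : Cardinal.{u}) (hκ : ℵ₀ ≤ κ) (hsing : κ.ord.cof < κ) :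
    ∃ (X : Type u) (_ : TopologicalSpace X),
      CompactSpace X ∧ T2Space X ∧ TotallyDisconnectedSpace X ∧
      cellularity' X = Order.succ κ ∧ Order.succ κ < cellularity' (X × X) := by
  have hω : ℵ₀ ≤ κ.ord.cof := Ordinal.aleph0_le_cof_iff.2
    (Ordinal.one_lt_cof_iff.2 (isSuccLimit_ord hκ))
  obtain ⟨F, G, hFG, hG⟩ := exists_isScale hκ hsing
  obtain ⟨U, hU, hU'⟩ := exists_cofinal_compl_cofinal hω
  have : Nonempty κ.ord.cof.ord.ToType := by
    rw [← mk_ne_zero_iff, mk_ord_toType]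
    exact (aleph0_pos.trans_le hω).ne'
  have hcc : ∀ W : Set κ.ord.cof.ord.ToType, (∀ i₀, ∃ i ≥ i₀, i ∈ W) →
      HasChainCondition (succ κ) (cliques fun α β => ∃ i ∈ W, IsLastReversal F i α β) := by
    intro W hW
    refine hasChainCondition_cliques (isRegular_succ hκ) (hκ.trans_lt (lt_succ κ))
      fun a hne hd => ?_
    obtain ⟨i₀, h₀⟩ := IsScale.exists_isLastReversal hκ (by simpa using hsing.le) hFG hG hne hd
    obtain ⟨i, hi, hiW⟩ := hW i₀
    obtain ⟨ζ, ζ', hζ, h⟩ := h₀ i hi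
    exact ⟨ζ, ζ', hζ, fun α hα β hβ => ⟨(h α hα β hβ).1, i, hiW, (h α hα β hβ).2⟩⟩
  let : TopologicalSpace κ.ord.ToType := ⊥
  have : DiscreteTopology κ.ord.ToType := ⟨rfl⟩
  have hone : #(OnePoint κ.ord.ToType) < succ κ := by
    rw [show #(OnePoint κ.ord.ToType) = #κ.ord.ToType + 1 from mk_option, mk_ord_toType,
      add_one_eq hκ]
    exact lt_succ κ
  refine ⟨(cliques (fun α β => ∃ i ∈ U, IsLastReversal F i α β) ⊕
    cliques (fun α β => ∃ i ∈ Uᶜ, IsLastReversal F i α β)) ⊕ OnePoint κ.ord.ToType,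
    inferInstance, inferInstance, inferInstance, inferInstance, le_antisymm ?_ ?_, ?_⟩
  · exact cellularity'_le_of_hasChainCondition (((hcc U hU).sum (isRegular_succ hκ)
      (hcc Uᶜ hU')).sum (isRegular_succ hκ) (hasChainCondition_of_mk_lt hone))
  · refine succ_le_of_lt ?_
    simpa only [mk_ord_toType] using mk_lt_cellularity'_sum_onePoint κ.ord.ToType
      (cliques (fun α β => ∃ i ∈ U, IsLastReversal F i α β) ⊕
        cliques (fun α β => ∃ i ∈ Uᶜ, IsLastReversal F i α β))
  · refine (mk_ord_toType (succ κ)).symm.trans_lt (mk_lt_cellularity'_prod_self (fun α β => ?_) _)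
    rintro ⟨i, hi, h⟩ ⟨j, hj, h'⟩
    exact hj (h.index_unique h' ▸ hi)
end
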